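/- Let c, d ≥ 5 be integers with c ≠ d and let P = conv{(0,0),(c,0),(0,d)}. Then for a generic polynomial f ∈ ℂ^{P∩ℤ²} (i.e., a generic quasihomogeneous polynomial of degree (c,d)): the number of inflection points of the curve {f=0} in the torus T equals 3cd − 2c − 2d, and the number of lines in T tangent to {f=0} at two distinct points of T equals (c²d² − 11cd + 6c + 6d)/2. -/

import Mathlib

open scoped Pointwise
open MvPolynomial

noncomputable section

/-- The torus `(ℂ ∖ {0})²`. -/
def Torus : Set (ℂ × ℂ) := {p | p.1 ≠ 0 ∧ p.2 ≠ 0}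

/-- Evaluation of a bivariate polynomial at a point of `ℂ²`. -/
def evalP (f : MvPolynomial (Fin 2) ℂ) (p : ℂ × ℂ) : ℂ :=
  MvPolynomial.eval (fun i => if i = 0 then p.1 else p.2) f

/-- The affine line through `p` with direction `w`, as a subset of `ℂ²`. -/
def lineThrough (p w : ℂ × ℂ) : Set (ℂ × ℂ) :=
  {q | ∃ t : ℂ, q = (p.1 + t * w.1, p.2 + t * w.2)}

/-- The univariate polynomial `t ↦ f (p + t • w)`. -/
def lineRestrict (f : MvPolynomial (Fin 2) ℂ) (p w : ℂ × ℂ) : Polynomial ℂ :=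
  MvPolynomial.aeval
    (fun i => if i = 0 then Polynomial.C p.1 + Polynomial.C w.1 * Polynomial.X
              else Polynomial.C p.2 + Polynomial.C w.2 * Polynomial.X) f

/-- Intersection multiplicity at `p` of the curve `{f = 0}` and the line through `p`
with direction `w` (as `ℕ∞`; it is `⊤` if the line lies inside the curve). -/
def interMult (f : MvPolynomial (Fin 2) ℂ) (p w : ℂ × ℂ) : ℕ∞ :=
  if lineRestrict f p w = 0 then ⊤
  else (Polynomial.rootMultiplicity 0 (lineRestrict f p w) : ℕ∞)

/-- The point of `ℝ²` corresponding to a lattice point. -/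
def rpt (k : ℤ × ℤ) : ℝ × ℝ := ((k.1 : ℝ), (k.2 : ℝ))

/-- The support of `f` is contained in `S ⊆ ℤ²`. -/
def SuppIn (f : MvPolynomial (Fin 2) ℂ) (S : Set (ℤ × ℤ)) : Prop :=
  ∀ m ∈ f.support, ((m 0 : ℤ), (m 1 : ℤ)) ∈ S

/-- The coefficient of `f` at the exponent `k ∈ ℤ²`. -/
def coeffAt (f : MvPolynomial (Fin 2) ℂ) (k : ℤ × ℤ) : ℂ :=
  if 0 ≤ k.1 ∧ 0 ≤ k.2 then
    f.coeff (Finsupp.single (0 : Fin 2) k.1.toNat + Finsupp.single (1 : Fin 2) k.2.toNat)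
  else 0

/-- A property `Q` holds for a generic polynomial supported in `S`: there is a nonzero
polynomial `D` in variables indexed by `S` such that `Q f` holds for every `f` with
support in `S` whose coefficient tuple is not annihilated by `D`. -/
def GenericOn (S : Set (ℤ × ℤ)) (Q : MvPolynomial (Fin 2) ℂ → Prop) : Prop :=
  ∃ D : MvPolynomial S ℂ, D ≠ 0 ∧
    ∀ f : MvPolynomial (Fin 2) ℂ, SuppIn f S →
      MvPolynomial.eval (fun k => coeffAt f k.1) D ≠ 0 → Q f

/-- `P` is a lattice polygon: the convex hull of finitely many lattice points. -/
def IsLatticePolygon (P : Set (ℝ × ℝ)) : Prop :=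
  ∃ V : Finset (ℤ × ℤ), V.Nonempty ∧ P = convexHull ℝ (rpt '' (V : Set (ℤ × ℤ)))

/-- The standard triangle `Δ = conv {(0,0), (1,0), (0,1)}`. -/
def stdTriangle : Set (ℝ × ℝ) := convexHull ℝ {(0, 0), (1, 0), (0, 1)}

/-- The lattice points of a subset of `ℝ²`. -/
def latticePts (P : Set (ℝ × ℝ)) : Set (ℤ × ℤ) := {k | rpt k ∈ P}

/-- The support set (face) of `P` in the direction of the covector `γ`. -/
def face (P : Set (ℝ × ℝ)) (γ : ℤ × ℤ) : Set (ℝ × ℝ) :=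
  {p ∈ P | ∀ q ∈ P, (γ.1 : ℝ) * q.1 + (γ.2 : ℝ) * q.2 ≤ (γ.1 : ℝ) * p.1 + (γ.2 : ℝ) * p.2}

/-- The lattice length of the face of `P` in direction `γ`. -/
def lenFace (P : Set (ℝ × ℝ)) (γ : ℤ × ℤ) : ℕ := (latticePts (face P γ)).ncard - 1

/-- The Euclidean area of a subset of `ℝ²`. -/
def areaOf (P : Set (ℝ × ℝ)) : ℝ := (MeasureTheory.volume P).toReal

/-- The set of inflection points of `{f = 0}` in the torus. -/
def inflPts (f : MvPolynomial (Fin 2) ℂ) : Set (ℂ × ℂ) :=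
  {p | p ∈ Torus ∧ evalP f p = 0 ∧ ∃ w : ℂ × ℂ, w ≠ 0 ∧ 3 ≤ interMult f p w}

/-- The set of lines (as subsets of `ℂ²`) tangent to `{f = 0}` at two distinct
points of the torus. -/
def bitangentLines (f : MvPolynomial (Fin 2) ℂ) : Set (Set (ℂ × ℂ)) :=
  {l | ∃ p w q₁ q₂ : ℂ × ℂ, w ≠ 0 ∧ l = lineThrough p w ∧
    q₁ ∈ lineThrough p w ∩ Torus ∧ q₂ ∈ lineThrough p w ∩ Torus ∧ q₁ ≠ q₂ ∧
    2 ≤ interMult f q₁ w ∧ 2 ≤ interMult f q₂ w}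

/-- `P` contains a lattice translate of `5Δ`. -/
def Contains5Delta (P : Set (ℝ × ℝ)) : Prop :=
  ∃ t : ℤ × ℤ, rpt t +ᵥ ((5 : ℝ) • stdTriangle) ⊆ P

theorem GenericOn.mono {S : Set (ℤ × ℤ)} {P Q : MvPolynomial (Fin 2) ℂ → Prop}
    (h : GenericOn S P) (hPQ : ∀ f, SuppIn f S → P f → Q f) : GenericOn S Q := by
  obtain ⟨D, hD, hP⟩ := h
  exact ⟨D, hD, fun f hf hDf => hPQ f hf (hP f hf hDf)⟩

theorem GenericOn.and {S : Set (ℤ × ℤ)} {P Q : MvPolynomial (Fin 2) ℂ → Prop}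
    (hP : GenericOn S P) (hQ : GenericOn S Q) : GenericOn S (fun f => P f ∧ Q f) := by
  obtain ⟨D, hD, hP⟩ := hP
  obtain ⟨E, hE, hQ⟩ := hQ
  refine ⟨D * E, mul_ne_zero hD hE, fun f hf hDE => ?_⟩
  rw [map_mul] at hDE
  exact ⟨hP f hf (left_ne_zero_of_mul hDE), hQ f hf (right_ne_zero_of_mul hDE)⟩

theorem genericOn_coeffAt_ne_zero {S : Set (ℤ × ℤ)} {k : ℤ × ℤ} (hk : k ∈ S) :
    GenericOn S (fun f => coeffAt f k ≠ 0) :=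
  ⟨X ⟨k, hk⟩, X_ne_zero _, fun f _ h => by simpa using h⟩

/-- The coefficient tuples parametrized by polynomials in fewer variables are avoided by a
generic polynomial. -/
theorem genericOn_of_param {S : Set (ℤ × ℤ)} [Fintype S] {σ : Type} [Fintype σ]
    (hcard : Fintype.card σ < Fintype.card S) (θ : S → MvPolynomial σ ℂ) :
    GenericOn S (fun f => ∀ u : σ → ℂ, ∃ k : S, coeffAt f k ≠ eval u (θ k)) := by
  have hdep : ¬ AlgebraicIndependent ℂ θ := by
    intro h
    have h1 := h.cardinalMk_le_trdeg
    rw [MvPolynomial.trdeg_of_isDomain] at h1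
    simp only [Cardinal.mk_fintype, Cardinal.lift_natCast] at h1
    have h2 : Fintype.card S ≤ Fintype.card σ := by exact_mod_cast h1
    omega
  rw [algebraicIndependent_iff] at hdep
  push Not at hdep
  obtain ⟨D, hD0, hD⟩ := hdep
  refine ⟨D, hD, fun f _ hDf u => ?_⟩
  by_contra! hcon
  apply hDf
  have h1 : (fun k : S => coeffAt f k.1) = fun k => eval u (θ k) := funext hcon
  rw [h1]
  have h2 := congrArg (eval u) hD0
  rw [map_zero] at h2
  rw [← h2, ← MvPolynomial.coe_aeval_eq_eval, ← MvPolynomial.coe_aeval_eq_eval]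
  change aeval _ D = ((aeval u).comp (aeval θ)) D
  rw [comp_aeval]
  simp only [MvPolynomial.aeval_eq_eval]
  rfl

/-- For a system of `n + 1` linear conditions depending polynomially on `n` parameters, in the
coefficients of `f`, which is in echelon form, a generic `f` satisfies none of its members. -/
theorem genericOn_linear {S : Set (ℤ × ℤ)} [Fintype S] {n : ℕ}
    (ψ : S → Fin (n + 1) → MvPolynomial (Fin n) ℂ) (ι : Fin (n + 1) → S)
    (hι : Function.Injective ι) (hψ : ∀ j i, ψ (ι j) i = if i = j then 1 else 0) :
    GenericOn S (fun f => ∀ u : Fin n → ℂ,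
      ∃ i, ∑ k : S, coeffAt f k * eval u (ψ k i) ≠ 0) := by
  classical
  let τ := {k : S // k ∉ Set.range ι}
  have hcard : Fintype.card (Fin n ⊕ τ) < Fintype.card S := by
    have h1 : Fintype.card τ = Fintype.card S - Fintype.card {k : S // k ∈ Set.range ι} :=
      Fintype.card_subtype_compl _
    have h2 : Fintype.card {k : S // k ∈ Set.range ι} = n + 1 := by
      exact (Fintype.card_congr (Equiv.ofInjective ι hι)).symm.trans (Fintype.card_fin (n + 1))
    have h3 : Fintype.card {k : S // k ∈ Set.range ι} ≤ Fintype.card S :=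
      Fintype.card_subtype_le _
    rw [Fintype.card_sum, Fintype.card_fin]
    omega
  let θ : S → MvPolynomial (Fin n ⊕ τ) ℂ := fun k =>
    if h : k ∈ Set.range ι then
      - ∑ l : τ, X (Sum.inr l) * rename Sum.inl (ψ l.1 h.choose)
    else X (Sum.inr ⟨k, h⟩)
  refine (genericOn_of_param hcard θ).mono fun f _ hf u => ?_
  by_contra! hcon
  obtain ⟨k, hk⟩ := hf (Sum.elim u fun l => coeffAt f l.1)
  apply hk
  by_cases h : k ∈ Set.range ι
  · have hj := h.choose_spec
    set j := h.choose with hjdef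
    have h1 := hcon j
    have h2 : ∑ k : S, coeffAt f k * eval u (ψ k j)
        = coeffAt f k + ∑ l : τ, coeffAt f l.1 * eval u (ψ l.1 j) := by
      have hsplit := Fintype.sum_subtype_add_sum_subtype (fun k : S => k ∈ Set.range ι)
        (fun k : S => coeffAt f k * eval u (ψ k j))
      rw [← hsplit]
      congr 1
      rw [Finset.sum_eq_single (⟨k, h⟩ : {k : S // k ∈ Set.range ι})]
      · have h3 : ψ k j = 1 := by
          conv_lhs => rw [← hj]
          rw [hψ, if_pos rfl]
        simp [h3]
      · rintro ⟨b, jb, rfl⟩ _ hne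
        rw [hψ, if_neg]
        · simp
        · rintro rfl
          exact hne (Subtype.ext hj)
      · simp
    simp only [θ, dif_pos h, map_neg, map_sum, map_mul, eval_X, Sum.elim_inr]
    rw [h2] at h1
    simp only [eval_rename, Sum.elim_comp_inl]
    exact eq_neg_of_add_eq_zero_left h1
  · simp only [θ, dif_neg h, eval_X, Sum.elim_inr]

/-- The exponents of the quasihomogeneous polynomials of degree `(c, d)`. -/
def qhExponents (c d : ℕ) : Set (ℤ × ℤ) :=
  {k | 0 ≤ k.1 ∧ 0 ≤ k.2 ∧ (d : ℤ) * k.1 + (c : ℤ) * k.2 ≤ (c : ℤ) * (d : ℤ)}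

theorem qhExponents_finite {c d : ℕ} (hc : 0 < c) (hd : 0 < d) : (qhExponents c d).Finite := by
  refine ((Set.finite_Icc (0 : ℤ) c).prod (Set.finite_Icc (0 : ℤ) d)).subset ?_
  rintro ⟨i, j⟩ ⟨hi, hj, hij⟩
  simp only at hi hj hij
  have hc' : (0 : ℤ) < c := by exact_mod_cast hc
  have hd' : (0 : ℤ) < d := by exact_mod_cast hd
  refine ⟨⟨hi, ?_⟩, ⟨hj, ?_⟩⟩
  · have : 0 ≤ (c : ℤ) * j := by positivity
    nlinarith
  · have : 0 ≤ (d : ℤ) * i := by positivity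
    nlinarith

theorem aeval_eq_sum_coeffAt {S : Set (ℤ × ℤ)} [Fintype S] (hS : ∀ k ∈ S, 0 ≤ k.1 ∧ 0 ≤ k.2)
    {f : MvPolynomial (Fin 2) ℂ} (hf : SuppIn f S) {A : Type*} [CommRing A] [Algebra ℂ A]
    (g : Fin 2 → A) :
    aeval g f = ∑ k : S, coeffAt f k • (g 0 ^ k.1.1.toNat * g 1 ^ k.1.2.toNat) := by
  classical
  rw [aeval_def, eval₂_eq']
  have h1 : ∑ k : S, coeffAt f k • (g 0 ^ k.1.1.toNat * g 1 ^ k.1.2.toNat)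
      = ∑ k ∈ S.toFinset, coeffAt f k • (g 0 ^ k.1.toNat * g 1 ^ k.2.toNat) :=
    (Finset.sum_subtype S.toFinset (fun x => Set.mem_toFinset)
      (fun k => coeffAt f k • (g 0 ^ k.1.toNat * g 1 ^ k.2.toNat))).symm
  have hm : ∀ m : Fin 2 →₀ ℕ, Finsupp.single 0 (m 0) + Finsupp.single 1 (m 1) = m := by
    intro m
    ext i
    fin_cases i <;> simp
  rw [h1]
  refine Finset.sum_of_injOn (fun m => ((m 0 : ℤ), (m 1 : ℤ))) ?_ ?_ ?_ ?_
  · intro m _ m' _ h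
    simp only [Prod.mk.injEq, Nat.cast_inj] at h
    rw [← hm m, ← hm m', h.1, h.2]
  · intro m hmf
    simpa using hf m hmf
  · rintro ⟨i, j⟩ hk hk'
    have hk0 := hS _ (Set.mem_toFinset.1 hk)
    simp only at hk0
    suffices h : coeffAt f (i, j) = 0 by rw [h, zero_smul]
    rw [coeffAt, if_pos hk0]
    by_contra hne
    refine hk' ⟨_, Finsupp.mem_support_iff.2 hne, ?_⟩
    simp [hk0]
  · intro m _
    rw [coeffAt, if_pos (by simp), Algebra.smul_def, Fin.prod_univ_two]
    simp [hm]

/-- A generic `f` does not become divisible by a monic polynomial of degree `n + 1` after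
substituting a curve, when everything depends on `n` parameters. -/
theorem genericOn_not_dvd {S : Set (ℤ × ℤ)} [Fintype S] (hS : ∀ k ∈ S, 0 ≤ k.1 ∧ 0 ≤ k.2) {n : ℕ}
    (A B M : Polynomial (MvPolynomial (Fin n) ℂ)) (hM : M.Monic) (hMn : M.natDegree = n + 1)
    (ι : Fin (n + 1) → S) (hι : Function.Injective ι)
    (hAB : ∀ j, A ^ (ι j).1.1.toNat * B ^ (ι j).1.2.toNat = Polynomial.X ^ (j : ℕ)) :
    GenericOn S (fun f => ∀ u : Fin n → ℂ, ¬ M.map (eval u) ∣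
      aeval (fun i : Fin 2 => if i = 0 then A.map (eval u) else B.map (eval u)) f) := by
  refine (genericOn_linear
    (fun k i => ((A ^ k.1.1.toNat * B ^ k.1.2.toNat) %ₘ M).coeff i) ι hι ?_).mono ?_
  · intro j i
    rw [hAB, (Polynomial.modByMonic_eq_self_iff hM).2, Polynomial.coeff_X_pow]
    · simp [Fin.ext_iff]
    · rw [Polynomial.degree_X_pow, Polynomial.degree_eq_natDegree hM.ne_zero, hMn]
      exact_mod_cast j.2
  · intro f hfS hf u hdvd
    obtain ⟨i, hi⟩ := hf u
    apply hi
    have hMu : (M.map (eval u)).Monic := hM.map _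
    have h1 := (Polynomial.modByMonic_eq_zero_iff_dvd hMu).2 hdvd
    rw [aeval_eq_sum_coeffAt hS hfS] at h1
    have h2 := congrArg (fun q : Polynomial ℂ => q.coeff (i : ℕ)) h1
    have h3 : ∀ q, q %ₘ M.map (eval u) = Polynomial.modByMonicHom (M.map (eval u)) q :=
      fun q => rfl
    simp only [h3, map_sum, map_smul, Polynomial.finsetSum_coeff, Polynomial.coeff_smul,
      Polynomial.coeff_zero, smul_eq_mul] at h2
    rw [← h2]
    refine Finset.sum_congr rfl fun k _ => ?_
    rw [← h3, ← Polynomial.coeff_map, Polynomial.map_modByMonic _ hM]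
    simp

theorem genericOn_line {c d n : ℕ} (hnc : n ≤ c) (hc : 0 < c) (hd : 0 < d)
    (b m : MvPolynomial (Fin n) ℂ)
    (M : Polynomial (MvPolynomial (Fin n) ℂ)) (hM : M.Monic) (hMn : M.natDegree = n + 1) :
    GenericOn (qhExponents c d) (fun f => ∀ u : Fin n → ℂ, ¬ M.map (eval u) ∣
      lineRestrict f (0, eval u b) (1, eval u m)) := by
  have := (qhExponents_finite hc hd).fintype
  refine (genericOn_not_dvd (fun k hk => ⟨hk.1, hk.2.1⟩) Polynomial.X
    (Polynomial.C b + Polynomial.C m * Polynomial.X) M hM hMn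
    (fun j => ⟨((j : ℕ), 0), ?_⟩) ?_ ?_).mono ?_
  · refine ⟨by simp, by simp, ?_⟩
    have : (j : ℕ) ≤ c := by omega
    have h2 : ((j : ℕ) : ℤ) ≤ c := by exact_mod_cast this
    simp only [mul_zero, add_zero]
    nlinarith
  · intro i j h
    have h2 : ((i : ℕ) : ℤ) = ((j : ℕ) : ℤ) := congrArg (fun z => z.1.1) h
    exact Fin.ext (by exact_mod_cast h2)
  · intro j
    simp
  · intro f _ hf u
    have := hf u
    simpa [lineRestrict] using this

theorem genericOn_vertical {c d n : ℕ} (hnd : n ≤ d) (hc : 0 < c) (hd : 0 < d)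
    (a : MvPolynomial (Fin n) ℂ)
    (M : Polynomial (MvPolynomial (Fin n) ℂ)) (hM : M.Monic) (hMn : M.natDegree = n + 1) :
    GenericOn (qhExponents c d) (fun f => ∀ u : Fin n → ℂ, ¬ M.map (eval u) ∣
      lineRestrict f (eval u a, 0) (0, 1)) := by
  have := (qhExponents_finite hc hd).fintype
  refine (genericOn_not_dvd (fun k hk => ⟨hk.1, hk.2.1⟩) (Polynomial.C a) Polynomial.X M hM hMn
    (fun j => ⟨(0, (j : ℕ)), ?_⟩) ?_ ?_).mono ?_
  · refine ⟨by simp, by simp, ?_⟩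
    have : (j : ℕ) ≤ d := by omega
    have h2 : ((j : ℕ) : ℤ) ≤ d := by exact_mod_cast this
    simp only [mul_zero, zero_add]
    nlinarith
  · intro i j h
    have h2 : ((i : ℕ) : ℤ) = ((j : ℕ) : ℤ) := congrArg (fun z => z.1.2) h
    exact Fin.ext (by exact_mod_cast h2)
  · intro j
    simp
  · intro f _ hf u
    have := hf u
    simpa [lineRestrict] using this

section UltrafilterLimits

open Filter Topology Asymptotics

theorem isBigO_of_ultrafilter {α : Type*} {l : Filter α} {f g : α → ℂ}
    (h : ∀ u : Ultrafilter α, ↑u ≤ l → f =O[(u : Filter α)] g) : f =O[l] g := by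
  by_contra hcon
  simp only [isBigO_iff, not_exists, not_eventually, not_le] at hcon
  let s : ℕ → Set α := fun n => {a | n * ‖g a‖ < ‖f a‖}
  have hs : Antitone s := by
    intro m n hmn a ha
    have h1 : (m : ℝ) ≤ n := by exact_mod_cast hmn
    exact (mul_le_mul_of_nonneg_right h1 (norm_nonneg _)).trans_lt ha
  have hl : (⨅ n, l ⊓ 𝓟 (s n)).NeBot := by
    have : Nonempty α := (hcon 0).exists.nonempty
    refine iInf_neBot_of_directed ?_ fun n => ?_
    · intro m n
      exact ⟨max m n, inf_le_inf_left _ (principal_mono.2 (hs (le_max_left _ _))),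
        inf_le_inf_left _ (principal_mono.2 (hs (le_max_right _ _)))⟩
    · exact frequently_mem_iff_neBot.1 (hcon n)
  obtain ⟨u, hu⟩ := exists_ultrafilter_le (⨅ n, l ⊓ 𝓟 (s n))
  have hul : ↑u ≤ l := hu.trans ((iInf_le _ 0).trans inf_le_left)
  obtain ⟨c, hc⟩ := isBigO_iff.1 (h u hul)
  obtain ⟨n, hn⟩ := exists_nat_ge c
  have h2 : ∀ᶠ a in (u : Filter α), n * ‖g a‖ < ‖f a‖ :=
    le_principal_iff.1 (hu.trans ((iInf_le _ n).trans inf_le_right))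
  obtain ⟨a, ha, ha'⟩ := (hc.and h2).exists
  exact absurd (ha.trans (mul_le_mul_of_nonneg_right hn (norm_nonneg _))) (not_le.2 ha')

theorem isTheta_of_ultrafilter {α : Type*} {l : Filter α} {f g : α → ℂ}
    (h : ∀ u : Ultrafilter α, ↑u ≤ l → f =Θ[(u : Filter α)] g) : f =Θ[l] g :=
  ⟨isBigO_of_ultrafilter fun u hu => (h u hu).1, isBigO_of_ultrafilter fun u hu => (h u hu).2⟩

theorem isTheta_one_of_tendsto {α : Type*} {l : Filter α} {f : α → ℂ} {z : ℂ}
    (h : Tendsto f l (𝓝 z)) (hz : z ≠ 0) : f =Θ[l] fun _ => (1 : ℂ) := by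
  have h2 : Tendsto (fun a => (1 : ℂ) / f a) l (𝓝 (1 / z)) := tendsto_const_nhds.div h hz
  exact isTheta_of_div_tendsto_nhds_ne_zero h2 (by simpa using hz)

theorem isTheta_of_tendsto_ne_zero {α : Type*} {l : Filter α} {f g : α → ℂ} {z w : ℂ}
    (hf : Tendsto f l (𝓝 z)) (hg : Tendsto g l (𝓝 w)) (hz : z ≠ 0) (hw : w ≠ 0) :
    f =Θ[l] g :=
  (isTheta_one_of_tendsto hf hz).trans (isTheta_one_of_tendsto hg hw).symm

theorem ultrafilter_tendsto_or {α : Type*} (u : Ultrafilter α) (z : α → ℂ) :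
    (∃ z₀, Tendsto z u (𝓝 z₀)) ∨ Tendsto (fun a => ‖z a‖) u atTop := by
  by_cases h : ∃ R : ℝ, ∀ᶠ a in (u : Filter α), ‖z a‖ ≤ R
  · obtain ⟨R, hR⟩ := h
    left
    have h1 : ((u.map z : Ultrafilter ℂ) : Filter ℂ) ≤ 𝓟 (Metric.closedBall 0 R) := by
      rw [le_principal_iff]
      change ∀ᶠ a in (u : Filter α), z a ∈ Metric.closedBall 0 R
      simpa using hR
    obtain ⟨z₀, -, hz₀⟩ := (isCompact_closedBall (0 : ℂ) R).ultrafilter_le_nhds _ h1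
    exact ⟨z₀, hz₀⟩
  · right
    rw [tendsto_atTop]
    intro R
    have h1 : ∀ᶠ a in (u : Filter α), ¬ ‖z a‖ ≤ R :=
      Ultrafilter.eventually_not.2 fun h2 => h ⟨R, h2⟩
    exact h1.mono fun a ha => (not_le.1 ha).le

/-- Coefficientwise convergence of polynomials. -/
def CoeffTendsto {α : Type*} (P : α → Polynomial ℂ) (l : Filter α) (Q : Polynomial ℂ) : Prop :=
  ∀ i, Tendsto (fun a => (P a).coeff i) l (𝓝 (Q.coeff i))

namespace CoeffTendsto

variable {α : Type*} {P P' : α → Polynomial ℂ} {l : Filter α} {Q Q' : Polynomial ℂ}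

theorem const (Q : Polynomial ℂ) : CoeffTendsto (fun _ : α => Q) l Q :=
  fun _ => tendsto_const_nhds

theorem add (h : CoeffTendsto P l Q) (h' : CoeffTendsto P' l Q') :
    CoeffTendsto (fun a => P a + P' a) l (Q + Q') := fun i => by
  simpa only [Polynomial.coeff_add] using (h i).add (h' i)

theorem mul (h : CoeffTendsto P l Q) (h' : CoeffTendsto P' l Q') :
    CoeffTendsto (fun a => P a * P' a) l (Q * Q') := fun i => by
  simp only [Polynomial.coeff_mul]
  exact tendsto_finsetSum _ fun x _ => (h x.1).mul (h' x.2)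

theorem pow (h : CoeffTendsto P l Q) (n : ℕ) : CoeffTendsto (fun a => P a ^ n) l (Q ^ n) := by
  induction n with
  | zero => simpa using CoeffTendsto.const 1
  | succ n ih => simpa only [pow_succ] using ih.mul h

theorem C {z : α → ℂ} {z₀ : ℂ} (h : Tendsto z l (𝓝 z₀)) :
    CoeffTendsto (fun a => Polynomial.C (z a)) l (Polynomial.C z₀) := fun i => by
  simp only [Polynomial.coeff_C]
  split_ifs
  · exact h
  · exact tendsto_const_nhds

theorem sum {ι : Type*} (s : Finset ι) {P : ι → α → Polynomial ℂ} {Q : ι → Polynomial ℂ}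
    (h : ∀ i ∈ s, CoeffTendsto (P i) l (Q i)) :
    CoeffTendsto (fun a => ∑ i ∈ s, P i a) l (∑ i ∈ s, Q i) := fun j => by
  simp only [Polynomial.finsetSum_coeff]
  exact tendsto_finsetSum _ fun i hi => h i hi j

theorem divX (h : CoeffTendsto P l Q) : CoeffTendsto (fun a => (P a).divX) l Q.divX := fun i => by
  simpa only [Polynomial.coeff_divX] using h (i + 1)

theorem derivative (h : CoeffTendsto P l Q) :
    CoeffTendsto (fun a => Polynomial.derivative (P a)) l (Polynomial.derivative Q) := fun i => by
  simp only [Polynomial.coeff_derivative]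
  exact (h (i + 1)).mul_const _

theorem natDegree_le [l.NeBot] {N : ℕ} (hN : ∀ a, (P a).natDegree ≤ N) (h : CoeffTendsto P l Q) :
    Q.natDegree ≤ N := by
  rw [Polynomial.natDegree_le_iff_coeff_eq_zero]
  intro i hi
  refine tendsto_nhds_unique (h i) ?_
  have : (fun a => (P a).coeff i) = fun _ => 0 :=
    funext fun a => Polynomial.coeff_eq_zero_of_natDegree_lt ((hN a).trans_lt hi)
  rw [this]
  exact tendsto_const_nhds

theorem eval [l.NeBot] {N : ℕ} (hN : ∀ a, (P a).natDegree ≤ N) (h : CoeffTendsto P l Q)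
    {z : α → ℂ} {z₀ : ℂ} (hz : Tendsto z l (𝓝 z₀)) :
    Tendsto (fun a => (P a).eval (z a)) l (𝓝 (Q.eval z₀)) := by
  have h1 : ∀ a, (P a).eval (z a) = ∑ i ∈ Finset.range (N + 1), (P a).coeff i * z a ^ i :=
    fun a => Polynomial.eval_eq_sum_range' (Nat.lt_succ_of_le (hN a)) _
  rw [Polynomial.eval_eq_sum_range' (Nat.lt_succ_of_le (h.natDegree_le hN)), funext h1]
  exact tendsto_finsetSum _ fun i _ => (h i).mul (hz.pow i)

theorem tendsto_root {u : Ultrafilter α} {N : ℕ} (hN : ∀ a, (P a).natDegree ≤ N)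
    (h : CoeffTendsto P u Q) (hQ : Q.coeff N ≠ 0) {z : α → ℂ}
    (hz : ∀ᶠ a in (u : Filter α), (P a).eval (z a) = 0) :
    ∃ z₀, Tendsto z u (𝓝 z₀) ∧ Q.eval z₀ = 0 := by
  rcases ultrafilter_tendsto_or u z with ⟨z₀, hz₀⟩ | hinf
  · refine ⟨z₀, hz₀, tendsto_nhds_unique (h.eval hN hz₀) ?_⟩
    exact tendsto_const_nhds.congr' (hz.mono fun a ha => ha.symm)
  · exfalso
    have hinv : Tendsto (fun a => (z a)⁻¹) u (𝓝 0) :=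
      tendsto_inv₀_cobounded.comp (tendsto_norm_atTop_iff_cobounded.1 hinf)
    have hr : CoeffTendsto (fun a => (P a).reflect N) u (Q.reflect N) := fun i => by
      simpa only [Polynomial.coeff_reflect] using h _
    have hrN : ∀ a, ((P a).reflect N).natDegree ≤ N := fun a =>
      Polynomial.natDegree_reflect_le.trans (by simp [hN a])
    have h2 := hr.eval hrN hinv
    have h3 : (Q.reflect N).eval 0 = Q.coeff N := by
      rw [← Polynomial.coeff_zero_eq_eval_zero, Polynomial.coeff_reflect, Polynomial.revAt_zero]
    rw [h3] at h2
    refine hQ (tendsto_nhds_unique h2 (tendsto_const_nhds.congr' ?_))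
    filter_upwards [hz, hinf.eventually_gt_atTop 0] with a ha ha'
    have hza : z a ≠ 0 := norm_pos_iff.1 ha'
    let := invertibleOfNonzero hza
    have h4 := Polynomial.eval₂_reflect_mul_pow (RingHom.id ℂ) (z a) N (P a) (hN a)
    rw [invOf_eq_inv, Polynomial.eval₂_id, Polynomial.eval₂_id, ha] at h4
    exact ((mul_eq_zero.1 h4).resolve_right (pow_ne_zero _ hza)).symm

end CoeffTendsto

theorem isTheta_prod_roots {α : Type*} {l : Filter α} {P : α → Polynomial ℂ} {N : ℕ}
    (hN : ∀ᶠ a in l, (P a).natDegree = N) (hP : ∀ᶠ a in l, P a ≠ 0) {g h : α → ℂ → ℂ}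
    (H : ∀ (z : α → ℂ) (u : Ultrafilter α), ↑u ≤ l →
      (∀ᶠ a in (u : Filter α), (P a).eval (z a) = 0) →
      (fun a => g a (z a)) =Θ[(u : Filter α)] fun a => h a (z a)) :
    (fun a => ((P a).roots.map (g a)).prod) =Θ[l] fun a => ((P a).roots.map (h a)).prod := by
  have hcard : ∀ᶠ a in l, (P a).roots.toList.length = N := hN.mono fun a ha => by
    rw [Multiset.length_toList, IsAlgClosed.card_roots_eq_natDegree, ha]
  let y : ℕ → α → ℂ := fun i a => (P a).roots.toList.getD i 0
  have hprod : ∀ g : α → ℂ → ℂ, (fun a => ((P a).roots.map (g a)).prod)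
      =ᶠ[l] fun a => ∏ i ∈ Finset.range N, g a (y i a) := fun g => hcard.mono fun a ha => by
    change ((P a).roots.map (g a)).prod = ∏ i ∈ Finset.range N, g a (y i a)
    rw [← ha, Finset.prod_range, ← Fin.prod_ofFn]
    conv_lhs => rw [← Multiset.coe_toList (P a).roots]
    rw [Multiset.map_coe, Multiset.prod_coe]
    congr 1
    refine List.ext_getElem (by simp) fun i h1 h2 => ?_
    simp [y]
  refine ((hprod g).isTheta.trans ?_).trans (hprod h).symm.isTheta
  have hmain : ∀ i ∈ Finset.range N, (fun a => g a (y i a)) =Θ[l] fun a => h a (y i a) := by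
    intro i hi
    refine isTheta_of_ultrafilter fun u hu => H _ u hu ?_
    filter_upwards [hu hcard, hu hP] with a ha ha'
    have hlt : i < (P a).roots.toList.length := ha.symm ▸ Finset.mem_range.1 hi
    have hmem : y i a ∈ (P a).roots.toList := by
      simp only [y, List.getD_eq_getElem _ _ hlt]
      exact List.getElem_mem _
    exact (Polynomial.mem_roots ha').1 (Multiset.mem_toList.1 hmem)
  exact IsTheta.finsetProd hmain

theorem pow_eq_of_isTheta {α : Type*} {l : Filter α} [l.NeBot] {z : α → ℂ}
    (hz : Tendsto z l (𝓝[≠] 0)) {m n : ℕ} (h : (fun a => z a ^ m) =Θ[l] fun a => z a ^ n) :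
    m = n := by
  wlog hmn : m < n generalizing m n
  · rcases lt_or_eq_of_le (not_lt.1 hmn) with h1 | h1
    · exact (this h.symm h1).symm
    · exact h1.symm
  exfalso
  obtain ⟨k, rfl⟩ := Nat.exists_eq_add_of_lt hmn
  have h0 : ∀ᶠ a in l, z a ≠ 0 := (tendsto_nhdsWithin_iff.1 hz).2
  have h1 : Tendsto z l (𝓝 0) := (tendsto_nhdsWithin_iff.1 hz).1
  have h2 := h.div (isTheta_refl (fun a => z a ^ m) l)
  have h3 : (fun _ : α => (1 : ℂ)) =Θ[l] fun a => z a ^ (k + 1) := by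
    refine (EventuallyEq.isTheta ?_).trans (h2.trans (EventuallyEq.isTheta ?_))
    · filter_upwards [h0] with a ha
      field_simp
    · filter_upwards [h0] with a ha
      field_simp
      ring
  have h4 : Tendsto (fun a => z a ^ (k + 1)) l (𝓝 0) := by
    simpa using h1.pow (k + 1)
  have h5 := h3.tendsto_zero_iff.2 h4
  exact one_ne_zero (tendsto_nhds_unique tendsto_const_nhds h5)

theorem Polynomial.eval_isTheta_pow {p : Polynomial ℂ} (hp : p ≠ 0) (x₀ : ℂ) :
    (fun x => p.eval x) =Θ[𝓝[≠] x₀] fun x => (x - x₀) ^ p.rootMultiplicity x₀ := by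
  obtain ⟨q, hq, hq0⟩ := Polynomial.exists_eq_pow_rootMultiplicity_mul_and_not_dvd p hp x₀
  have h1 : (fun x => p.eval x) = fun x => (x - x₀) ^ p.rootMultiplicity x₀ * q.eval x := by
    funext x
    conv_lhs => rw [hq]
    simp
  rw [h1]
  have h2 : (fun x => q.eval x) =Θ[𝓝[≠] x₀] fun _ => (1 : ℂ) :=
    isTheta_one_of_tendsto (q.continuous.continuousAt.tendsto.mono_left nhdsWithin_le_nhds)
      (fun h => hq0 (Polynomial.dvd_iff_isRoot.2 h))
  simpa using (isTheta_refl (fun x => (x - x₀) ^ p.rootMultiplicity x₀) _).mul h2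

theorem Polynomial.rootMultiplicity_eq_of_isTheta {p q : Polynomial ℂ} (hp : p ≠ 0) (hq : q ≠ 0)
    {x₀ : ℂ} (h : (fun x => p.eval x) =Θ[𝓝[≠] x₀] fun x => q.eval x) :
    p.rootMultiplicity x₀ = q.rootMultiplicity x₀ := by
  have h1 := (Polynomial.eval_isTheta_pow hp x₀).symm.trans
    (h.trans (Polynomial.eval_isTheta_pow hq x₀))
  have h2 : Tendsto (fun x => x - x₀) (𝓝[≠] x₀) (𝓝[≠] 0) := by
    rw [tendsto_nhdsWithin_iff]
    refine ⟨?_, ?_⟩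
    · have : Tendsto (fun x => x - x₀) (𝓝 x₀) (𝓝 (x₀ - x₀)) :=
        (continuous_id.sub continuous_const).tendsto x₀
      rw [sub_self] at this
      exact this.mono_left nhdsWithin_le_nhds
    · filter_upwards [self_mem_nhdsWithin] with x hx
      exact sub_ne_zero.2 hx
  exact pow_eq_of_isTheta h2 h1

theorem Polynomial.natDegree_eq_of_isTheta {p : Polynomial ℂ} {α : Type*} {l : Filter α} [l.NeBot]
    {ε : α → ℂ} (hε : Tendsto ε l (𝓝[≠] 0)) {w : ℕ}
    (h : (fun a => p.eval (ε a)⁻¹) =Θ[l] fun a => (ε a)⁻¹ ^ w) : p ≠ 0 ∧ p.natDegree = w := by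
  have h0 : ∀ᶠ a in l, ε a ≠ 0 := (tendsto_nhdsWithin_iff.1 hε).2
  have h1 : Tendsto ε l (𝓝 0) := (tendsto_nhdsWithin_iff.1 hε).1
  have hp : p ≠ 0 := by
    rintro rfl
    obtain ⟨a, ha, ha'⟩ := (h.eq_zero_iff.and h0).exists
    simp [ha'] at ha
  refine ⟨hp, ?_⟩
  have h2 : (fun a => p.reverse.eval (ε a)) =Θ[l] fun _ => (1 : ℂ) := by
    refine isTheta_one_of_tendsto ((p.reverse.continuous.tendsto 0).comp h1) ?_
    rw [← Polynomial.coeff_zero_eq_eval_zero, Polynomial.coeff_zero_reverse]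
    exact Polynomial.leadingCoeff_ne_zero.2 hp
  have h3 : (fun a => p.eval (ε a)⁻¹) =ᶠ[l]
      fun a => p.reverse.eval (ε a) * (ε a)⁻¹ ^ p.natDegree := by
    filter_upwards [h0] with a ha
    let := invertibleOfNonzero (inv_ne_zero ha)
    have h4 := Polynomial.eval₂_reverse_mul_pow (RingHom.id ℂ) (ε a)⁻¹ p
    rw [invOf_eq_inv, Polynomial.eval₂_id, Polynomial.eval₂_id, inv_inv] at h4
    exact h4.symm
  have h5 := (h2.mul (isTheta_refl (fun a => (ε a)⁻¹ ^ p.natDegree) l)).symm.trans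
    (h3.symm.isTheta.trans h)
  refine pow_eq_of_isTheta hε ?_
  simpa using h5.inv

end UltrafilterLimits

/-! ### Restrictions to lines -/

@[simp] theorem evalP_add (f g : MvPolynomial (Fin 2) ℂ) (p : ℂ × ℂ) :
    evalP (f + g) p = evalP f p + evalP g p := map_add _ _ _

@[simp] theorem evalP_sub (f g : MvPolynomial (Fin 2) ℂ) (p : ℂ × ℂ) :
    evalP (f - g) p = evalP f p - evalP g p := map_sub _ _ _

@[simp] theorem evalP_neg (f : MvPolynomial (Fin 2) ℂ) (p : ℂ × ℂ) :
    evalP (-f) p = -evalP f p := map_neg _ _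

@[simp] theorem evalP_mul (f g : MvPolynomial (Fin 2) ℂ) (p : ℂ × ℂ) :
    evalP (f * g) p = evalP f p * evalP g p := map_mul _ _ _

@[simp] theorem evalP_pow (f : MvPolynomial (Fin 2) ℂ) (n : ℕ) (p : ℂ × ℂ) :
    evalP (f ^ n) p = evalP f p ^ n := map_pow _ _ _

@[simp] theorem evalP_C (a : ℂ) (p : ℂ × ℂ) : evalP (C a) p = a := eval_C _

@[simp] theorem evalP_one (p : ℂ × ℂ) : evalP 1 p = 1 := map_one _

@[simp] theorem evalP_natCast (n : ℕ) (p : ℂ × ℂ) :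
    evalP (n : MvPolynomial (Fin 2) ℂ) p = n := map_natCast _ _

@[simp] theorem evalP_X_zero (p : ℂ × ℂ) : evalP (X 0) p = p.1 := by simp [evalP]

@[simp] theorem evalP_X_one (p : ℂ × ℂ) : evalP (X 1) p = p.2 := by simp [evalP]

theorem continuous_evalP (f : MvPolynomial (Fin 2) ℂ) : Continuous (evalP f) := by
  induction f using MvPolynomial.induction_on with
  | C a => simpa only [funext (evalP_C a)] using continuous_const
  | add f g hf hg => rw [funext (evalP_add f g)]; exact hf.add hg
  | mul_X f i hf =>
    fin_cases i
    · simp only [funext (evalP_mul f _), Fin.zero_eta, evalP_X_zero]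
      exact hf.mul continuous_fst
    · simp only [funext (evalP_mul f _), Fin.mk_one, evalP_X_one]
      exact hf.mul continuous_snd

theorem eval_lineRestrict (f : MvPolynomial (Fin 2) ℂ) (p w : ℂ × ℂ) (t : ℂ) :
    (lineRestrict f p w).eval t = evalP f (p.1 + t * w.1, p.2 + t * w.2) := by
  induction f using MvPolynomial.induction_on with
  | C a => simp [lineRestrict]
  | add f g hf hg =>
    rw [evalP_add, ← hf, ← hg]
    simp [lineRestrict]
  | mul_X f i hf =>
    rw [evalP_mul, ← hf]
    fin_cases i <;> simp [lineRestrict, mul_comm t]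

theorem derivative_lineRestrict (f : MvPolynomial (Fin 2) ℂ) (p w : ℂ × ℂ) :
    Polynomial.derivative (lineRestrict f p w)
      = Polynomial.C w.1 * lineRestrict (pderiv 0 f) p w
        + Polynomial.C w.2 * lineRestrict (pderiv 1 f) p w := by
  induction f using MvPolynomial.induction_on with
  | C a => simp [lineRestrict]
  | add f g hf hg =>
    simp only [lineRestrict, map_add] at hf hg ⊢
    rw [hf, hg]
    ring
  | mul_X f i hf =>
    simp only [lineRestrict, map_mul, Derivation.leibniz, smul_eq_mul, map_add,
      Polynomial.derivative_mul] at hf ⊢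
    rw [hf]
    fin_cases i <;> simp [pderiv_X] <;> ring

theorem lineRestrict_comp (f : MvPolynomial (Fin 2) ℂ) (p w : ℂ × ℂ) (s μ : ℂ) :
    (lineRestrict f p w).comp (Polynomial.C s + Polynomial.C μ * Polynomial.X)
      = lineRestrict f (p.1 + s * w.1, p.2 + s * w.2) (μ * w.1, μ * w.2) := by
  induction f using MvPolynomial.induction_on with
  | C a => simp [lineRestrict]
  | add f g hf hg =>
    simp only [lineRestrict, map_add, Polynomial.add_comp] at hf hg ⊢
    rw [hf, hg]
  | mul_X f i hf =>
    simp only [lineRestrict, map_mul, Polynomial.mul_comp] at hf ⊢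
    rw [hf]
    congr 1
    fin_cases i <;> simp <;> ring

theorem coeff_zero_lineRestrict (f : MvPolynomial (Fin 2) ℂ) (p w : ℂ × ℂ) :
    (lineRestrict f p w).coeff 0 = evalP f p := by
  rw [Polynomial.coeff_zero_eq_eval_zero, eval_lineRestrict]
  simp

theorem coeff_succ_lineRestrict (f : MvPolynomial (Fin 2) ℂ) (p w : ℂ × ℂ) (n : ℕ) :
    (lineRestrict f p w).coeff (n + 1) * (n + 1) = w.1 * (lineRestrict (pderiv 0 f) p w).coeff n
        + w.2 * (lineRestrict (pderiv 1 f) p w).coeff n := by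
  rw [← Polynomial.coeff_derivative, derivative_lineRestrict]
  simp

theorem coeff_one_lineRestrict (f : MvPolynomial (Fin 2) ℂ) (p w : ℂ × ℂ) :
    (lineRestrict f p w).coeff 1 = w.1 * evalP (pderiv 0 f) p + w.2 * evalP (pderiv 1 f) p := by
  have := coeff_succ_lineRestrict f p w 0
  simpa [coeff_zero_lineRestrict] using this

theorem pderiv_one_zero (f : MvPolynomial (Fin 2) ℂ) :
    pderiv 1 (pderiv 0 f) = pderiv 0 (pderiv 1 f) := by
  have h : ⁅pderiv (R := ℂ) (1 : Fin 2), pderiv (R := ℂ) (0 : Fin 2)⁆ = 0 := by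
    refine MvPolynomial.derivation_ext fun i => ?_
    fin_cases i <;> simp [Derivation.commutator_apply, pderiv_X]
  have h2 := congrArg (fun D => D f) h
  simp only [Derivation.commutator_apply, Derivation.coe_zero, Pi.zero_apply] at h2
  exact sub_eq_zero.1 h2

theorem coeff_two_lineRestrict (f : MvPolynomial (Fin 2) ℂ) (p w : ℂ × ℂ) :
    2 * (lineRestrict f p w).coeff 2 = w.1 ^ 2 * evalP (pderiv 0 (pderiv 0 f)) p
      + 2 * w.1 * w.2 * evalP (pderiv 0 (pderiv 1 f)) p
      + w.2 ^ 2 * evalP (pderiv 1 (pderiv 1 f)) p := by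
  have := coeff_succ_lineRestrict f p w 1
  simp only [coeff_one_lineRestrict, Nat.cast_one, pderiv_one_zero] at this
  linear_combination this

theorem coeff_three_lineRestrict (f : MvPolynomial (Fin 2) ℂ) (p w : ℂ × ℂ) :
    6 * (lineRestrict f p w).coeff 3 = w.1 ^ 3 * evalP (pderiv 0 (pderiv 0 (pderiv 0 f))) p
      + 3 * w.1 ^ 2 * w.2 * evalP (pderiv 0 (pderiv 0 (pderiv 1 f))) p
      + 3 * w.1 * w.2 ^ 2 * evalP (pderiv 0 (pderiv 1 (pderiv 1 f))) p
      + w.2 ^ 3 * evalP (pderiv 1 (pderiv 1 (pderiv 1 f))) p := by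
  have h := coeff_succ_lineRestrict f p w 2
  have h0 := coeff_two_lineRestrict (pderiv 0 f) p w
  have h1 := coeff_two_lineRestrict (pderiv 1 f) p w
  simp only [pderiv_one_zero, Nat.cast_ofNat] at h h0 h1
  linear_combination 2 * h + w.1 * h0 + w.2 * h1

/-- The line through `p` in direction `w` meets `{f = 0}` at `p` with multiplicity `≥ k`. -/
def Contact (f : MvPolynomial (Fin 2) ℂ) (p w : ℂ × ℂ) (k : ℕ) : Prop :=
  Polynomial.X ^ k ∣ lineRestrict f p w

theorem le_interMult_iff {f : MvPolynomial (Fin 2) ℂ} {p w : ℂ × ℂ} {k : ℕ} :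
    (k : ℕ∞) ≤ interMult f p w ↔ Contact f p w k := by
  rw [interMult, Contact]
  split_ifs with h
  · simp [h]
  · rw [Nat.cast_le, Polynomial.le_rootMultiplicity_iff h, Polynomial.C_0, sub_zero]

theorem Contact.mono {f : MvPolynomial (Fin 2) ℂ} {p w : ℂ × ℂ} {k l : ℕ} (h : Contact f p w l)
    (hkl : k ≤ l) : Contact f p w k :=
  (pow_dvd_pow _ hkl).trans h

theorem contact_translate {f : MvPolynomial (Fin 2) ℂ} {p w : ℂ × ℂ} {t : ℂ} {k : ℕ} :
    (Polynomial.X - Polynomial.C t) ^ k ∣ lineRestrict f p w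
      ↔ Contact f (p.1 + t * w.1, p.2 + t * w.2) w k := by
  have h := lineRestrict_comp f p w t 1
  simp only [one_mul, Polynomial.C_1] at h
  rw [Contact, ← h, add_comm, Polynomial.dvd_comp_X_add_C_iff]
  simp

theorem Contact.smul {f : MvPolynomial (Fin 2) ℂ} {p w : ℂ × ℂ} {k : ℕ} (h : Contact f p w k)
    (μ : ℂ) : Contact f p (μ * w.1, μ * w.2) k := by
  have h1 := lineRestrict_comp f p w 0 μ
  simp only [Polynomial.C_0, zero_mul, add_zero, zero_add] at h1
  obtain ⟨q, hq⟩ := h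
  rw [Contact, ← h1, hq]
  simp only [Polynomial.mul_comp, Polynomial.pow_comp, Polynomial.X_comp, mul_pow]
  rw [mul_assoc, mul_left_comm]
  exact dvd_mul_right _ _

theorem contact_two_iff {f : MvPolynomial (Fin 2) ℂ} {p w : ℂ × ℂ} :
    Contact f p w 2 ↔ evalP f p = 0 ∧ w.1 * evalP (pderiv 0 f) p + w.2 * evalP (pderiv 1 f) p = 0 := by
  rw [Contact, Polynomial.X_pow_dvd_iff, ← coeff_zero_lineRestrict f p w,
    ← coeff_one_lineRestrict]
  refine ⟨fun h => ⟨h 0 (by norm_num), h 1 (by norm_num)⟩, fun h k hk => ?_⟩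
  interval_cases k
  exacts [h.1, h.2]

/-- The direction of the tangent line of `{f = 0}` at `p`. -/
def tdir (f : MvPolynomial (Fin 2) ℂ) (p : ℂ × ℂ) : ℂ × ℂ :=
  (evalP (pderiv 1 f) p, -evalP (pderiv 0 f) p)

theorem contact_tdir {f : MvPolynomial (Fin 2) ℂ} {p : ℂ × ℂ} (h : evalP f p = 0) :
    Contact f p (tdir f p) 2 :=
  contact_two_iff.2 ⟨h, by simp only [tdir]; ring⟩

theorem eq_smul_tdir {f : MvPolynomial (Fin 2) ℂ} {p w : ℂ × ℂ}
    (hs : ¬ (evalP (pderiv 0 f) p = 0 ∧ evalP (pderiv 1 f) p = 0))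
    (h : w.1 * evalP (pderiv 0 f) p + w.2 * evalP (pderiv 1 f) p = 0) :
    ∃ μ : ℂ, w = (μ * (tdir f p).1, μ * (tdir f p).2) := by
  simp only [tdir]
  by_cases h1 : evalP (pderiv 1 f) p = 0
  · have h0 : evalP (pderiv 0 f) p ≠ 0 := fun h0 => hs ⟨h0, h1⟩
    refine ⟨-w.2 / evalP (pderiv 0 f) p, Prod.ext ?_ ?_⟩
    · rw [h1] at h ⊢
      simpa [h0] using h
    · simp only
      field_simp
  · refine ⟨w.1 / evalP (pderiv 1 f) p, Prod.ext ?_ ?_⟩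
    · simp only
      field_simp
    · simp only
      field_simp
      linear_combination h

/-- The second fundamental polynomial, which cuts out the inflection points. -/
def hess (f : MvPolynomial (Fin 2) ℂ) : MvPolynomial (Fin 2) ℂ :=
  pderiv 0 (pderiv 0 f) * pderiv 1 f ^ 2 - C 2 * pderiv 0 (pderiv 1 f) * pderiv 0 f * pderiv 1 f
    + pderiv 1 (pderiv 1 f) * pderiv 0 f ^ 2

theorem evalP_hess (f : MvPolynomial (Fin 2) ℂ) (p : ℂ × ℂ) :
    evalP (hess f) p = 2 * (lineRestrict f p (tdir f p)).coeff 2 := by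
  rw [coeff_two_lineRestrict]
  simp only [hess, tdir, evalP_add, evalP_sub, evalP_mul, evalP_pow, evalP_C]
  ring

theorem tdir_deriv_hess (f : MvPolynomial (Fin 2) ℂ) (p : ℂ × ℂ) :
    (tdir f p).1 * evalP (pderiv 0 (hess f)) p + (tdir f p).2 * evalP (pderiv 1 (hess f)) p
      = 6 * (lineRestrict f p (tdir f p)).coeff 3 := by
  rw [coeff_three_lineRestrict]
  simp only [hess, tdir, map_add, map_sub, Derivation.leibniz, Derivation.leibniz_pow, pderiv_C,
    smul_eq_mul, nsmul_eq_mul, pderiv_one_zero, evalP_add, evalP_sub, evalP_mul, evalP_pow,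
    evalP_natCast, mul_zero, add_zero, evalP_C]
  push_cast
  ring

theorem contact_tdir_three_iff {f : MvPolynomial (Fin 2) ℂ} {p : ℂ × ℂ} (h : evalP f p = 0) :
    Contact f p (tdir f p) 3 ↔ evalP (hess f) p = 0 := by
  have h2 := contact_tdir h
  rw [Contact, Polynomial.X_pow_dvd_iff] at h2
  rw [evalP_hess, Contact, Polynomial.X_pow_dvd_iff]
  refine ⟨fun H => by rw [H 2 (by norm_num), mul_zero], fun H k hk => ?_⟩
  rcases Nat.lt_succ_iff_lt_or_eq.1 hk with h3 | rfl
  · exact h2 k h3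
  · simpa using H

/-- Increments of a polynomial in terms of the increments of the coordinates. -/
theorem exists_increment (f : MvPolynomial (Fin 2) ℂ) (q : ℂ × ℂ) :
    ∃ A B : MvPolynomial (Fin 2) ℂ,
      (∀ p, evalP f p - evalP f q = (p.1 - q.1) * evalP A p + (p.2 - q.2) * evalP B p) ∧
      evalP A q = evalP (pderiv 0 f) q ∧ evalP B q = evalP (pderiv 1 f) q := by
  induction f using MvPolynomial.induction_on with
  | C a => exact ⟨0, 0, by simp [evalP], by simp, by simp⟩
  | add f g hf hg =>
    obtain ⟨A, B, h, hA, hB⟩ := hf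
    obtain ⟨A', B', h', hA', hB'⟩ := hg
    refine ⟨A + A', B + B', fun p => ?_, by simp [hA, hA'], by simp [hB, hB']⟩
    simp only [evalP_add]
    linear_combination h p + h' p
  | mul_X f i hf =>
    obtain ⟨A, B, h, hA, hB⟩ := hf
    fin_cases i
    · refine ⟨A * C q.1 + f, B * C q.1, fun p => ?_, ?_, ?_⟩
      · simp only [Fin.zero_eta, evalP_add, evalP_mul, evalP_C, evalP_X_zero]
        linear_combination q.1 * h p
      · simp [Derivation.leibniz, hA, pderiv_X, mul_comm, add_comm]
      · simp [Derivation.leibniz, hB, pderiv_X, mul_comm]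
    · refine ⟨A * C q.2, B * C q.2 + f, fun p => ?_, ?_, ?_⟩
      · simp only [Fin.mk_one, evalP_add, evalP_mul, evalP_C, evalP_X_one]
        linear_combination q.2 * h p
      · simp [Derivation.leibniz, hA, pderiv_X, mul_comm]
      · simp [Derivation.leibniz, hB, pderiv_X, mul_comm, add_comm]

section QuasiHomogeneous

open Filter Topology

/-- All the exponents of `f` have weight at most `c d`, for the weights `(d, c)`. -/
def WtLe (c d : ℕ) (f : MvPolynomial (Fin 2) ℂ) : Prop :=
  ∀ m ∈ f.support, d * m 0 + c * m 1 ≤ c * d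

theorem WtLe.of_suppIn {c d : ℕ} {f : MvPolynomial (Fin 2) ℂ}
    (h : SuppIn f (qhExponents c d)) : WtLe c d f := fun m hm => by
  have := (h m hm).2.2
  simp only at this
  exact_mod_cast this

/-- The degeneration of `f` to its quasihomogeneous leading form, which is reached at `ε = 0`. -/
def deform (c d : ℕ) (ε : ℂ) (f : MvPolynomial (Fin 2) ℂ) : MvPolynomial (Fin 2) ℂ :=
  ∑ m ∈ f.support, monomial m (ε ^ (c * d - (d * m 0 + c * m 1)) * coeff m f)

theorem coeff_deform (c d : ℕ) (ε : ℂ) (f : MvPolynomial (Fin 2) ℂ) (m : Fin 2 →₀ ℕ) :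
    coeff m (deform c d ε f) = ε ^ (c * d - (d * m 0 + c * m 1)) * coeff m f := by
  classical
  rw [deform, coeff_sum]
  simp only [coeff_monomial]
  rw [Finset.sum_ite_eq']
  split_ifs with h
  · rfl
  · rw [notMem_support_iff.1 h, mul_zero]

theorem deform_one (c d : ℕ) (f : MvPolynomial (Fin 2) ℂ) : deform c d 1 f = f := by
  ext m
  rw [coeff_deform, one_pow, one_mul]

theorem WtLe.deform {c d : ℕ} {f : MvPolynomial (Fin 2) ℂ} (h : WtLe c d f) (ε : ℂ) :
    WtLe c d (deform c d ε f) := fun m hm => by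
  rw [mem_support_iff, coeff_deform] at hm
  exact h m (mem_support_iff.2 (right_ne_zero_of_mul hm))

theorem lineRestrict_eq_sum (f : MvPolynomial (Fin 2) ℂ) (p w : ℂ × ℂ) :
    lineRestrict f p w = ∑ m ∈ f.support, Polynomial.C (coeff m f) *
      ((Polynomial.C p.1 + Polynomial.C w.1 * Polynomial.X) ^ m 0
        * (Polynomial.C p.2 + Polynomial.C w.2 * Polynomial.X) ^ m 1) := by
  rw [lineRestrict, aeval_def, eval₂_eq']
  simp only [Fin.prod_univ_two]
  rfl

theorem lineRestrict_deform (c d : ℕ) (ε : ℂ) (f : MvPolynomial (Fin 2) ℂ) (p w : ℂ × ℂ) :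
    lineRestrict (deform c d ε f) p w = ∑ m ∈ f.support,
      Polynomial.C (ε ^ (c * d - (d * m 0 + c * m 1)) * coeff m f) *
      ((Polynomial.C p.1 + Polynomial.C w.1 * Polynomial.X) ^ m 0
        * (Polynomial.C p.2 + Polynomial.C w.2 * Polynomial.X) ^ m 1) := by
  rw [lineRestrict, deform, map_sum]
  refine Finset.sum_congr rfl fun m _ => ?_
  rw [aeval_monomial, Finsupp.prod_fintype _ _ (fun i => pow_zero _), Fin.prod_univ_two]
  rfl

theorem coeffTendsto_lineRestrict_deform (c d : ℕ) (f : MvPolynomial (Fin 2) ℂ) {α : Type*}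
    {l : Filter α} {ε : α → ℂ} {ε₀ : ℂ} {p w : α → ℂ × ℂ} {p₀ w₀ : ℂ × ℂ}
    (hε : Tendsto ε l (𝓝 ε₀)) (hp : Tendsto p l (𝓝 p₀)) (hw : Tendsto w l (𝓝 w₀)) :
    CoeffTendsto (fun a => lineRestrict (deform c d (ε a) f) (p a) (w a)) l
      (lineRestrict (deform c d ε₀ f) p₀ w₀) := by
  simp only [lineRestrict_deform]
  have hp1 := (continuous_fst.tendsto p₀).comp hp
  have hp2 := (continuous_snd.tendsto p₀).comp hp
  have hw1 := (continuous_fst.tendsto w₀).comp hw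
  have hw2 := (continuous_snd.tendsto w₀).comp hw
  refine CoeffTendsto.sum _ fun m _ => ?_
  exact (CoeffTendsto.C ((hε.pow _).mul_const _)).mul
    ((((CoeffTendsto.C hp1).add ((CoeffTendsto.C hw1).mul (CoeffTendsto.const _))).pow _).mul
      (((CoeffTendsto.C hp2).add ((CoeffTendsto.C hw2).mul (CoeffTendsto.const _))).pow _))

theorem coeffTendsto_lineRestrict (f : MvPolynomial (Fin 2) ℂ) {α : Type*}
    {l : Filter α} {p w : α → ℂ × ℂ} {p₀ w₀ : ℂ × ℂ}
    (hp : Tendsto p l (𝓝 p₀)) (hw : Tendsto w l (𝓝 w₀)) :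
    CoeffTendsto (fun a => lineRestrict f (p a) (w a)) l (lineRestrict f p₀ w₀) := by
  simpa only [deform_one] using coeffTendsto_lineRestrict_deform 0 0 f
    (tendsto_const_nhds (x := (1 : ℂ))) hp hw

theorem WtLe.lineRestrict_scale {c d : ℕ} {f : MvPolynomial (Fin 2) ℂ} (h : WtLe c d f)
    (ε r : ℂ) (p w : ℂ × ℂ) :
    lineRestrict (_root_.deform c d (r * ε) f) (r ^ d * p.1, r ^ c * p.2)
        (r ^ d * w.1, r ^ c * w.2)
      = Polynomial.C (r ^ (c * d)) * lineRestrict (_root_.deform c d ε f) p w := by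
  rw [lineRestrict_deform, lineRestrict_deform, Finset.mul_sum]
  refine Finset.sum_congr rfl fun m hm => ?_
  obtain ⟨k, hk⟩ := Nat.exists_eq_add_of_le (h m hm)
  rw [hk, Nat.add_sub_cancel_left]
  simp only [map_mul, map_pow]
  have e1 : Polynomial.C r ^ d * Polynomial.C p.1 + Polynomial.C r ^ d * Polynomial.C w.1
      * Polynomial.X = Polynomial.C r ^ d * (Polynomial.C p.1 + Polynomial.C w.1 * Polynomial.X) := by
    ring
  have e2 : Polynomial.C r ^ c * Polynomial.C p.2 + Polynomial.C r ^ c * Polynomial.C w.2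
      * Polynomial.X = Polynomial.C r ^ c * (Polynomial.C p.2 + Polynomial.C w.2 * Polynomial.X) := by
    ring
  rw [e1, e2, mul_pow, mul_pow, mul_pow, pow_add, pow_add, ← pow_mul, ← pow_mul]
  ring

theorem WtLe.natDegree_lineRestrict_le {c d : ℕ} {f : MvPolynomial (Fin 2) ℂ} (h : WtLe c d f)
    (hd : 0 < d) (hdc : d < c) (p w : ℂ × ℂ) : (lineRestrict f p w).natDegree ≤ c := by
  rw [lineRestrict_eq_sum]
  refine Polynomial.natDegree_sum_le_of_forall_le _ _ fun m hm => ?_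
  have h1 := h m hm
  have h2 : m 0 + m 1 ≤ c := by
    have : d * (m 0 + m 1) ≤ d * c := by nlinarith
    exact Nat.le_of_mul_le_mul_left this hd
  refine le_trans ?_ h2
  compute_degree

/-- The exponent `(i, j)`. -/
def exponent (i j : ℕ) : Fin 2 →₀ ℕ := Finsupp.single 0 i + Finsupp.single 1 j

theorem exponent_zero (i j : ℕ) : exponent i j 0 = i := by simp [exponent]

theorem exponent_one (i j : ℕ) : exponent i j 1 = j := by simp [exponent]

theorem eq_exponent_iff {m : Fin 2 →₀ ℕ} {i j : ℕ} : m = exponent i j ↔ m 0 = i ∧ m 1 = j := by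
  constructor
  · rintro rfl
    exact ⟨exponent_zero i j, exponent_one i j⟩
  · rintro ⟨rfl, rfl⟩
    ext k
    fin_cases k
    · exact (exponent_zero _ _).symm
    · exact (exponent_one _ _).symm

theorem coeff_mul_pow_add (a b a' b' : ℂ) (i j : ℕ) :
    ((Polynomial.C a + Polynomial.C b * Polynomial.X) ^ i
      * (Polynomial.C a' + Polynomial.C b' * Polynomial.X) ^ j).coeff (i + j) = b ^ i * b' ^ j := by
  have h : ∀ (a b : ℂ) (n : ℕ),
      ((Polynomial.C a + Polynomial.C b * Polynomial.X) ^ n).coeff n = b ^ n := fun a b n => by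
    have h1 := Polynomial.coeff_pow_of_natDegree_le
      (p := Polynomial.C a + Polynomial.C b * Polynomial.X) (n := 1) (m := n) (by compute_degree)
    simpa using h1
  rw [Polynomial.coeff_mul_add_eq_of_natDegree_le (df := i) (dg := j), h, h]
  · exact (by compute_degree)
  · exact (by compute_degree)

theorem WtLe.coeff_lineRestrict {c d : ℕ} {f : MvPolynomial (Fin 2) ℂ} (h : WtLe c d f)
    (hd : 0 < d) (hdc : d < c) (p w : ℂ × ℂ) :
    (lineRestrict f p w).coeff c = coeff (exponent c 0) f * w.1 ^ c := by
  rw [lineRestrict_eq_sum, Polynomial.finsetSum_coeff]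
  have h0 : ∀ m ∈ f.support, m ≠ exponent c 0 → (Polynomial.C (coeff m f) *
      ((Polynomial.C p.1 + Polynomial.C w.1 * Polynomial.X) ^ m 0
        * (Polynomial.C p.2 + Polynomial.C w.2 * Polynomial.X) ^ m 1)).coeff c = 0 := by
    intro m hm hne
    have h1 := h m hm
    have h2 : m 0 + m 1 < c := by
      by_contra! hcon
      obtain ⟨k, hk⟩ := Nat.exists_eq_add_of_lt hdc
      have h3 : m 1 = 0 := by
        by_contra h4
        have h5 : 0 < m 1 := Nat.pos_of_ne_zero h4
        nlinarith
      apply hne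
      rw [eq_exponent_iff]
      refine ⟨le_antisymm ?_ (by omega), h3⟩
      rw [h3, mul_zero, add_zero, mul_comm c d] at h1
      exact Nat.le_of_mul_le_mul_left h1 hd
    refine Polynomial.coeff_eq_zero_of_natDegree_lt (lt_of_le_of_lt ?_ h2)
    compute_degree
  by_cases hm : exponent c 0 ∈ f.support
  · rw [Finset.sum_eq_single_of_mem _ hm h0, Polynomial.coeff_C_mul]
    congr 1
    have := coeff_mul_pow_add p.1 w.1 p.2 w.2 c 0
    rw [exponent_zero, exponent_one]
    simpa using this
  · rw [notMem_support_iff.1 hm, zero_mul]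
    exact Finset.sum_eq_zero fun m hm' => h0 m hm' fun h2 => hm (h2 ▸ hm')

theorem WtLe.natDegree_vertical_le {c d : ℕ} {f : MvPolynomial (Fin 2) ℂ} (h : WtLe c d f)
    (hc : 0 < c) (p : ℂ × ℂ) (r : ℂ) : (lineRestrict f p (0, r)).natDegree ≤ d := by
  rw [lineRestrict_eq_sum]
  refine Polynomial.natDegree_sum_le_of_forall_le _ _ fun m hm => ?_
  have h1 := h m hm
  have h2 : m 1 ≤ d := by
    have : c * m 1 ≤ c * d := by nlinarith
    exact Nat.le_of_mul_le_mul_left this hc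
  refine le_trans ?_ h2
  simp only [Polynomial.C_0, zero_mul, add_zero]
  compute_degree

theorem WtLe.coeff_vertical {c d : ℕ} {f : MvPolynomial (Fin 2) ℂ} (h : WtLe c d f)
    (hc : 0 < c) (hd : 0 < d) (p : ℂ × ℂ) (r : ℂ) :
    (lineRestrict f p (0, r)).coeff d = coeff (exponent 0 d) f * r ^ d := by
  rw [lineRestrict_eq_sum, Polynomial.finsetSum_coeff]
  simp only [Polynomial.C_0, zero_mul, add_zero]
  have h0 : ∀ m ∈ f.support, m ≠ exponent 0 d → (Polynomial.C (coeff m f) *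
      (Polynomial.C p.1 ^ m 0
        * (Polynomial.C p.2 + Polynomial.C r * Polynomial.X) ^ m 1)).coeff d = 0 := by
    intro m hm hne
    have h1 := h m hm
    have h2 : m 1 < d := by
      by_contra! hcon
      have h3 : m 0 = 0 := by
        by_contra h4
        have h5 : 0 < m 0 := Nat.pos_of_ne_zero h4
        nlinarith
      apply hne
      rw [eq_exponent_iff]
      refine ⟨h3, le_antisymm ?_ hcon⟩
      rw [h3, mul_zero, zero_add] at h1
      exact Nat.le_of_mul_le_mul_left h1 hc
    refine Polynomial.coeff_eq_zero_of_natDegree_lt (lt_of_le_of_lt ?_ h2)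
    compute_degree
  by_cases hm : exponent 0 d ∈ f.support
  · rw [Finset.sum_eq_single_of_mem _ hm h0, Polynomial.coeff_C_mul]
    congr 1
    have := coeff_mul_pow_add p.1 0 p.2 r 0 d
    rw [exponent_zero, exponent_one]
    simpa using this
  · rw [notMem_support_iff.1 hm, zero_mul]
    exact Finset.sum_eq_zero fun m hm' => h0 m hm' fun h2 => hm (h2 ▸ hm')

theorem coeff_deform_x (c d : ℕ) (ε : ℂ) (f : MvPolynomial (Fin 2) ℂ) :
    coeff (exponent c 0) (deform c d ε f) = coeff (exponent c 0) f := by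
  rw [coeff_deform, exponent_zero, exponent_one, mul_comm d c]
  simp

theorem coeff_deform_y (c d : ℕ) (ε : ℂ) (f : MvPolynomial (Fin 2) ℂ) :
    coeff (exponent 0 d) (deform c d ε f) = coeff (exponent 0 d) f := by
  rw [coeff_deform, exponent_zero, exponent_one]
  simp

/-- Euler's identity for the quasihomogeneous leading form. -/
theorem WtLe.euler {c d : ℕ} {f : MvPolynomial (Fin 2) ℂ} (h : WtLe c d f) :
    C (d : ℂ) * X 0 * pderiv 0 (_root_.deform c d 0 f)
      + C (c : ℂ) * X 1 * pderiv 1 (_root_.deform c d 0 f)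
      = C ((c : ℂ) * d) * _root_.deform c d 0 f := by
  have hw : IsWeightedHomogeneous ![d, c] (_root_.deform c d 0 f) (c * d) := by
    intro m hm
    rw [coeff_deform] at hm
    have h1 := h m (mem_support_iff.2 (right_ne_zero_of_mul hm))
    have h2 : c * d - (d * m 0 + c * m 1) = 0 := by
      by_contra h3
      exact left_ne_zero_of_mul hm (zero_pow h3)
    rw [Finsupp.weight_apply, Finsupp.sum_fintype _ _ (by simp), Fin.sum_univ_two]
    simp only [Matrix.cons_val_zero, Matrix.cons_val_one, smul_eq_mul]
    rw [mul_comm (m 0), mul_comm (m 1)]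
    omega
  have h1 := hw.sum_weight_X_mul_pderiv
  rw [Fin.sum_univ_two] at h1
  simp only [Matrix.cons_val_zero, Matrix.cons_val_one, nsmul_eq_mul, Nat.cast_mul] at h1
  simp only [map_mul, map_natCast]
  linear_combination h1

end QuasiHomogeneous

section Nondegenerate

@[simp] theorem evalP_zero (p : ℂ × ℂ) : evalP 0 p = 0 := map_zero _

theorem eq_sum_coeffAt {S : Set (ℤ × ℤ)} [Fintype S] (hS : ∀ k ∈ S, 0 ≤ k.1 ∧ 0 ≤ k.2)
    {f : MvPolynomial (Fin 2) ℂ} (hf : SuppIn f S) :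
    f = ∑ k : S, C (coeffAt f k) * (X 0 ^ k.1.1.toNat * X 1 ^ k.1.2.toNat) := by
  have h := aeval_eq_sum_coeffAt hS hf (X : Fin 2 → MvPolynomial (Fin 2) ℂ)
  rw [aeval_X_left_apply] at h
  simpa only [smul_eq_C_mul] using h

theorem evalP_sum {ι : Type*} (s : Finset ι) (g : ι → MvPolynomial (Fin 2) ℂ) (p : ℂ × ℂ) :
    evalP (∑ i ∈ s, g i) p = ∑ i ∈ s, evalP (g i) p := map_sum _ _ _

theorem evalP_eq_sum {S : Set (ℤ × ℤ)} [Fintype S] (hS : ∀ k ∈ S, 0 ≤ k.1 ∧ 0 ≤ k.2)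
    {f : MvPolynomial (Fin 2) ℂ} (hf : SuppIn f S) (p : ℂ × ℂ) :
    evalP f p = ∑ k : S, coeffAt f k * (p.1 ^ k.1.1.toNat * p.2 ^ k.1.2.toNat) := by
  conv_lhs => rw [eq_sum_coeffAt hS hf]
  simp [evalP_sum]

theorem evalP_pderiv_zero_eq_sum {S : Set (ℤ × ℤ)} [Fintype S]
    (hS : ∀ k ∈ S, 0 ≤ k.1 ∧ 0 ≤ k.2)
    {f : MvPolynomial (Fin 2) ℂ} (hf : SuppIn f S) (p : ℂ × ℂ) :
    evalP (pderiv 0 f) p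
      = ∑ k : S, coeffAt f k * (k.1.1.toNat * p.1 ^ (k.1.1.toNat - 1) * p.2 ^ k.1.2.toNat) := by
  conv_lhs => rw [eq_sum_coeffAt hS hf]
  simp only [map_sum, evalP_sum, Derivation.leibniz, Derivation.leibniz_pow, pderiv_C, pderiv_X]
  refine Finset.sum_congr rfl fun k _ => ?_
  simp
  left
  ring

theorem evalP_pderiv_one_eq_sum {S : Set (ℤ × ℤ)} [Fintype S]
    (hS : ∀ k ∈ S, 0 ≤ k.1 ∧ 0 ≤ k.2)
    {f : MvPolynomial (Fin 2) ℂ} (hf : SuppIn f S) (p : ℂ × ℂ) :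
    evalP (pderiv 1 f) p
      = ∑ k : S, coeffAt f k * (k.1.2.toNat * p.2 ^ (k.1.2.toNat - 1) * p.1 ^ k.1.1.toNat) := by
  conv_lhs => rw [eq_sum_coeffAt hS hf]
  simp only [map_sum, evalP_sum, Derivation.leibniz, Derivation.leibniz_pow, pderiv_C, pderiv_X]
  refine Finset.sum_congr rfl fun k _ => ?_
  simp
  left
  ring

theorem qhExponents_nonneg {c d : ℕ} : ∀ k ∈ qhExponents c d, 0 ≤ k.1 ∧ 0 ≤ k.2 :=
  fun _ hk => ⟨hk.1, hk.2.1⟩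

theorem genericOn_smooth {c d : ℕ} (hc : 0 < c) (hd : 0 < d) :
    GenericOn (qhExponents c d) (fun f => ∀ p, evalP f p = 0 →
      ¬ (evalP (pderiv 0 f) p = 0 ∧ evalP (pderiv 1 f) p = 0)) := by
  have := (qhExponents_finite hc hd).fintype
  have hc' : (1 : ℤ) ≤ c := by exact_mod_cast hc
  have hd' : (1 : ℤ) ≤ d := by exact_mod_cast hd
  let ψ : qhExponents c d → Fin 3 → MvPolynomial (Fin 2) ℂ := fun k =>
    ![C (1 - k.1.1.toNat - k.1.2.toNat : ℂ) * (X 0 ^ k.1.1.toNat * X 1 ^ k.1.2.toNat),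
      C (k.1.1.toNat : ℂ) * (X 0 ^ (k.1.1.toNat - 1) * X 1 ^ k.1.2.toNat),
      C (k.1.2.toNat : ℂ) * (X 0 ^ k.1.1.toNat * X 1 ^ (k.1.2.toNat - 1))]
  let ι : Fin 3 → qhExponents c d :=
    ![⟨(0, 0), by simp only [qhExponents, Set.mem_ofPred_eq]; refine ⟨le_rfl, le_rfl, by nlinarith⟩⟩,
      ⟨(1, 0), by simp only [qhExponents, Set.mem_ofPred_eq]; refine ⟨by simp, le_rfl, by nlinarith⟩⟩,
      ⟨(0, 1), by simp only [qhExponents, Set.mem_ofPred_eq]; refine ⟨le_rfl, by simp, by nlinarith⟩⟩]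
  refine (genericOn_linear ψ ι ?_ ?_).mono ?_
  · intro i j hij
    fin_cases i <;> fin_cases j <;> simp [ι] at hij ⊢
  · intro j i
    fin_cases i <;> fin_cases j <;> simp [ι, ψ]
  · rintro f hf h p h0 ⟨h1, h2⟩
    obtain ⟨i, hi⟩ := h ![p.1, p.2]
    apply hi
    have e1 : ∑ k : qhExponents c d, coeffAt f k * eval ![p.1, p.2] (ψ k 1) = 0 := by
      rw [← h1, evalP_pderiv_zero_eq_sum qhExponents_nonneg hf]
      exact Finset.sum_congr rfl fun k _ => by simp [ψ]; left; ring
    have e2 : ∑ k : qhExponents c d, coeffAt f k * eval ![p.1, p.2] (ψ k 2) = 0 := by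
      rw [← h2, evalP_pderiv_one_eq_sum qhExponents_nonneg hf]
      exact Finset.sum_congr rfl fun k _ => by simp [ψ]; left; ring
    have e0 : ∑ k : qhExponents c d, coeffAt f k * eval ![p.1, p.2] (ψ k 0) = 0 := by
      have hk : ∀ k : qhExponents c d, coeffAt f k * eval ![p.1, p.2] (ψ k 0)
          = coeffAt f k * (p.1 ^ k.1.1.toNat * p.2 ^ k.1.2.toNat)
            - p.1 * (coeffAt f k * eval ![p.1, p.2] (ψ k 1))
            - p.2 * (coeffAt f k * eval ![p.1, p.2] (ψ k 2)) := by
        intro k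
        simp only [ψ, Matrix.cons_val, map_mul, eval_C, map_pow, eval_X]
        rcases Nat.eq_zero_or_pos k.1.1.toNat with h3 | h3 <;>
          rcases Nat.eq_zero_or_pos k.1.2.toNat with h4 | h4
        · simp [h3, h4]
        · obtain ⟨n, hn⟩ := Nat.exists_eq_add_of_le' h4
          simp [h3, hn]
          ring
        · obtain ⟨n, hn⟩ := Nat.exists_eq_add_of_le' h3
          simp [h4, hn]
          ring
        · obtain ⟨n, hn⟩ := Nat.exists_eq_add_of_le' h4
          obtain ⟨n', hn'⟩ := Nat.exists_eq_add_of_le' h3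
          simp [hn, hn']
          ring
      rw [Finset.sum_congr rfl fun k _ => hk k, Finset.sum_sub_distrib, Finset.sum_sub_distrib,
        ← Finset.mul_sum, ← Finset.mul_sum, e1, e2, ← evalP_eq_sum qhExponents_nonneg hf, h0]
      simp
    fin_cases i
    exacts [e0, e1, e2]

theorem WtLe.suppIn {c d : ℕ} {f : MvPolynomial (Fin 2) ℂ} (h : WtLe c d f) :
    SuppIn f (qhExponents c d) := fun m hm => by
  refine ⟨by simp, by simp, ?_⟩
  have := h m hm
  simp only
  exact_mod_cast this

theorem coeffAt_deform {c d : ℕ} (f : MvPolynomial (Fin 2) ℂ) {k : ℤ × ℤ}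
    (hk : k ∈ qhExponents c d) : coeffAt (deform c d 0 f) k
      = if (d : ℤ) * k.1 + c * k.2 = c * d then coeffAt f k else 0 := by
  obtain ⟨h1, h2, h3⟩ := hk
  have e : c * d - (d * (exponent k.1.toNat k.2.toNat) 0
      + c * (exponent k.1.toNat k.2.toNat) 1) = 0 ↔ (d : ℤ) * k.1 + c * k.2 = c * d := by
    rw [exponent_zero, exponent_one]
    zify [show d * k.1.toNat + c * k.2.toNat ≤ c * d by zify; simpa [h1, h2] using h3]
    simp only [h1, h2, Int.toNat_of_nonneg]
    constructor <;> intro h <;> linarith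
  simp only [coeffAt, if_pos (And.intro h1 h2)]
  change coeff (exponent _ _) _ = if (d : ℤ) * k.1 + c * k.2 = c * d then coeff (exponent _ _) _ else 0
  rw [coeff_deform]
  split_ifs with h
  · rw [e.2 h]
    simp
  · rw [zero_pow (mt e.1 h), zero_mul]

theorem genericOn_edge {c d : ℕ} (hc : 0 < c) (hd : 0 < d) :
    GenericOn (qhExponents c d) (fun f => ∀ y, evalP (deform c d 0 f) (1, y) = 0 →
      y * evalP (pderiv 1 (deform c d 0 f)) (1, y) ≠ 0 ∨ y = 0) := by
  have := (qhExponents_finite hc hd).fintype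
  obtain ⟨g, hg⟩ : ∃ g, g = Nat.gcd c d := ⟨_, rfl⟩
  have hg0 : 0 < g := hg ▸ Nat.gcd_pos_of_pos_left d hc
  obtain ⟨c', hc'⟩ : g ∣ c := hg ▸ Nat.gcd_dvd_left c d
  obtain ⟨d', hd'⟩ : g ∣ d := hg ▸ Nat.gcd_dvd_right c d
  have hcop : Nat.Coprime c' d' := by
    have h := Nat.coprime_div_gcd_div_gcd (m := c) (n := d) (hg ▸ hg0)
    rw [← hg] at h
    rwa [Nat.div_eq_of_eq_mul_right hg0 hc', Nat.div_eq_of_eq_mul_right hg0 hd'] at h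
  have hcz : (c : ℤ) = g * c' := by exact_mod_cast hc'
  have hdz : (d : ℤ) = g * d' := by exact_mod_cast hd'
  have hd'0 : 0 < d' := Nat.pos_of_mul_pos_left (hd' ▸ hd)
  have hedge : ∀ k : qhExponents c d, (d : ℤ) * k.1.1 + c * k.1.2 = c * d →
      d' * (k.1.2.toNat / d') = k.1.2.toNat := by
    intro k hk
    refine Nat.mul_div_cancel' ?_
    have h1 : (d' : ℤ) * k.1.1 + c' * k.1.2 = g * (c' * d') := by
      have : (g : ℤ) ≠ 0 := by exact_mod_cast hg0.ne'
      apply mul_left_cancel₀ this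
      rw [hcz, hdz] at hk
      linear_combination hk
    have h2 : (d' : ℤ) ∣ c' * k.1.2 := ⟨g * c' - k.1.1, by linear_combination h1⟩
    have h3 : (d' : ℤ) ∣ k.1.2 :=
      (Int.isCoprime_iff_gcd_eq_one.2 (by simpa using hcop.symm)).dvd_of_dvd_mul_left h2
    rw [← Int.natCast_dvd_natCast, Int.toNat_of_nonneg k.2.2.1]
    exact h3
  let e : qhExponents c d → Prop := fun k => (d : ℤ) * k.1.1 + c * k.1.2 = c * d
  classical
  let ψ : qhExponents c d → Fin 2 → MvPolynomial (Fin 1) ℂ := fun k =>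
    if e k then ![C (1 - (k.1.2.toNat / d' : ℕ) : ℂ) * X 0 ^ (k.1.2.toNat / d'),
      C ((k.1.2.toNat / d' : ℕ) : ℂ) * X 0 ^ (k.1.2.toNat / d' - 1)] else 0
  let ι : Fin 2 → qhExponents c d :=
    ![⟨(c, 0), by
        simp only [qhExponents, Set.mem_ofPred_eq]
        exact ⟨by simp, le_rfl, by linarith⟩⟩,
      ⟨(c' * (g - 1), d'), by
        simp only [qhExponents, Set.mem_ofPred_eq]
        have : (1 : ℤ) ≤ g := by exact_mod_cast hg0
        refine ⟨mul_nonneg (by simp) (by linarith), by simp, le_of_eq ?_⟩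
        rw [hcz, hdz]
        ring⟩]
  have he0 : e (ι 0) := by simp [e, ι, mul_comm]
  have he1 : e (ι 1) := by
    simp only [e, ι, Matrix.cons_val_one, Matrix.cons_val_fin_one]
    linear_combination (c' * (g - 1) : ℤ) * hdz + (d' - d : ℤ) * hcz - (c' * g : ℤ) * hdz
  refine (genericOn_linear ψ ι ?_ ?_).mono ?_
  · intro i j hij
    fin_cases i <;> fin_cases j <;> simp [ι, hd'0.ne'] at hij ⊢
    exact hd'0.ne (by exact_mod_cast hij.2)
  · intro j i
    fin_cases i <;> fin_cases j <;> simp [ψ, he0, he1] <;> simp [ι, hd'0]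
  · rintro f hf h y h0
    by_contra! hcon
    obtain ⟨h1, hy⟩ := hcon
    have hF : SuppIn (deform c d 0 f) (qhExponents c d) :=
      ((WtLe.of_suppIn hf).deform 0).suppIn
    have hk1 : ∀ k : qhExponents c d, y ^ d' * (coeffAt f k * eval ![y ^ d'] (ψ k 1)) * d'
        = y * (coeffAt (deform c d 0 f) k
          * (k.1.2.toNat * y ^ (k.1.2.toNat - 1) * 1 ^ k.1.1.toNat)) := by
      intro k
      rw [coeffAt_deform f k.2]
      by_cases hk : e k
      · have h2 := hedge k hk
        rw [if_pos hk]
        simp only [ψ, if_pos hk, Matrix.cons_val, map_mul, eval_C, map_pow, eval_X]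
        generalize k.1.2.toNat / d' = n at h2 ⊢
        rw [← h2]
        rcases Nat.eq_zero_or_pos n with rfl | hn
        · simp
        · obtain ⟨m, rfl⟩ := Nat.exists_eq_add_of_le' hn
          obtain ⟨m', hm'⟩ := Nat.exists_eq_add_of_le' (Nat.mul_pos hd'0 hn)
          have h3 : y ^ (d' * (m + 1) - 1) * y = y ^ d' * (y ^ d') ^ m := by
            rw [← pow_succ, hm', Nat.add_sub_cancel, ← hm', pow_mul, pow_succ, mul_comm]
          have h4 : ((d' * (m + 1) : ℕ) : ℂ) = d' * ((m + 1 : ℕ) : ℂ) := by push_cast; ring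
          rw [h4, Nat.add_sub_cancel]
          linear_combination (-coeffAt f k * d' * ((m + 1 : ℕ) : ℂ)) * h3
      · rw [if_neg hk]
        simp [ψ, if_neg hk]
    have hk0 : ∀ k : qhExponents c d, coeffAt f k * eval ![y ^ d'] (ψ k 0)
        = coeffAt (deform c d 0 f) k * (1 ^ k.1.1.toNat * y ^ k.1.2.toNat)
          - y ^ d' * (coeffAt f k * eval ![y ^ d'] (ψ k 1)) := by
      intro k
      rw [coeffAt_deform f k.2]
      by_cases hk : e k
      · have h2 := hedge k hk
        rw [if_pos hk]
        simp only [ψ, if_pos hk, Matrix.cons_val, map_mul, eval_C, map_pow, eval_X]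
        generalize k.1.2.toNat / d' = n at h2 ⊢
        rw [← h2]
        rcases Nat.eq_zero_or_pos n with rfl | hn
        · simp
        · obtain ⟨m, rfl⟩ := Nat.exists_eq_add_of_le' hn
          rw [Nat.add_sub_cancel, one_pow, one_mul, pow_mul]
          push_cast
          ring
      · rw [if_neg hk]
        simp [ψ, if_neg hk]
    have e1 : ∑ k : qhExponents c d, coeffAt f k * eval ![y ^ d'] (ψ k 1) = 0 := by
      rw [evalP_pderiv_one_eq_sum qhExponents_nonneg hF, Finset.mul_sum] at h1
      simp only at h1
      rw [← Finset.sum_congr rfl fun k _ => hk1 k, ← Finset.sum_mul, ← Finset.mul_sum] at h1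
      have : (d' : ℂ) ≠ 0 := by exact_mod_cast hd'0.ne'
      simpa [hy, this] using h1
    have e0 : ∑ k : qhExponents c d, coeffAt f k * eval ![y ^ d'] (ψ k 0) = 0 := by
      rw [evalP_eq_sum qhExponents_nonneg hF] at h0
      rw [Finset.sum_congr rfl fun k _ => hk0 k, Finset.sum_sub_distrib, ← Finset.mul_sum, e1]
      simpa using h0
    obtain ⟨i, hi⟩ := h ![y ^ d']
    apply hi
    fin_cases i
    exacts [e0, e1]

end Nondegenerate

section NondegenerateLines

theorem Contact.dvd_line {f : MvPolynomial (Fin 2) ℂ} {p w : ℂ × ℂ} {k : ℕ}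
    (h : Contact f p w k) (hw : w.1 ≠ 0) :
    (Polynomial.X - Polynomial.C p.1) ^ k ∣
      lineRestrict f (0, p.2 - p.1 * (w.2 / w.1)) (1, w.2 / w.1) := by
  rw [contact_translate]
  have h1 := h.smul w.1⁻¹
  rw [inv_mul_cancel₀ hw, inv_mul_eq_div] at h1
  have h2 : p = ((0 : ℂ) + p.1 * 1, p.2 - p.1 * (w.2 / w.1) + p.1 * (w.2 / w.1)) :=
    Prod.ext (by simp) (by simp)
  rw [← h2]
  exact h1

theorem Contact.dvd_line_add {f : MvPolynomial (Fin 2) ℂ} {p w : ℂ × ℂ} {t : ℂ} {k : ℕ}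
    (h : Contact f (p.1 + t * w.1, p.2 + t * w.2) w k) (hw : w.1 ≠ 0) :
    (Polynomial.X - Polynomial.C (p.1 + t * w.1)) ^ k ∣
      lineRestrict f (0, p.2 - p.1 * (w.2 / w.1)) (1, w.2 / w.1) := by
  have h1 := h.dvd_line hw
  have h2 : p.2 + t * w.2 - (p.1 + t * w.1) * (w.2 / w.1) = p.2 - p.1 * (w.2 / w.1) := by
    field_simp
    ring
  simpa only [h2] using h1

theorem Contact.dvd_vertical {f : MvPolynomial (Fin 2) ℂ} {p w : ℂ × ℂ} {k : ℕ}
    (h : Contact f p w k) (hw : w ≠ 0) (hw1 : w.1 = 0) :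
    (Polynomial.X - Polynomial.C p.2) ^ k ∣ lineRestrict f (p.1, 0) (0, 1) := by
  have hw2 : w.2 ≠ 0 := fun h2 => hw (Prod.ext hw1 h2)
  rw [contact_translate]
  have h1 := h.smul w.2⁻¹
  rw [hw1, inv_mul_cancel₀ hw2, mul_zero] at h1
  have h2 : p = (p.1 + p.2 * 0, (0 : ℂ) + p.2 * 1) := Prod.ext (by simp) (by simp)
  rw [← h2]
  exact h1

theorem isCoprime_X_sub_C_pow {a b : ℂ} (h : a ≠ b) (m n : ℕ) :
    IsCoprime ((Polynomial.X - Polynomial.C a) ^ m) ((Polynomial.X - Polynomial.C b) ^ n) :=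
  (Polynomial.isCoprime_X_sub_C_of_isUnit_sub (sub_ne_zero.2 h).isUnit).pow

theorem ne_add_mul {a t w : ℂ} (ht : t ≠ 0) (hw : w ≠ 0) : a ≠ a + t * w := fun h =>
  mul_ne_zero ht hw (by linear_combination -h)

/-- The monic polynomial with the prescribed roots, depending on parameters. -/
def rootsPoly {n : ℕ} (l : List (MvPolynomial (Fin n) ℂ × ℕ)) :
    Polynomial (MvPolynomial (Fin n) ℂ) :=
  (l.map fun a => (Polynomial.X - Polynomial.C a.1) ^ a.2).prod

theorem monic_rootsPoly {n : ℕ} (l : List (MvPolynomial (Fin n) ℂ × ℕ)) : (rootsPoly l).Monic := by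
  induction l with
  | nil => simp [rootsPoly]
  | cons a l ih =>
    simp only [rootsPoly, List.map_cons, List.prod_cons]
    exact ((Polynomial.monic_X_sub_C _).pow _).mul ih

theorem natDegree_rootsPoly {n : ℕ} (l : List (MvPolynomial (Fin n) ℂ × ℕ)) :
    (rootsPoly l).natDegree = (l.map Prod.snd).sum := by
  induction l with
  | nil => simp [rootsPoly]
  | cons a l ih =>
    have h : rootsPoly (a :: l) = (Polynomial.X - Polynomial.C a.1) ^ a.2 * rootsPoly l := by
      simp [rootsPoly]
    rw [h, Polynomial.Monic.natDegree_mul ((Polynomial.monic_X_sub_C _).pow _) (monic_rootsPoly l),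
      ih, (Polynomial.monic_X_sub_C _).natDegree_pow]
    simp

theorem map_rootsPoly {n : ℕ} (l : List (MvPolynomial (Fin n) ℂ × ℕ)) (u : Fin n → ℂ) :
    (rootsPoly l).map (eval u)
      = (l.map fun a => (Polynomial.X - Polynomial.C (eval u a.1)) ^ a.2).prod := by
  induction l with
  | nil => simp [rootsPoly]
  | cons a l ih =>
    simp only [rootsPoly, List.map_cons, List.prod_cons] at ih ⊢
    rw [Polynomial.map_mul, ih]
    simp

theorem genericOn_line_roots {c d n : ℕ} (hnc : n ≤ c) (hc : 0 < c) (hd : 0 < d)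
    (b m : MvPolynomial (Fin n) ℂ) (l : List (MvPolynomial (Fin n) ℂ × ℕ))
    (hl : (l.map Prod.snd).sum = n + 1) :
    GenericOn (qhExponents c d) (fun f => ∀ u : Fin n → ℂ,
      ¬ (l.map fun a => (Polynomial.X - Polynomial.C (eval u a.1)) ^ a.2).prod ∣
        lineRestrict f (0, eval u b) (1, eval u m)) := by
  refine (genericOn_line hnc hc hd b m (rootsPoly l) (monic_rootsPoly l)
    ((natDegree_rootsPoly l).trans hl)).mono fun f _ h u => ?_
  rw [← map_rootsPoly]
  exact h u

theorem genericOn_vertical_roots {c d n : ℕ} (hnd : n ≤ d) (hc : 0 < c) (hd : 0 < d)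
    (a : MvPolynomial (Fin n) ℂ) (l : List (MvPolynomial (Fin n) ℂ × ℕ))
    (hl : (l.map Prod.snd).sum = n + 1) :
    GenericOn (qhExponents c d) (fun f => ∀ u : Fin n → ℂ,
      ¬ (l.map fun a => (Polynomial.X - Polynomial.C (eval u a.1)) ^ a.2).prod ∣
        lineRestrict f (eval u a, 0) (0, 1)) := by
  refine (genericOn_vertical hnd hc hd a (rootsPoly l) (monic_rootsPoly l)
    ((natDegree_rootsPoly l).trans hl)).mono fun f _ h u => ?_
  rw [← map_rootsPoly]
  exact h u

/-- The contact of the curve with lines is as mild as dimension counts predict. -/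
structure MildContact (f : MvPolynomial (Fin 2) ℂ) : Prop where
  four : ∀ p w, w ≠ 0 → ¬ Contact f p w 4
  three_two : ∀ (p w : ℂ × ℂ) (t : ℂ), w ≠ 0 → t ≠ 0 → Contact f p w 3 →
    ¬ Contact f (p.1 + t * w.1, p.2 + t * w.2) w 2
  two_two_two : ∀ (p w : ℂ × ℂ) (s t : ℂ), w ≠ 0 → s ≠ 0 → t ≠ 0 → s ≠ t → Contact f p w 2 →
    Contact f (p.1 + s * w.1, p.2 + s * w.2) w 2 →
    ¬ Contact f (p.1 + t * w.1, p.2 + t * w.2) w 2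
  three : ∀ p w : ℂ × ℂ, w ≠ 0 → Contact f p w 3 → (w.1 ≠ 0 ∧ w.2 ≠ 0) ∧ p ∈ Torus
  two_two : ∀ (p w : ℂ × ℂ) (t : ℂ), w ≠ 0 → t ≠ 0 → Contact f p w 2 →
    Contact f (p.1 + t * w.1, p.2 + t * w.2) w 2 → (w.1 ≠ 0 ∧ w.2 ≠ 0) ∧ p ∈ Torus

theorem genericOn_mildContact {c d : ℕ} (hc : 5 ≤ c) (hd : 5 ≤ d) :
    GenericOn (qhExponents c d) MildContact := by
  have hc0 : 0 < c := by omega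
  have hd0 : 0 < d := by omega
  have v3 := genericOn_vertical_roots (c := c) (n := 2) (by omega : 2 ≤ d) hc0 hd0 (X 0)
    [(X 1, 3)] (by simp)
  have v22 := genericOn_vertical_roots (c := c) (n := 3) (by omega : 3 ≤ d) hc0 hd0 (X 0)
    [(X 1, 2), (X 2, 2)] (by simp)
  have h3 := genericOn_line_roots (d := d) (n := 2) (by omega : 2 ≤ c) hc0 hd0 (X 0) 0
    [(X 1, 3)] (by simp)
  have h22 := genericOn_line_roots (d := d) (n := 3) (by omega : 3 ≤ c) hc0 hd0 (X 0) 0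
    [(X 1, 2), (X 2, 2)] (by simp)
  have a4 := genericOn_line_roots (d := d) (n := 3) (by omega : 3 ≤ c) hc0 hd0 (X 0) (X 1)
    [(X 2, 4)] (by simp)
  have a32 := genericOn_line_roots (d := d) (n := 4) (by omega : 4 ≤ c) hc0 hd0 (X 0) (X 1)
    [(X 2, 3), (X 3, 2)] (by simp)
  have a222 := genericOn_line_roots (d := d) (n := 5) (by omega : 5 ≤ c) hc0 hd0 (X 0) (X 1)
    [(X 2, 2), (X 3, 2), (X 4, 2)] (by simp)
  have x3 := genericOn_line_roots (d := d) (n := 2) (by omega : 2 ≤ c) hc0 hd0 (X 0) (X 1)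
    [(0, 3)] (by simp)
  have y3 := genericOn_line_roots (d := d) (n := 2) (by omega : 2 ≤ c) hc0 hd0 (-X 0 * X 1) (X 1)
    [(X 0, 3)] (by simp)
  have x22 := genericOn_line_roots (d := d) (n := 3) (by omega : 3 ≤ c) hc0 hd0 (X 0) (X 1)
    [(0, 2), (X 2, 2)] (by simp)
  have y22 := genericOn_line_roots (d := d) (n := 3) (by omega : 3 ≤ c) hc0 hd0 (-X 0 * X 1) (X 1)
    [(X 0, 2), (X 2, 2)] (by simp)
  refine (v3.and (v22.and (h3.and (h22.and (a4.and (a32.and (a222.and (x3.and (y3.and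
    (x22.and y22)))))))))).mono ?_
  rintro f _ ⟨v3, v22, h3, h22, a4, a32, a222, x3, y3, x22, y22⟩
  simp only [List.map_cons, List.map_nil, List.prod_cons, List.prod_nil, mul_one] at v3 v22 h3 h22 a4 a32 a222 x3 y3 x22 y22
  have three : ∀ p w : ℂ × ℂ, w ≠ 0 → Contact f p w 3 → (w.1 ≠ 0 ∧ w.2 ≠ 0) ∧ p ∈ Torus := by
    intro p w hw h
    have hw1 : w.1 ≠ 0 := fun hw1 => v3 ![p.1, p.2] (by simpa using h.dvd_vertical hw hw1)
    have h' := h.dvd_line hw1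
    refine ⟨⟨hw1, fun hw2 => h3 ![p.2, p.1] ?_⟩, fun hp1 => x3 ![p.2, w.2 / w.1] ?_,
      fun hp2 => y3 ![p.1, w.2 / w.1] ?_⟩
    · simpa [hw2] using h'
    · simpa [hp1] using h'
    · simpa [hp2] using h'
  have two_two : ∀ (p w : ℂ × ℂ) (t : ℂ), w ≠ 0 → t ≠ 0 → Contact f p w 2 →
      Contact f (p.1 + t * w.1, p.2 + t * w.2) w 2 → (w.1 ≠ 0 ∧ w.2 ≠ 0) ∧ p ∈ Torus := by
    intro p w t hw ht h1 h2
    have hw1 : w.1 ≠ 0 := fun hw1 => by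
      have hw2 : w.2 ≠ 0 := fun h2 => hw (Prod.ext hw1 h2)
      have e1 := h1.dvd_vertical hw hw1
      have e2 := h2.dvd_vertical hw hw1
      have e := (isCoprime_X_sub_C_pow (ne_add_mul ht hw2) 2 2).mul_dvd e1 (by simpa [hw1] using e2)
      exact v22 ![p.1, p.2, p.2 + t * w.2] (by simpa using e)
    have e := (isCoprime_X_sub_C_pow (ne_add_mul ht hw1) 2 2).mul_dvd (h1.dvd_line hw1)
      (h2.dvd_line_add hw1)
    refine ⟨⟨hw1, fun hw2 => h22 ![p.2, p.1, p.1 + t * w.1] ?_⟩,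
      fun hp1 => x22 ![p.2, w.2 / w.1, p.1 + t * w.1] ?_,
      fun hp2 => y22 ![p.1, w.2 / w.1, p.1 + t * w.1] ?_⟩
    · simpa [hw2] using e
    · simpa [hp1] using e
    · simpa [hp2] using e
  refine ⟨?_, ?_, ?_, three, two_two⟩
  · intro p w hw h
    have hw1 := (three p w hw (h.mono (by norm_num))).1.1
    exact a4 ![p.2 - p.1 * (w.2 / w.1), w.2 / w.1, p.1] (by simpa using h.dvd_line hw1)
  · intro p w t hw ht h1 h2
    have hw1 := (three p w hw h1).1.1
    have e := (isCoprime_X_sub_C_pow (ne_add_mul ht hw1) 3 2).mul_dvd (h1.dvd_line hw1)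
      (h2.dvd_line_add hw1)
    exact a32 ![p.2 - p.1 * (w.2 / w.1), w.2 / w.1, p.1, p.1 + t * w.1] (by simpa using e)
  · intro p w s t hw hs ht hst h1 h2 h3
    have hw1 := (two_two p w s hw hs h1 h2).1.1
    have hne : p.1 + s * w.1 ≠ p.1 + t * w.1 := fun h =>
      hst (mul_right_cancel₀ hw1 (add_left_cancel h))
    have e := (isCoprime_X_sub_C_pow hne 2 2).mul_dvd (h2.dvd_line_add hw1) (h3.dvd_line_add hw1)
    have hdvd := (IsCoprime.mul_right (isCoprime_X_sub_C_pow (ne_add_mul hs hw1) 2 2)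
      (isCoprime_X_sub_C_pow (ne_add_mul ht hw1) 2 2)).mul_dvd (h1.dvd_line hw1) e
    exact a222 ![p.2 - p.1 * (w.2 / w.1), w.2 / w.1, p.1, p.1 + s * w.1, p.1 + t * w.1]
      (by simpa using hdvd)

/-- The genericity conditions under which the inflection points and bitangents are counted. -/
structure Nondegenerate (c d : ℕ) (f : MvPolynomial (Fin 2) ℂ) : Prop extends MildContact f where
  wt : WtLe c d f
  coeff_x : coeff (exponent c 0) f ≠ 0
  coeff_y : coeff (exponent 0 d) f ≠ 0
  smooth : ∀ p, evalP f p = 0 → ¬ (evalP (pderiv 0 f) p = 0 ∧ evalP (pderiv 1 f) p = 0)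
  edge : ∀ y, evalP (deform c d 0 f) (1, y) = 0 → evalP (pderiv 1 (deform c d 0 f)) (1, y) ≠ 0

theorem evalP_zero_eq {c d : ℕ} {f : MvPolynomial (Fin 2) ℂ} (h : WtLe c d f) (hd : 0 < d)
    (x : ℂ) : evalP (deform c d 0 f) (x, 0) = coeff (exponent c 0) f * x ^ c := by
  classical
  rw [← coeff_deform_x c d 0 f]
  rw [evalP, eval_eq']
  simp only [Fin.prod_univ_two]
  have h0 : ∀ m ∈ (deform c d 0 f).support, m ≠ exponent c 0 →
      coeff m (deform c d 0 f) * (x ^ m 0 * 0 ^ m 1) = 0 := by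
    intro m hm hne
    have h1 := h.deform 0 m hm
    rw [mem_support_iff, coeff_deform] at hm
    have h2 : c * d - (d * m 0 + c * m 1) = 0 := by
      by_contra h3
      exact left_ne_zero_of_mul hm (zero_pow h3)
    have h3 : m 1 ≠ 0 := by
      intro h3
      apply hne
      rw [eq_exponent_iff]
      refine ⟨?_, h3⟩
      rw [h3, mul_zero, add_zero] at h1 h2
      refine Nat.eq_of_mul_eq_mul_left hd ?_
      rw [mul_comm d c]
      omega
    rw [zero_pow h3, mul_zero, mul_zero]
  by_cases hm : exponent c 0 ∈ (deform c d 0 f).support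
  · simp only [if_true, Fin.reduceEq, if_false]
    rw [Finset.sum_eq_single_of_mem _ hm h0, exponent_zero, exponent_one]
    simp
  · rw [notMem_support_iff.1 hm, zero_mul]
    simp only [if_true, Fin.reduceEq, if_false]
    exact Finset.sum_eq_zero fun m hm' => h0 m hm' fun h2 => hm (h2 ▸ hm')

theorem genericOn_nondegenerate {c d : ℕ} (hc : 5 ≤ c) (hd : 5 ≤ d) :
    GenericOn (qhExponents c d) (Nondegenerate c d) := by
  have hc0 : 0 < c := by omega
  have hd0 : 0 < d := by omega
  have kx : ((c : ℤ), (0 : ℤ)) ∈ qhExponents c d := ⟨by simp, le_rfl, by simp [mul_comm]⟩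
  have ky : ((0 : ℤ), (d : ℤ)) ∈ qhExponents c d := ⟨le_rfl, by simp, by simp⟩
  refine ((genericOn_mildContact hc hd).and ((genericOn_coeffAt_ne_zero kx).and
    ((genericOn_coeffAt_ne_zero ky).and ((genericOn_smooth hc0 hd0).and
      (genericOn_edge hc0 hd0))))).mono ?_
  rintro f hf ⟨h, hx, hy, hs, he⟩
  have hwt := WtLe.of_suppIn hf
  have hx' : coeff (exponent c 0) f ≠ 0 := by simpa [coeffAt, exponent] using hx
  refine ⟨h, hwt, hx', by simpa [coeffAt, exponent] using hy, hs, fun y h0 => ?_⟩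
  rcases he y h0 with h1 | rfl
  · exact right_ne_zero_of_mul h1
  · rw [evalP_zero_eq hwt hd0] at h0
    simp [hx'] at h0

end NondegenerateLines

section Counting

open Filter Topology Asymptotics

theorem evalP_fibre (f : MvPolynomial (Fin 2) ℂ) (x y : ℂ) :
    (lineRestrict f (x, 0) (0, 1)).eval y = evalP f (x, y) := by
  rw [eval_lineRestrict]
  simp

theorem WtLe.natDegree_fibre {c d : ℕ} {f : MvPolynomial (Fin 2) ℂ} (h : WtLe c d f)
    (hc : 0 < c) (hd : 0 < d) (hy : coeff (exponent 0 d) f ≠ 0) (x : ℂ) :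
    (lineRestrict f (x, 0) (0, 1)).natDegree = d := by
  refine le_antisymm (h.natDegree_vertical_le hc _ _) (Polynomial.le_natDegree_of_ne_zero ?_)
  rw [h.coeff_vertical hc hd]
  simpa using hy

theorem WtLe.fibre_ne_zero {c d : ℕ} {f : MvPolynomial (Fin 2) ℂ} (h : WtLe c d f)
    (hc : 0 < c) (hd : 0 < d) (hy : coeff (exponent 0 d) f ≠ 0) (x : ℂ) :
    lineRestrict f (x, 0) (0, 1) ≠ 0 := by
  intro h0
  have := h.natDegree_fibre hc hd hy x
  rw [h0, Polynomial.natDegree_zero] at this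
  omega

theorem WtLe.leadingCoeff_fibre {c d : ℕ} {f : MvPolynomial (Fin 2) ℂ} (h : WtLe c d f)
    (hc : 0 < c) (hd : 0 < d) (hy : coeff (exponent 0 d) f ≠ 0) (x : ℂ) :
    (lineRestrict f (x, 0) (0, 1)).leadingCoeff = coeff (exponent 0 d) f := by
  rw [Polynomial.leadingCoeff, h.natDegree_fibre hc hd hy, h.coeff_vertical hc hd]
  simp

/-- `N` is the norm of `G` from the curve `{f = 0}` to the `x`-axis. -/
def IsNorm (f G : MvPolynomial (Fin 2) ℂ) (N : Polynomial ℂ) : Prop :=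
  ∀ x, N.eval x = ((lineRestrict f (x, 0) (0, 1)).roots.map fun y => evalP G (x, y)).prod

/-- A bivariate polynomial as a polynomial in `y` over the polynomials in `x`. -/
def toBivariate : MvPolynomial (Fin 2) ℂ →ₐ[ℂ] Polynomial (Polynomial ℂ) :=
  aeval (fun i => if i = 0 then Polynomial.C Polynomial.X else Polynomial.X)

theorem map_toBivariate (f : MvPolynomial (Fin 2) ℂ) (x : ℂ) :
    (toBivariate f).map (Polynomial.evalRingHom x) = lineRestrict f (x, 0) (0, 1) := by
  induction f using MvPolynomial.induction_on with
  | C a => simp [toBivariate, lineRestrict]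
  | add f g hf hg =>
    simp only [map_add, Polynomial.map_add, hf, hg]
    simp [lineRestrict]
  | mul_X f i hf =>
    simp only [map_mul, Polynomial.map_mul, hf]
    fin_cases i <;> simp [toBivariate, lineRestrict]

theorem WtLe.exists_isNorm {c d : ℕ} {f : MvPolynomial (Fin 2) ℂ} (h : WtLe c d f)
    (hc : 0 < c) (hd : 0 < d) (hy : coeff (exponent 0 d) f ≠ 0) (G : MvPolynomial (Fin 2) ℂ) :
    ∃ N, IsNorm f G N := by
  set n := (toBivariate G).natDegree with hn
  set β := coeff (exponent 0 d) f
  refine ⟨Polynomial.C (β⁻¹ ^ n) * Polynomial.resultant (toBivariate f) (toBivariate G) d n,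
    fun x => ?_⟩
  have h1 := Polynomial.resultant_map_map (toBivariate f) (toBivariate G) d n
    (Polynomial.evalRingHom x)
  rw [map_toBivariate, map_toBivariate, Polynomial.coe_evalRingHom] at h1
  have h2 := Polynomial.resultant_eq_prod_eval (lineRestrict f (x, 0) (0, 1))
    (lineRestrict G (x, 0) (0, 1)) n
    (by rw [← map_toBivariate]; exact Polynomial.natDegree_map_le) (IsAlgClosed.splits _)
  rw [h.natDegree_fibre hc hd hy, h.leadingCoeff_fibre hc hd hy, h1] at h2
  rw [Polynomial.eval_mul, h2, Polynomial.eval_C, ← mul_assoc, ← mul_pow, inv_mul_cancel₀ hy,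
    one_pow, one_mul]
  congr 1
  exact Multiset.map_congr rfl fun y _ => evalP_fibre G x y

theorem WtLe.prod_roots_sub {c d : ℕ} {f : MvPolynomial (Fin 2) ℂ} (h : WtLe c d f)
    (hc : 0 < c) (hd : 0 < d) (hy : coeff (exponent 0 d) f ≠ 0) (x y₀ : ℂ) :
    ((lineRestrict f (x, 0) (0, 1)).roots.map fun y => y - y₀).prod
      = (-1) ^ d * (coeff (exponent 0 d) f)⁻¹ * evalP f (x, y₀) := by
  have h1 := (IsAlgClosed.splits (lineRestrict f (x, 0) (0, 1))).eq_prod_roots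
  have h2 := congrArg (Polynomial.eval y₀) h1
  rw [evalP_fibre, Polynomial.eval_mul, Polynomial.eval_C, h.leadingCoeff_fibre hc hd hy,
    Polynomial.eval_multiset_prod, Multiset.map_map] at h2
  have h3 : ((lineRestrict f (x, 0) (0, 1)).roots.map fun y => y - y₀).prod
      = (-1) ^ d * ((lineRestrict f (x, 0) (0, 1)).roots.map
        (Polynomial.eval y₀ ∘ fun a => Polynomial.X - Polynomial.C a)).prod := by
    have h4 : d = Multiset.card (lineRestrict f (x, 0) (0, 1)).roots := by
      rw [IsAlgClosed.card_roots_eq_natDegree, h.natDegree_fibre hc hd hy]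
    conv_rhs => rw [h4]
    rw [← Multiset.prod_replicate, ← Multiset.map_const', ← Multiset.prod_map_mul]
    simp
  rw [h3, h2]
  field_simp

theorem Polynomial.natDegree_eq_sum_rootMultiplicity {p : Polynomial ℂ} (hp : p ≠ 0)
    {T : Finset ℂ} (hT : ∀ x, p.eval x = 0 → x ∈ T) :
    p.natDegree = ∑ x ∈ T, p.rootMultiplicity x := by
  classical
  rw [← IsAlgClosed.card_roots_eq_natDegree, ← Multiset.toFinset_sum_count_eq]
  simp only [Polynomial.count_roots]
  refine Finset.sum_subset (fun x hx => hT x ?_) fun x _ hx => ?_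
  · exact (Polynomial.mem_roots hp).1 (Multiset.mem_toFinset.1 hx)
  · rw [← Polynomial.count_roots]
    exact Multiset.count_eq_zero.2 fun h => hx (Multiset.mem_toFinset.2 h)

/-- A family of points of the curve `{f = 0}` which tends to `p₀` off its vertical line. -/
structure IsBranch (f : MvPolynomial (Fin 2) ℂ) (p₀ : ℂ × ℂ) (u : Ultrafilter ℂ)
    (p : ℂ → ℂ × ℂ) : Prop where
  tendsto : Tendsto p u (𝓝 p₀)
  zero : ∀ᶠ a in (u : Filter ℂ), evalP f (p a) = 0
  ne : ∀ᶠ a in (u : Filter ℂ), (p a).1 ≠ p₀.1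

theorem IsBranch.tendsto_evalP {f : MvPolynomial (Fin 2) ℂ} {p₀ : ℂ × ℂ} {u : Ultrafilter ℂ}
    {p : ℂ → ℂ × ℂ} (h : IsBranch f p₀ u p) (g : MvPolynomial (Fin 2) ℂ) :
    Tendsto (fun a => evalP g (p a)) u (𝓝 (evalP g p₀)) :=
  ((continuous_evalP g).tendsto p₀).comp h.tendsto

theorem IsBranch.eval_eq_zero {f : MvPolynomial (Fin 2) ℂ} {p₀ : ℂ × ℂ} {u : Ultrafilter ℂ}
    {p : ℂ → ℂ × ℂ} (h : IsBranch f p₀ u p) : evalP f p₀ = 0 :=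
  tendsto_nhds_unique (h.tendsto_evalP f)
    (tendsto_const_nhds.congr' (h.zero.mono fun _ ha => ha.symm))

theorem rootMultiplicity_isNorm {c d : ℕ} {f G B : MvPolynomial (Fin 2) ℂ} (h : WtLe c d f)
    (hc : 0 < c) (hd : 0 < d) (hy : coeff (exponent 0 d) f ≠ 0) {NG NB : Polynomial ℂ}
    (hNG : IsNorm f G NG) (hNB : IsNorm f B NB) (hG0 : NG ≠ 0) (hB0 : NB ≠ 0) (x₀ : ℂ)
    (S : Finset ℂ) (hS : ∀ y ∈ S, evalP f (x₀, y) = 0 ∧ evalP (pderiv 0 f) (x₀, y) ≠ 0)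
    (h1 : ∀ y₀ ∉ S, ∀ u p, IsBranch f (x₀, y₀) u p →
      (fun a => evalP G (p a)) =Θ[u] fun a => evalP B (p a))
    (h2 : ∀ y₀ ∈ S, ∀ u p, IsBranch f (x₀, y₀) u p →
      (fun a => evalP G (p a)) =Θ[u] fun a => evalP B (p a) * ((p a).2 - y₀)) :
    NG.rootMultiplicity x₀ = NB.rootMultiplicity x₀ + S.card := by
  let q : ℂ → Polynomial ℂ := fun y => lineRestrict f (0, y) (1, 0)
  have hq : ∀ x y, (q y).eval x = evalP f (x, y) := fun x y => by
    simp only [q, eval_lineRestrict]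
    simp
  have hqm : ∀ y ∈ S, (q y) ≠ 0 ∧ (q y).rootMultiplicity x₀ = 1 := by
    intro y hyS
    obtain ⟨e0, e1⟩ := hS y hyS
    have hder : (Polynomial.derivative (q y)).eval x₀ ≠ 0 := by
      simp only [q, derivative_lineRestrict, Polynomial.eval_add, Polynomial.eval_mul,
        eval_lineRestrict]
      simpa using e1
    have hne : q y ≠ 0 := fun h0 => hder (by rw [h0]; simp)
    have hroot : (q y).IsRoot x₀ := by
      rw [Polynomial.IsRoot, hq, e0]
    refine ⟨hne, le_antisymm ?_ ((Polynomial.rootMultiplicity_pos hne).2 hroot)⟩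
    by_contra! hlt
    exact hder ((Polynomial.one_lt_rootMultiplicity_iff_isRoot hne).1 hlt).2
  have hprod : ∏ y ∈ S, q y ≠ 0 := Finset.prod_ne_zero_iff.2 fun y hyS => (hqm y hyS).1
  have hmult : (∏ y ∈ S, q y).rootMultiplicity x₀ = S.card := by
    rw [← Polynomial.count_roots, Polynomial.roots_prod _ _ hprod, Multiset.count_bind]
    simp only [Polynomial.count_roots]
    rw [Multiset.map_congr rfl fun y hyS => (hqm y hyS).2]
    simp
  rw [← hmult, ← Polynomial.rootMultiplicity_mul (mul_ne_zero hB0 hprod)]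
  refine Polynomial.rootMultiplicity_eq_of_isTheta hG0 (mul_ne_zero hB0 hprod) ?_
  have hmain := isTheta_prod_roots (l := 𝓝[≠] x₀)
    (P := fun x => lineRestrict f (x, 0) (0, 1)) (N := d)
    (Eventually.of_forall fun x => h.natDegree_fibre hc hd hy x)
    (Eventually.of_forall fun x => h.fibre_ne_zero hc hd hy x)
    (g := fun x y => evalP G (x, y)) (h := fun x y => evalP B (x, y) * ∏ y₀ ∈ S, (y - y₀)) ?_
  · have e1 : (fun x => NG.eval x) = fun x =>
        ((lineRestrict f (x, 0) (0, 1)).roots.map fun y => evalP G (x, y)).prod := funext hNG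
    rw [e1]
    refine hmain.trans ?_
    have e2 : (fun x => ((lineRestrict f (x, 0) (0, 1)).roots.map
        fun y => evalP B (x, y) * ∏ y₀ ∈ S, (y - y₀)).prod) = fun x =>
        ((-1) ^ d * (coeff (exponent 0 d) f)⁻¹) ^ S.card * (NB * ∏ y ∈ S, q y).eval x := by
      funext x
      rw [Multiset.prod_map_mul, ← hNB x, Multiset.prod_map_prod, Polynomial.eval_mul,
        Polynomial.eval_prod]
      simp only [h.prod_roots_sub hc hd hy, Finset.prod_mul_distrib, hq, Finset.prod_const]
      ring
    rw [e2]
    refine IsTheta.const_mul_left (pow_ne_zero _ (mul_ne_zero (by simp) (inv_ne_zero hy))) ?_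
    exact isTheta_refl _ _
  · intro z u hu hz
    have hu0 : Tendsto (fun x : ℂ => x) u (𝓝 x₀) := hu.trans nhdsWithin_le_nhds
    have hlim : Tendsto (fun x : ℂ => ((x, 0) : ℂ × ℂ)) u (𝓝 (x₀, 0)) :=
      hu0.prodMk_nhds tendsto_const_nhds
    obtain ⟨y₁, hy₁, -⟩ := (coeffTendsto_lineRestrict f hlim
      (tendsto_const_nhds (x := ((0, 1) : ℂ × ℂ)))).tendsto_root (N := d)
      (fun x => (h.natDegree_fibre hc hd hy x).le)
      (by rw [h.coeff_vertical hc hd]; simpa using hy) hz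
    have hb : IsBranch f (x₀, y₁) u (fun x => (x, z x)) := by
      refine ⟨hu0.prodMk_nhds hy₁, ?_, ?_⟩
      · filter_upwards [hz] with x hx
        rwa [evalP_fibre] at hx
      · exact hu self_mem_nhdsWithin
    have hothers : ∀ S' : Finset ℂ, y₁ ∉ S' →
        (fun x => ∏ y₀ ∈ S', (z x - y₀)) =Θ[(u : Filter ℂ)] fun _ => (1 : ℂ) := by
      intro S' hS'
      refine isTheta_one_of_tendsto (tendsto_finsetProd _ fun y₀ _ => hy₁.sub_const y₀) ?_
      rw [Finset.prod_ne_zero_iff]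
      rintro y₀ hy₀ h0
      exact hS' (sub_eq_zero.1 h0 ▸ hy₀)
    by_cases hmem : y₁ ∈ S
    · have e : (fun x => evalP B (x, z x) * ∏ y₀ ∈ S, (z x - y₀)) = fun x =>
          (evalP B (x, z x) * (z x - y₁)) * ∏ y₀ ∈ S.erase y₁, (z x - y₀) := by
        funext x
        rw [mul_assoc, Finset.mul_prod_erase S (fun y₀ => z x - y₀) hmem]
      change _ =Θ[(u : Filter ℂ)] fun x => evalP B (x, z x) * ∏ y₀ ∈ S, (z x - y₀)
      rw [e]
      simpa using (h2 y₁ hmem u _ hb).mul (hothers (S.erase y₁) (Finset.notMem_erase _ _)).symm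
    · simpa using (h1 y₁ hmem u _ hb).mul (hothers S hmem).symm

/-- Counting points of a curve by comparing two norms. -/
theorem ncard_eq_of_isNorm {c d : ℕ} {f G B : MvPolynomial (Fin 2) ℂ} (h : WtLe c d f)
    (hc : 0 < c) (hd : 0 < d) (hy : coeff (exponent 0 d) f ≠ 0) {NG NB : Polynomial ℂ}
    (hNG : IsNorm f G NG) (hNB : IsNorm f B NB) (hG0 : NG ≠ 0) (hB0 : NB ≠ 0)
    (Z : Set (ℂ × ℂ)) (hZ : ∀ p ∈ Z, evalP f p = 0 ∧ evalP (pderiv 0 f) p ≠ 0)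
    (h1 : ∀ p₀ ∉ Z, ∀ u p, IsBranch f p₀ u p →
      (fun a => evalP G (p a)) =Θ[u] fun a => evalP B (p a))
    (h2 : ∀ p₀ ∈ Z, ∀ u p, IsBranch f p₀ u p →
      (fun a => evalP G (p a)) =Θ[u] fun a => evalP B (p a) * ((p a).2 - p₀.2)) :
    Z.Finite ∧ Z.ncard + NB.natDegree = NG.natDegree := by
  classical
  have hfin : ∀ x, {y | (x, y) ∈ Z}.Finite := fun x => by
    refine ((lineRestrict f (x, 0) (0, 1)).roots.toFinset.finite_toSet).subset fun y hyZ => ?_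
    rw [Finset.mem_coe, Multiset.mem_toFinset, Polynomial.mem_roots (h.fibre_ne_zero hc hd hy x),
      Polynomial.IsRoot, evalP_fibre]
    exact (hZ _ hyZ).1
  let S : ℂ → Finset ℂ := fun x => (hfin x).toFinset
  have hSmem : ∀ x y, y ∈ S x ↔ (x, y) ∈ Z := fun x y => by simp [S]
  have hrm : ∀ x, NG.rootMultiplicity x = NB.rootMultiplicity x + (S x).card := fun x =>
    rootMultiplicity_isNorm h hc hd hy hNG hNB hG0 hB0 x (S x)
      (fun y hyS => hZ _ ((hSmem x y).1 hyS))
      (fun y hyS => h1 _ (mt (hSmem x y).2 hyS)) (fun y hyS => h2 _ ((hSmem x y).1 hyS))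
  let T := NG.roots.toFinset
  have hTG : ∀ x, NG.eval x = 0 → x ∈ T := fun x hx =>
    Multiset.mem_toFinset.2 ((Polynomial.mem_roots hG0).2 hx)
  have hTB : ∀ x, NB.eval x = 0 → x ∈ T := fun x hx => by
    refine hTG x ((Polynomial.rootMultiplicity_pos hG0).1 ?_)
    have := (Polynomial.rootMultiplicity_pos hB0).2 hx
    have := hrm x
    omega
  have hTS : ∀ p ∈ Z, p.1 ∈ T := fun p hp => by
    refine hTG _ ((Polynomial.rootMultiplicity_pos hG0).1 ?_)
    have h3 : 0 < (S p.1).card := Finset.card_pos.2 ⟨p.2, (hSmem _ _).2 hp⟩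
    have := hrm p.1
    omega
  have hZeq : Z = ((T.sigma S).map
      ⟨fun s => (s.1, s.2), fun s t hst => by
        obtain ⟨s1, s2⟩ := s
        obtain ⟨t1, t2⟩ := t
        simp only [Prod.mk.injEq] at hst
        rw [hst.1, hst.2]⟩ : Finset (ℂ × ℂ)) := by
    ext p
    simp only [Finset.coe_map, Set.mem_image, Finset.mem_coe,
      Finset.mem_sigma]
    constructor
    · exact fun hp => ⟨⟨p.1, p.2⟩, ⟨hTS p hp, (hSmem _ _).2 hp⟩, rfl⟩
    · rintro ⟨s, ⟨-, hs⟩, rfl⟩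
      exact (hSmem _ _).1 hs
  refine ⟨hZeq ▸ Finset.finite_toSet _, ?_⟩
  rw [hZeq, Set.ncard_coe_finset, Finset.card_map, Finset.card_sigma,
    Polynomial.natDegree_eq_sum_rootMultiplicity hG0 hTG,
    Polynomial.natDegree_eq_sum_rootMultiplicity hB0 hTB, ← Finset.sum_add_distrib]
  exact Finset.sum_congr rfl fun x _ => by rw [hrm x, add_comm]

/-- A family of points of the curve `{f = 0}`, written in the coordinates which are suitable near
infinity, with limit `y₀` at infinity. -/
structure IsInfBranch (c d : ℕ) (f : MvPolynomial (Fin 2) ℂ) (y₀ : ℂ) (u : Ultrafilter ℂ)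
    (y : ℂ → ℂ) : Prop where
  le : ↑u ≤ 𝓝[≠] (0 : ℂ)
  tendsto : Tendsto y u (𝓝 y₀)
  zero : ∀ᶠ ε in (u : Filter ℂ), evalP (deform c d ε f) (1, y ε) = 0
  zero_lim : evalP (deform c d 0 f) (1, y₀) = 0

theorem WtLe.evalP_scale {c d : ℕ} {f : MvPolynomial (Fin 2) ℂ} (h : WtLe c d f) {ε : ℂ}
    (hε : ε ≠ 0) (p : ℂ × ℂ) :
    evalP (_root_.deform c d ε f) p = ε ^ (c * d) * evalP f (ε⁻¹ ^ d * p.1, ε⁻¹ ^ c * p.2) := by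
  have h1 := congrArg (fun q => q.eval 0) (h.lineRestrict_scale ε ε⁻¹ p (0, 0))
  simp only [inv_mul_cancel₀ hε, deform_one, eval_lineRestrict, Polynomial.eval_mul,
    Polynomial.eval_C, zero_mul, add_zero] at h1
  rw [h1, ← mul_assoc, ← mul_pow, mul_inv_cancel₀ hε, one_pow, one_mul]

theorem natDegree_isNorm {c d : ℕ} {f G : MvPolynomial (Fin 2) ℂ} (h : WtLe c d f)
    (hc : 0 < c) (hd : 0 < d) (hy : coeff (exponent 0 d) f ≠ 0) {N : Polynomial ℂ}
    (hN : IsNorm f G N) {w : ℕ}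
    (H : ∀ y₀ u y, IsInfBranch c d f y₀ u y →
      (fun ε => evalP G (ε⁻¹ ^ d, ε⁻¹ ^ c * y ε)) =Θ[u] fun ε => ε⁻¹ ^ w) :
    N ≠ 0 ∧ N.natDegree = w := by
  have hmain := isTheta_prod_roots (l := 𝓝[≠] (0 : ℂ))
    (P := fun ε => lineRestrict f (ε⁻¹ ^ d, 0) (0, 1)) (N := d)
    (Eventually.of_forall fun x => h.natDegree_fibre hc hd hy _)
    (Eventually.of_forall fun x => h.fibre_ne_zero hc hd hy _)
    (g := fun ε y => evalP G (ε⁻¹ ^ d, y)) (h := fun ε _ => ε⁻¹ ^ w) ?_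
  · have h2 : (N.comp (Polynomial.X ^ d)) ≠ 0 ∧ (N.comp (Polynomial.X ^ d)).natDegree = w * d := by
      refine Polynomial.natDegree_eq_of_isTheta (l := 𝓝[≠] (0 : ℂ)) (ε := fun ε => ε)
        tendsto_id ?_
      refine (EventuallyEq.isTheta (Eventually.of_forall fun ε => ?_)).trans
        (hmain.trans (EventuallyEq.isTheta (Eventually.of_forall fun ε => ?_)))
      · simp only [Polynomial.eval_comp, Polynomial.eval_pow, Polynomial.eval_X]
        exact hN _
      · simp only [Multiset.map_const', Multiset.prod_replicate,
          IsAlgClosed.card_roots_eq_natDegree, h.natDegree_fibre hc hd hy]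
        rw [← pow_mul]
    refine ⟨fun h0 => h2.1 (by rw [h0, Polynomial.zero_comp]), ?_⟩
    have h3 := h2.2
    rw [Polynomial.natDegree_comp, Polynomial.natDegree_X_pow] at h3
    exact Nat.eq_of_mul_eq_mul_right hd h3
  · intro z u hu hz
    have hu0 : Tendsto (fun x : ℂ => x) u (𝓝 0) := hu.trans nhdsWithin_le_nhds
    have hne : ∀ᶠ ε in (u : Filter ℂ), ε ≠ 0 := hu self_mem_nhdsWithin
    let y : ℂ → ℂ := fun ε => ε ^ c * z ε
    have hyz : ∀ ε, ε ≠ 0 → ε⁻¹ ^ c * y ε = z ε := fun ε hε => by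
      simp only [y]
      rw [← mul_assoc, ← mul_pow, inv_mul_cancel₀ hε, one_pow, one_mul]
    have hzero : ∀ᶠ ε in (u : Filter ℂ), evalP (deform c d ε f) (1, y ε) = 0 := by
      filter_upwards [hz, hne] with ε h0 hε
      rw [h.evalP_scale hε]
      simp only [hyz ε hε, mul_one]
      rw [evalP_fibre] at h0
      rw [h0, mul_zero]
    obtain ⟨y₀, hy₀, hF⟩ := (coeffTendsto_lineRestrict_deform c d f hu0
      (tendsto_const_nhds (x := ((1, 0) : ℂ × ℂ)))
      (tendsto_const_nhds (x := ((0, 1) : ℂ × ℂ)))).tendsto_root (N := d) (z := y)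
      (fun ε => (h.deform ε).natDegree_vertical_le hc _ _)
      (by rw [(h.deform 0).coeff_vertical hc hd, coeff_deform_y]; simpa using hy)
      (by
        filter_upwards [hzero] with ε h0
        rwa [evalP_fibre])
    rw [evalP_fibre] at hF
    refine (EventuallyEq.isTheta ?_).trans (H y₀ u y ⟨hu, hy₀, hzero, hF⟩)
    filter_upwards [hne] with ε hε
    rw [hyz ε hε]

end Counting

section LeadingForm

open Filter Topology Asymptotics

/-- The polynomial whose roots are the residualPoly intersections of the curve with its tangent line
at `p`. -/
def residualPoly (f : MvPolynomial (Fin 2) ℂ) (p : ℂ × ℂ) : Polynomial ℂ :=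
  (lineRestrict f p (tdir f p)).divX.divX

theorem coeff_residual (f : MvPolynomial (Fin 2) ℂ) (p : ℂ × ℂ) (n : ℕ) :
    (residualPoly f p).coeff n = (lineRestrict f p (tdir f p)).coeff (n + 2) := by
  rw [residualPoly, Polynomial.coeff_divX, Polynomial.coeff_divX]

theorem lineRestrict_tdir {f : MvPolynomial (Fin 2) ℂ} {p : ℂ × ℂ} (h : evalP f p = 0) :
    lineRestrict f p (tdir f p) = Polynomial.X ^ 2 * residualPoly f p := by
  have h2 := contact_tdir h
  rw [Contact, Polynomial.X_pow_dvd_iff] at h2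
  ext n
  rw [Polynomial.coeff_X_pow_mul']
  split_ifs with hn
  · rw [coeff_residual, Nat.sub_add_cancel hn]
  · exact h2 n (by omega)

theorem eval_residual_zero (f : MvPolynomial (Fin 2) ℂ) (p : ℂ × ℂ) :
    2 * (residualPoly f p).eval 0 = evalP (hess f) p := by
  rw [← Polynomial.coeff_zero_eq_eval_zero, coeff_residual, evalP_hess]

theorem contact_iff_residual {f : MvPolynomial (Fin 2) ℂ} {p : ℂ × ℂ} (h : evalP f p = 0) {t : ℂ}
    (ht : t ≠ 0) (k : ℕ) :
    Contact f (p.1 + t * (tdir f p).1, p.2 + t * (tdir f p).2) (tdir f p) k ↔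
      (Polynomial.X - Polynomial.C t) ^ k ∣ residualPoly f p := by
  rw [← contact_translate, lineRestrict_tdir h]
  have h1 : IsCoprime ((Polynomial.X - Polynomial.C t) ^ k) (Polynomial.X ^ 2 : Polynomial ℂ) := by
    have := isCoprime_X_sub_C_pow ht k 2
    simpa using this
  exact ⟨fun h2 => h1.dvd_of_dvd_mul_left h2, fun h2 => h2.mul_left _⟩

theorem X_sub_C_sq_dvd_iff {p : Polynomial ℂ} {t : ℂ} :
    (Polynomial.X - Polynomial.C t) ^ 2 ∣ p ↔
      p.eval t = 0 ∧ (Polynomial.derivative p).eval t = 0 := by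
  constructor
  · rintro ⟨q, rfl⟩
    simp [Polynomial.derivative_mul, Polynomial.derivative_pow]
  · rintro ⟨h0, h1⟩
    obtain ⟨q, rfl⟩ := Polynomial.dvd_iff_isRoot.2 h0
    rw [pow_two]
    refine mul_dvd_mul_left _ (Polynomial.dvd_iff_isRoot.2 ?_)
    simpa [Polynomial.derivative_mul] using h1

theorem WtLe.natDegree_residual_le {c d : ℕ} {f : MvPolynomial (Fin 2) ℂ} (h : WtLe c d f)
    (hd : 0 < d) (hdc : d < c) (p : ℂ × ℂ) : (residualPoly f p).natDegree ≤ c - 2 := by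
  rw [residualPoly, Polynomial.natDegree_divX_eq_natDegree_tsub_one,
    Polynomial.natDegree_divX_eq_natDegree_tsub_one]
  have := h.natDegree_lineRestrict_le hd hdc p (tdir f p)
  omega

theorem WtLe.coeff_residual {c d : ℕ} {f : MvPolynomial (Fin 2) ℂ} (h : WtLe c d f)
    (hd : 2 ≤ d) (hdc : d < c) (p : ℂ × ℂ) :
    (residualPoly f p).coeff (c - 2) = coeff (exponent c 0) f * evalP (pderiv 1 f) p ^ c := by
  rw [_root_.coeff_residual, Nat.sub_add_cancel (by omega), h.coeff_lineRestrict (by omega) hdc]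
  rfl

theorem evalP_zero_eq' {c d : ℕ} {f : MvPolynomial (Fin 2) ℂ} (h : WtLe c d f) (hc : 0 < c)
    (y : ℂ) : evalP (deform c d 0 f) (0, y) = coeff (exponent 0 d) f * y ^ d := by
  classical
  rw [← coeff_deform_y c d 0 f]
  rw [evalP, eval_eq']
  simp only [Fin.prod_univ_two]
  have h0 : ∀ m ∈ (deform c d 0 f).support, m ≠ exponent 0 d →
      coeff m (deform c d 0 f) * (0 ^ m 0 * y ^ m 1) = 0 := by
    intro m hm hne
    rw [mem_support_iff, coeff_deform] at hm
    have h1 := h m (mem_support_iff.2 (right_ne_zero_of_mul hm))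
    have h2 : c * d - (d * m 0 + c * m 1) = 0 := by
      by_contra h3
      exact left_ne_zero_of_mul hm (zero_pow h3)
    rcases Nat.eq_zero_or_pos (m 0) with h3 | h3
    · rw [h3, mul_zero, zero_add] at h1 h2
      have h4 : c * m 1 = c * d := by omega
      exact absurd (eq_exponent_iff.2 ⟨h3, Nat.eq_of_mul_eq_mul_left hc h4⟩) hne
    · rw [zero_pow h3.ne', zero_mul, mul_zero]
  by_cases hm : exponent 0 d ∈ (deform c d 0 f).support
  · have := Finset.sum_eq_single_of_mem (f := fun m =>
      coeff m (deform c d 0 f) * ((0 : ℂ) ^ m 0 * y ^ m 1)) _ hm h0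
    simp only [exponent_zero, exponent_one] at this
    simpa using this
  · rw [notMem_support_iff.1 hm, zero_mul]
    exact Finset.sum_eq_zero fun m hm' => by
      simpa using h0 m hm' fun h2 => hm (h2 ▸ hm')

theorem WtLe.evalP_euler {c d : ℕ} {f : MvPolynomial (Fin 2) ℂ} (h : WtLe c d f) {p : ℂ × ℂ}
    (hp : evalP (_root_.deform c d 0 f) p = 0) :
    d * p.1 * evalP (pderiv 0 (_root_.deform c d 0 f)) p
      + c * p.2 * evalP (pderiv 1 (_root_.deform c d 0 f)) p = 0 := by
  have := congrArg (fun g => evalP g p) h.euler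
  simpa [hp] using this

theorem WtLe.evalP_pderiv_scale {c d : ℕ} {f : MvPolynomial (Fin 2) ℂ} (h : WtLe c d f)
    (ε r : ℂ) (p w : ℂ × ℂ) :
    r ^ d * w.1 * evalP (pderiv 0 (_root_.deform c d (r * ε) f)) (r ^ d * p.1, r ^ c * p.2)
      + r ^ c * w.2 * evalP (pderiv 1 (_root_.deform c d (r * ε) f)) (r ^ d * p.1, r ^ c * p.2)
      = r ^ (c * d) * (w.1 * evalP (pderiv 0 (_root_.deform c d ε f)) p
        + w.2 * evalP (pderiv 1 (_root_.deform c d ε f)) p) := by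
  have h1 := congrArg (fun q => q.coeff 1) (h.lineRestrict_scale ε r p w)
  simpa only [Polynomial.coeff_C_mul, coeff_one_lineRestrict] using h1

theorem Nondegenerate.leadingForm_ne_zero {c d : ℕ} {f : MvPolynomial (Fin 2) ℂ}
    (h : Nondegenerate c d f) (hc : 0 < c) (hd : 0 < d) {p : ℂ × ℂ} (hp0 : p ≠ 0)
    (hp : evalP (deform c d 0 f) p = 0) :
    (p.1 ≠ 0 ∧ p.2 ≠ 0) ∧ evalP (pderiv 0 (deform c d 0 f)) p ≠ 0 ∧
      evalP (pderiv 1 (deform c d 0 f)) p ≠ 0 := by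
  have hc' : (c : ℂ) ≠ 0 := Nat.cast_ne_zero.2 hc.ne'
  have hd' : (d : ℂ) ≠ 0 := Nat.cast_ne_zero.2 hd.ne'
  obtain ⟨x, y⟩ := p
  have hx : x ≠ 0 := by
    rintro rfl
    rw [evalP_zero_eq' h.wt hc, mul_eq_zero, pow_eq_zero_iff hd.ne'] at hp
    exact hp0 (Prod.ext rfl (hp.resolve_left h.coeff_y))
  have hy : y ≠ 0 := by
    rintro rfl
    rw [evalP_zero_eq h.wt hd, mul_eq_zero, pow_eq_zero_iff hc.ne'] at hp
    exact hx (hp.resolve_left h.coeff_x)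
  have hFy : evalP (pderiv 1 (deform c d 0 f)) (x, y) ≠ 0 := by
    obtain ⟨r, hr⟩ := IsAlgClosed.exists_pow_nat_eq x hd
    have hr0 : r ≠ 0 := by
      rintro rfl
      exact hx (by rw [← hr, zero_pow hd.ne'])
    have e1 := congrArg (fun q => q.eval 0) (h.wt.lineRestrict_scale 0 r (1, y / r ^ c) (0, 0))
    have e2 := h.wt.evalP_pderiv_scale 0 r (1, y / r ^ c) (0, 1)
    have e3 : r ^ c * (y / r ^ c) = y := mul_div_cancel₀ _ (pow_ne_zero _ hr0)
    simp only [eval_lineRestrict, Polynomial.eval_mul, Polynomial.eval_C, mul_zero,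
      add_zero, mul_one, hr, e3, hp] at e1
    simp only [mul_zero, mul_one, hr, e3, zero_mul, zero_add, one_mul] at e2
    intro h0
    rw [h0, mul_zero] at e2
    have hrp : r ^ (c * d) ≠ 0 := pow_ne_zero _ hr0
    exact h.edge _ ((mul_eq_zero.1 e1.symm).resolve_left hrp)
      ((mul_eq_zero.1 e2.symm).resolve_left hrp)
  refine ⟨⟨hx, hy⟩, fun h0 => ?_, hFy⟩
  have := h.wt.evalP_euler hp
  rw [h0, mul_zero, zero_add] at this
  exact mul_ne_zero (mul_ne_zero hc' hy) hFy this

theorem Nondegenerate.position_dot_ne_zero {c d : ℕ} {f : MvPolynomial (Fin 2) ℂ}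
    (h : Nondegenerate c d f) (hc : 0 < c) (hd : 0 < d) (hcd : c ≠ d) {p : ℂ × ℂ} (hp0 : p ≠ 0)
    (hp : evalP (deform c d 0 f) p = 0) :
    p.1 * evalP (pderiv 0 (deform c d 0 f)) p + p.2 * evalP (pderiv 1 (deform c d 0 f)) p ≠ 0 := by
  obtain ⟨⟨hx, hy⟩, -, hFy⟩ := h.leadingForm_ne_zero hc hd hp0 hp
  have h1 := h.wt.evalP_euler hp
  have hcd' : (c : ℂ) - d ≠ 0 := sub_ne_zero.2 (Nat.cast_injective.ne hcd)
  intro h0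
  exact mul_ne_zero hcd' (mul_ne_zero hy hFy) (by linear_combination h1 - (d : ℂ) * h0)

theorem Nondegenerate.hess_leadingForm_ne_zero {c d : ℕ} {f : MvPolynomial (Fin 2) ℂ}
    (h : Nondegenerate c d f) (hc : 0 < c) (hd : 0 < d) (hcd : c ≠ d) {p : ℂ × ℂ} (hp0 : p ≠ 0)
    (hp : evalP (deform c d 0 f) p = 0) : evalP (hess (deform c d 0 f)) p ≠ 0 := by
  obtain ⟨⟨hx, hy⟩, hFx, hFy⟩ := h.leadingForm_ne_zero hc hd hp0 hp
  have h1 := h.wt.evalP_euler hp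
  have hcd' : (c : ℂ) - d ≠ 0 := sub_ne_zero.2 (Nat.cast_injective.ne hcd)
  have hd' : (d : ℂ) ≠ 0 := Nat.cast_ne_zero.2 hd.ne'
  have e0 := congrArg (fun g => evalP (pderiv 0 g) p) h.wt.euler
  have e1 := congrArg (fun g => evalP (pderiv 1 g) p) h.wt.euler
  set F := deform c d 0 f
  simp only [map_add, Derivation.leibniz, pderiv_C, pderiv_X, pderiv_one_zero, evalP_add, evalP_mul,
    evalP_C, evalP_X_zero, evalP_X_one, smul_eq_mul, mul_zero, add_zero, Pi.single_eq_same,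
    mul_one, ne_eq, one_ne_zero, zero_ne_one, not_false_eq_true,
    Pi.single_eq_of_ne] at e0 e1
  obtain ⟨m, hm⟩ : ∃ m, d * p.1 = m * evalP (pderiv 1 F) p :=
    ⟨d * p.1 / evalP (pderiv 1 F) p, (div_mul_cancel₀ _ hFy).symm⟩
  have hm' : c * p.2 = - m * evalP (pderiv 0 F) p := by
    refine mul_right_cancel₀ hFy ?_
    linear_combination h1 - evalP (pderiv 0 F) p * hm
  intro h0
  simp only [hess, evalP_add, evalP_sub, evalP_mul, evalP_pow, evalP_C] at h0
  refine mul_ne_zero (mul_ne_zero hd' hcd') (mul_ne_zero hx hFx) ?_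
  have key : (d * p.1) ^ 2 * evalP (pderiv 0 (pderiv 0 F)) p
      + 2 * (d * p.1) * (c * p.2) * evalP (pderiv 0 (pderiv 1 F)) p
      + (c * p.2) ^ 2 * evalP (pderiv 1 (pderiv 1 F)) p = 0 := by
    rw [hm, hm']
    linear_combination m ^ 2 * h0
  linear_combination key - d * p.1 * e0 - c * p.2 * e1 + (c - c * d) * h1

theorem Nondegenerate.separable_residual_leadingForm {c d : ℕ} {f : MvPolynomial (Fin 2) ℂ}
    (h : Nondegenerate c d f) (hc : 0 < c) (hd : 0 < d) (hcd : c ≠ d) {p : ℂ × ℂ} (hp0 : p ≠ 0)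
    (hp : evalP (deform c d 0 f) p = 0) {t : ℂ} (ht : (residualPoly (deform c d 0 f) p).eval t = 0) :
    t ≠ 0 ∧ (Polynomial.derivative (residualPoly (deform c d 0 f) p)).eval t ≠ 0 := by
  have ht0 : t ≠ 0 := by
    rintro rfl
    have := eval_residual_zero (deform c d 0 f) p
    rw [ht, mul_zero] at this
    exact h.hess_leadingForm_ne_zero hc hd hcd hp0 hp this.symm
  refine ⟨ht0, fun h1 => ?_⟩
  obtain ⟨-, hFx, hFy⟩ := h.leadingForm_ne_zero hc hd hp0 hp
  have h2 := (contact_iff_residual hp ht0 2).2 (X_sub_C_sq_dvd_iff.2 ⟨ht, h1⟩)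
  have hEp := h.wt.evalP_euler hp
  set F := deform c d 0 f with hF
  set q : ℂ × ℂ := (p.1 + t * (tdir F p).1, p.2 + t * (tdir F p).2) with hq
  obtain ⟨hq0, hq1⟩ := contact_two_iff.1 h2
  have hEq := h.wt.evalP_euler hq0
  have hpar : (d : ℂ) * q.1 * (tdir F p).2 = c * q.2 * (tdir F p).1 := by
    by_cases hqz : q = 0
    · rw [hqz]
      simp
    · obtain ⟨-, -, hq2⟩ := h.leadingForm_ne_zero hc hd hqz hq0
      refine mul_right_cancel₀ hq2 ?_
      linear_combination (d : ℂ) * q.1 * hq1 - (tdir F p).1 * hEq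
  have hcd' : (c : ℂ) - d ≠ 0 := sub_ne_zero.2 (Nat.cast_injective.ne hcd)
  refine mul_ne_zero (mul_ne_zero hcd' ht0) (mul_ne_zero hFx hFy) ?_
  simp only [hq, tdir] at hpar
  linear_combination hpar + hEp

end LeadingForm

section Inflections

open Filter Topology Asymptotics

theorem IsBranch.exists_slope {f : MvPolynomial (Fin 2) ℂ} {p₀ : ℂ × ℂ} {u : Ultrafilter ℂ}
    {p : ℂ → ℂ × ℂ} (h : IsBranch f p₀ u p) (hx : evalP (pderiv 0 f) p₀ ≠ 0)
    (g : MvPolynomial (Fin 2) ℂ) :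
    ∃ κ : ℂ → ℂ, Tendsto κ u (𝓝 (-((tdir f p₀).1 * evalP (pderiv 0 g) p₀
        + (tdir f p₀).2 * evalP (pderiv 1 g) p₀) / evalP (pderiv 0 f) p₀)) ∧
      ∀ᶠ a in (u : Filter ℂ), evalP g (p a) = evalP g p₀ + κ a * ((p a).2 - p₀.2) := by
  obtain ⟨A, B, hAB, hA, hB⟩ := exists_increment f p₀
  obtain ⟨A', B', hAB', hA', hB'⟩ := exists_increment g p₀
  have hA0 : Tendsto (fun a => evalP A (p a)) u (𝓝 (evalP (pderiv 0 f) p₀)) :=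
    hA ▸ h.tendsto_evalP A
  have hB0 : Tendsto (fun a => evalP B (p a)) u (𝓝 (evalP (pderiv 1 f) p₀)) :=
    hB ▸ h.tendsto_evalP B
  have hA1 : Tendsto (fun a => evalP A' (p a)) u (𝓝 (evalP (pderiv 0 g) p₀)) :=
    hA' ▸ h.tendsto_evalP A'
  have hB1 : Tendsto (fun a => evalP B' (p a)) u (𝓝 (evalP (pderiv 1 g) p₀)) :=
    hB' ▸ h.tendsto_evalP B'
  refine ⟨fun a => evalP B' (p a) - evalP B (p a) / evalP A (p a) * evalP A' (p a), ?_, ?_⟩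
  · have h1 := hB1.sub ((hB0.div hA0 hx).mul hA1)
    have h2 : -((tdir f p₀).1 * evalP (pderiv 0 g) p₀ + (tdir f p₀).2 * evalP (pderiv 1 g) p₀)
        / evalP (pderiv 0 f) p₀ = evalP (pderiv 1 g) p₀
          - evalP (pderiv 1 f) p₀ / evalP (pderiv 0 f) p₀ * evalP (pderiv 0 g) p₀ := by
      simp only [tdir]
      field_simp
      ring
    rw [h2]
    exact h1
  · filter_upwards [h.zero, hA0.eventually_ne hx] with a h0 hne
    have h1 := hAB (p a)
    rw [h0, h.eval_eq_zero] at h1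
    have h2 := hAB' (p a)
    field_simp
    linear_combination evalP A (p a) * h2 - evalP A' (p a) * h1

theorem IsBranch.snd_ne {f : MvPolynomial (Fin 2) ℂ} {p₀ : ℂ × ℂ} {u : Ultrafilter ℂ}
    {p : ℂ → ℂ × ℂ} (h : IsBranch f p₀ u p) (hx : evalP (pderiv 0 f) p₀ ≠ 0) :
    ∀ᶠ a in (u : Filter ℂ), (p a).2 - p₀.2 ≠ 0 := by
  obtain ⟨κ, -, hκ⟩ := h.exists_slope hx (X 0)
  filter_upwards [hκ, h.ne] with a h1 h2 h3
  rw [h3, mul_zero, add_zero, evalP_X_zero, evalP_X_zero] at h1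
  exact h2 h1

theorem Nondegenerate.tdir_ne_zero {c d : ℕ} {f : MvPolynomial (Fin 2) ℂ}
    (h : Nondegenerate c d f) {p : ℂ × ℂ} (h0 : evalP f p = 0) : tdir f p ≠ 0 := fun h2 =>
  h.smooth p h0 ⟨by simpa [tdir] using congrArg Prod.snd h2, congrArg Prod.fst h2⟩

theorem inflPts_eq {c d : ℕ} {f : MvPolynomial (Fin 2) ℂ} (h : Nondegenerate c d f) :
    inflPts f = {p | evalP f p = 0 ∧ evalP (hess f) p = 0} := by
  ext p
  constructor
  · rintro ⟨-, h0, w, hw, h3⟩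
    refine ⟨h0, ?_⟩
    have h3' : Contact f p w 3 := le_interMult_iff.1 (by exact_mod_cast h3)
    obtain ⟨μ, hμ⟩ := eq_smul_tdir (h.smooth p h0)
      (contact_two_iff.1 (h3'.mono (by norm_num))).2
    have hμ0 : μ ≠ 0 := by
      rintro rfl
      exact hw (by rw [hμ]; simp)
    rw [← contact_tdir_three_iff h0]
    have := h3'.smul μ⁻¹
    rw [hμ] at this
    simpa [← mul_assoc, inv_mul_cancel₀ hμ0] using this
  · rintro ⟨h0, h1⟩
    have hne := h.tdir_ne_zero h0
    have h3 := (contact_tdir_three_iff h0).2 h1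
    exact ⟨(h.three p _ hne h3).2, h0, _, hne, by exact_mod_cast le_interMult_iff.2 h3⟩

theorem WtLe.tdir_scale {c d : ℕ} {f : MvPolynomial (Fin 2) ℂ} (h : WtLe c d f)
    (hcd : c + d ≤ c * d) {ε : ℂ} (hε : ε ≠ 0) (p : ℂ × ℂ) :
    tdir f (ε⁻¹ ^ d * p.1, ε⁻¹ ^ c * p.2)
      = (ε⁻¹ ^ d * (ε⁻¹ ^ (c * d - (c + d)) * (tdir (_root_.deform c d ε f) p).1),
         ε⁻¹ ^ c * (ε⁻¹ ^ (c * d - (c + d)) * (tdir (_root_.deform c d ε f) p).2)) := by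
  have h0 := h.evalP_pderiv_scale ε ε⁻¹ p (1, 0)
  have h1 := h.evalP_pderiv_scale ε ε⁻¹ p (0, 1)
  obtain ⟨k, hk⟩ := Nat.exists_eq_add_of_le hcd
  have he : ε⁻¹ ≠ 0 := inv_ne_zero hε
  simp only [inv_mul_cancel₀ hε, deform_one, mul_one, mul_zero, zero_mul, add_zero, zero_add,
    one_mul] at h0 h1
  rw [hk] at h0 h1
  rw [hk, Nat.add_sub_cancel_left]
  simp only [tdir]
  refine Prod.ext (mul_left_cancel₀ (pow_ne_zero c he) ?_)
    (mul_left_cancel₀ (pow_ne_zero d he) ?_)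
  · simp only
    rw [h1]
    ring
  · simp only
    rw [mul_neg, h0]
    ring

theorem WtLe.coeff_lineRestrict_tdir_scale {c d : ℕ} {f : MvPolynomial (Fin 2) ℂ} (h : WtLe c d f)
    (hcd : c + d ≤ c * d) {ε : ℂ} (hε : ε ≠ 0) (p : ℂ × ℂ) (n : ℕ) :
    (lineRestrict f (ε⁻¹ ^ d * p.1, ε⁻¹ ^ c * p.2)
        (tdir f (ε⁻¹ ^ d * p.1, ε⁻¹ ^ c * p.2))).coeff n
      = ε⁻¹ ^ (c * d) * (ε⁻¹ ^ (c * d - (c + d))) ^ n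
        * (lineRestrict (_root_.deform c d ε f) p (tdir (_root_.deform c d ε f) p)).coeff n := by
  have h1 := h.lineRestrict_scale ε ε⁻¹ p (ε⁻¹ ^ (c * d - (c + d)) * (tdir (_root_.deform c d ε f) p).1,
    ε⁻¹ ^ (c * d - (c + d)) * (tdir (_root_.deform c d ε f) p).2)
  rw [inv_mul_cancel₀ hε, deform_one] at h1
  rw [h.tdir_scale hcd hε, h1, Polynomial.coeff_C_mul]
  have h2 := lineRestrict_comp (_root_.deform c d ε f) p (tdir (_root_.deform c d ε f) p) 0
    (ε⁻¹ ^ (c * d - (c + d)))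
  simp only [zero_mul, add_zero, map_zero, zero_add] at h2
  rw [← h2, Polynomial.comp_C_mul_X_coeff]
  ring

theorem IsInfBranch.tendsto_tdir {c d : ℕ} {f : MvPolynomial (Fin 2) ℂ} {y₀ : ℂ}
    {u : Ultrafilter ℂ} {y : ℂ → ℂ} (h : IsInfBranch c d f y₀ u y) :
    Tendsto (fun ε => tdir (deform c d ε f) (1, y ε)) u (𝓝 (tdir (deform c d 0 f) (1, y₀))) := by
  have hp : Tendsto (fun ε => ((1, y ε) : ℂ × ℂ)) u (𝓝 (1, y₀)) :=
    tendsto_const_nhds.prodMk_nhds h.tendsto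
  have hε : Tendsto (fun ε : ℂ => ε) u (𝓝 0) := h.le.trans nhdsWithin_le_nhds
  have h1 := coeffTendsto_lineRestrict_deform c d f hε hp
    (tendsto_const_nhds (x := ((1, 0) : ℂ × ℂ))) 1
  have h2 := coeffTendsto_lineRestrict_deform c d f hε hp
    (tendsto_const_nhds (x := ((0, 1) : ℂ × ℂ))) 1
  simp only [coeff_one_lineRestrict, one_mul, zero_mul, add_zero, zero_add] at h1 h2
  exact h2.prodMk_nhds h1.neg

theorem IsInfBranch.coeffTendsto {c d : ℕ} {f : MvPolynomial (Fin 2) ℂ} {y₀ : ℂ}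
    {u : Ultrafilter ℂ} {y : ℂ → ℂ} (h : IsInfBranch c d f y₀ u y) :
    CoeffTendsto (fun ε => lineRestrict (deform c d ε f) (1, y ε) (tdir (deform c d ε f) (1, y ε)))
      u (lineRestrict (deform c d 0 f) (1, y₀) (tdir (deform c d 0 f) (1, y₀))) :=
  coeffTendsto_lineRestrict_deform c d f (h.le.trans nhdsWithin_le_nhds)
    (tendsto_const_nhds.prodMk_nhds h.tendsto) h.tendsto_tdir

theorem IsInfBranch.isTheta_hess {c d : ℕ} {f : MvPolynomial (Fin 2) ℂ} {y₀ : ℂ}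
    {u : Ultrafilter ℂ} {y : ℂ → ℂ} (h : IsInfBranch c d f y₀ u y) (hf : Nondegenerate c d f)
    (hc : 5 ≤ c) (hd : 5 ≤ d) (hcd : c ≠ d) {w : ℕ} (hw : w + 2 * c + 2 * d = 3 * (c * d)) :
    (fun ε => evalP (hess f) (ε⁻¹ ^ d, ε⁻¹ ^ c * y ε)) =Θ[u] fun ε => ε⁻¹ ^ w := by
  have hcd2 : c + d ≤ c * d := by nlinarith
  have h1 := (h.coeffTendsto 2).const_mul 2
  simp only [← evalP_hess] at h1
  have h2 := (isTheta_refl (fun ε : ℂ => ε⁻¹ ^ w) u).mul (isTheta_one_of_tendsto h1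
    (hf.hess_leadingForm_ne_zero (by omega) (by omega) hcd (by simp) h.zero_lim))
  simp only [mul_one] at h2
  refine (EventuallyEq.isTheta ?_).trans h2
  filter_upwards [h.le self_mem_nhdsWithin] with ε hε
  have h3 := hf.wt.coeff_lineRestrict_tdir_scale hcd2 hε (1, y ε) 2
  simp only [mul_one] at h3
  rw [evalP_hess, evalP_hess, h3, ← pow_mul, ← pow_add]
  have : c * d + (c * d - (c + d)) * 2 = w := by omega
  rw [this]
  ring

/-- The number of inflection points. -/
theorem Nondegenerate.ncard_inflPts {c d : ℕ} {f : MvPolynomial (Fin 2) ℂ}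
    (h : Nondegenerate c d f) (hc : 5 ≤ c) (hd : 5 ≤ d) (hcd : c ≠ d) :
    (inflPts f).Finite ∧ (inflPts f).ncard + 2 * c + 2 * d = 3 * (c * d) := by
  have hcd2 : 2 * c + 2 * d ≤ 3 * (c * d) := by nlinarith
  obtain ⟨N, hN⟩ := h.wt.exists_isNorm (by omega) (by omega) h.coeff_y (hess f)
  obtain ⟨hN0, hNw⟩ := natDegree_isNorm h.wt (by omega) (by omega) h.coeff_y hN
    (w := 3 * (c * d) - (2 * c + 2 * d)) fun y₀ u y hy =>
    hy.isTheta_hess h hc hd hcd (by omega)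
  have h1 : IsNorm f 1 1 := fun x => by simp
  have hthree : ∀ p, evalP f p = 0 → evalP (hess f) p = 0 →
      (tdir f p).1 ≠ 0 ∧ (tdir f p).2 ≠ 0 := fun p h0 hH =>
    (h.three p _ (h.tdir_ne_zero h0) ((contact_tdir_three_iff h0).2 hH)).1
  have hmain := ncard_eq_of_isNorm h.wt (by omega) (by omega) h.coeff_y hN h1 hN0 one_ne_zero
    (inflPts f) (fun p hp => ?_) (fun p₀ hp₀ u p hp => ?_) (fun p₀ hp₀ u p hp => ?_)
  · refine ⟨hmain.1, ?_⟩
    have := hmain.2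
    rw [hNw, Polynomial.natDegree_one] at this
    omega
  · rw [inflPts_eq h] at hp
    exact ⟨hp.1, fun h2 => (hthree p hp.1 hp.2).2 (by simp [tdir, h2])⟩
  · rw [inflPts_eq h] at hp₀
    simp only [evalP_one]
    exact isTheta_one_of_tendsto (hp.tendsto_evalP _) fun h2 => hp₀ ⟨hp.eval_eq_zero, h2⟩
  · rw [inflPts_eq h] at hp₀
    have hne := hthree p₀ hp₀.1 hp₀.2
    have hx : evalP (pderiv 0 f) p₀ ≠ 0 := fun h2 => hne.2 (by simp [tdir, h2])
    obtain ⟨κ, hκ, hκ'⟩ := hp.exists_slope hx (hess f)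
    rw [tdir_deriv_hess] at hκ
    have h3 : (lineRestrict f p₀ (tdir f p₀)).coeff 3 ≠ 0 := by
      intro h4
      refine h.four p₀ _ (h.tdir_ne_zero hp₀.1) ?_
      have h5 := (contact_tdir_three_iff hp₀.1).2 hp₀.2
      rw [Contact, Polynomial.X_pow_dvd_iff] at h5 ⊢
      intro k hk
      rcases Nat.lt_succ_iff_lt_or_eq.1 hk with h6 | rfl
      · exact h5 k h6
      · exact h4
    have h4 := (isTheta_one_of_tendsto hκ (div_ne_zero (neg_ne_zero.2
      (mul_ne_zero (by norm_num) h3)) hx)).mul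
      (isTheta_refl (fun a => (p a).2 - p₀.2) u)
    simp only [evalP_one]
    refine (EventuallyEq.isTheta ?_).trans h4
    filter_upwards [hκ'] with a ha
    rw [ha, hp₀.2, zero_add]

end Inflections

section TangentResultant

open Filter Topology Asymptotics

/-- The family of all the residual polynomials `residualPoly f p`. -/
def genericResidual (f : MvPolynomial (Fin 2) ℂ) : Polynomial (MvPolynomial (Fin 2) ℂ) :=
  (aeval (fun i : Fin 2 => if i = 0
    then Polynomial.C (X 0) + Polynomial.C (pderiv 1 f) * Polynomial.X
    else Polynomial.C (X 1) + Polynomial.C (-pderiv 0 f) * Polynomial.X) f).divX.divX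

/-- Evaluation at a point, as a ring homomorphism. -/
def evalPHom (p : ℂ × ℂ) : MvPolynomial (Fin 2) ℂ →+* ℂ :=
  MvPolynomial.eval (fun i => if i = 0 then p.1 else p.2)

theorem evalPHom_apply (p : ℂ × ℂ) (f : MvPolynomial (Fin 2) ℂ) : evalPHom p f = evalP f p := rfl

theorem map_genericResidual (f : MvPolynomial (Fin 2) ℂ) (p : ℂ × ℂ) :
    (genericResidual f).map (evalPHom p) = residualPoly f p := by
  have h : ∀ g : MvPolynomial (Fin 2) ℂ, (aeval (fun i : Fin 2 => if i = 0
      then Polynomial.C (X 0) + Polynomial.C (pderiv 1 f) * Polynomial.X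
      else Polynomial.C (X 1) + Polynomial.C (-pderiv 0 f) * Polynomial.X) g).map (evalPHom p)
      = lineRestrict g p (tdir f p) := fun g => by
    induction g using MvPolynomial.induction_on with
    | C a => simp [lineRestrict, evalPHom]
    | add g g' hg hg' =>
      simp only [map_add, Polynomial.map_add, hg, hg']
      simp [lineRestrict]
    | mul_X g i hg =>
      simp only [map_mul, Polynomial.map_mul, hg]
      fin_cases i <;> simp [lineRestrict, evalPHom_apply, tdir]
  ext n
  rw [Polynomial.coeff_map, coeff_residual, ← h f, Polynomial.coeff_map, genericResidual,
    Polynomial.coeff_divX, Polynomial.coeff_divX]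

/-- The discriminant (up to a leading coefficient) of the residual polynomials. -/
def tangentResultant (c : ℕ) (f : MvPolynomial (Fin 2) ℂ) : MvPolynomial (Fin 2) ℂ :=
  Polynomial.resultant (genericResidual f) (Polynomial.derivative (genericResidual f)) (c - 2)
    (c - 3)

theorem WtLe.natDegree_residual {c d : ℕ} {f : MvPolynomial (Fin 2) ℂ} (h : WtLe c d f)
    (hx : coeff (exponent c 0) f ≠ 0) (hd : 2 ≤ d) (hdc : d < c) {p : ℂ × ℂ}
    (hp : evalP (pderiv 1 f) p ≠ 0) : (residualPoly f p).natDegree = c - 2 := by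
  refine le_antisymm (h.natDegree_residual_le (by omega) hdc p)
    (Polynomial.le_natDegree_of_ne_zero ?_)
  rw [h.coeff_residual hd hdc]
  exact mul_ne_zero hx (pow_ne_zero _ hp)

theorem WtLe.residual_ne_zero {c d : ℕ} {f : MvPolynomial (Fin 2) ℂ} (h : WtLe c d f)
    (hx : coeff (exponent c 0) f ≠ 0) (hd : 2 ≤ d) (hdc : d < c) {p : ℂ × ℂ}
    (hp : evalP (pderiv 1 f) p ≠ 0) : residualPoly f p ≠ 0 := fun h0 => by
  have := h.coeff_residual hd hdc p
  rw [h0, Polynomial.coeff_zero] at this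
  exact mul_ne_zero hx (pow_ne_zero _ hp) this.symm

theorem WtLe.leadingCoeff_residual {c d : ℕ} {f : MvPolynomial (Fin 2) ℂ} (h : WtLe c d f)
    (hx : coeff (exponent c 0) f ≠ 0) (hd : 2 ≤ d) (hdc : d < c) {p : ℂ × ℂ}
    (hp : evalP (pderiv 1 f) p ≠ 0) :
    (residualPoly f p).leadingCoeff = coeff (exponent c 0) f * evalP (pderiv 1 f) p ^ c := by
  rw [Polynomial.leadingCoeff, h.natDegree_residual hx hd hdc hp, h.coeff_residual hd hdc]

theorem WtLe.evalP_tangentResultant {c d : ℕ} {f : MvPolynomial (Fin 2) ℂ} (h : WtLe c d f)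
    (hx : coeff (exponent c 0) f ≠ 0) (hd : 2 ≤ d) (hdc : d < c) {p : ℂ × ℂ}
    (hp : evalP (pderiv 1 f) p ≠ 0) :
    evalP (tangentResultant c f) p = (coeff (exponent c 0) f * evalP (pderiv 1 f) p ^ c) ^ (c - 3)
      * ((residualPoly f p).roots.map
        fun t => (Polynomial.derivative (residualPoly f p)).eval t).prod := by
  have h1 := Polynomial.resultant_map_map (genericResidual f)
    (Polynomial.derivative (genericResidual f)) (c - 2) (c - 3) (evalPHom p)
  rw [← Polynomial.derivative_map, map_genericResidual] at h1
  have h2 := Polynomial.resultant_eq_prod_eval (residualPoly f p)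
    (Polynomial.derivative (residualPoly f p)) (c - 3)
    ((Polynomial.natDegree_derivative_le _).trans
      (by rw [h.natDegree_residual hx hd hdc hp]; omega)) (IsAlgClosed.splits _)
  rw [h.natDegree_residual hx hd hdc hp, h1, h.leadingCoeff_residual hx hd hdc hp] at h2
  exact h2

theorem prod_roots_sub_eq {p : Polynomial ℂ} (t : ℂ) :
    p.leadingCoeff * (p.roots.map fun z => t - z).prod = p.eval t := by
  conv_rhs => rw [(IsAlgClosed.splits p).eq_prod_roots]
  rw [Polynomial.eval_mul, Polynomial.eval_C, Polynomial.eval_multiset_prod, Multiset.map_map]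
  simp

end TangentResultant

section Bitangency

open Filter Topology Asymptotics

theorem CoeffTendsto.taylor {α : Type*} {P : α → Polynomial ℂ} {Q : Polynomial ℂ} {l : Filter α}
    [l.NeBot] {N : ℕ} (hN : ∀ a, (P a).natDegree ≤ N) (h : CoeffTendsto P l Q) (t : ℂ) :
    CoeffTendsto (fun a => Polynomial.taylor t (P a)) l (Polynomial.taylor t Q) := fun i => by
  simp only [Polynomial.taylor_coeff]
  refine CoeffTendsto.eval (N := N) (fun a => ?_) (fun j => ?_) tendsto_const_nhds
  · exact (Polynomial.natDegree_hasseDeriv_le _ _).trans ((Nat.sub_le _ _).trans (hN a))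
  · simp only [Polynomial.hasseDeriv_coeff]
    exact (h _).const_mul _

theorem evalP_eval_derivative_genericResidual (f : MvPolynomial (Fin 2) ℂ) (t : ℂ) (p : ℂ × ℂ) :
    evalP ((Polynomial.derivative (genericResidual f)).eval (C t)) p
      = (Polynomial.derivative (residualPoly f p)).eval t := by
  have h1 : evalPHom p (C t) = t := by rw [evalPHom_apply, evalP_C]
  rw [← map_genericResidual, Polynomial.derivative_map, Polynomial.eval_map, ← evalPHom_apply,
    ← Polynomial.eval₂_at_apply, h1]

theorem IsBranch.tendsto_tdir {f : MvPolynomial (Fin 2) ℂ} {p₀ : ℂ × ℂ} {u : Ultrafilter ℂ}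
    {p : ℂ → ℂ × ℂ} (h : IsBranch f p₀ u p) :
    Tendsto (fun a => tdir f (p a)) u (𝓝 (tdir f p₀)) :=
  (h.tendsto_evalP _).prodMk_nhds (h.tendsto_evalP _).neg

theorem IsBranch.coeffTendsto {f : MvPolynomial (Fin 2) ℂ} {p₀ : ℂ × ℂ} {u : Ultrafilter ℂ}
    {p : ℂ → ℂ × ℂ} (h : IsBranch f p₀ u p) :
    CoeffTendsto (fun a => residualPoly f (p a)) u (residualPoly f p₀) :=
  (coeffTendsto_lineRestrict f h.tendsto h.tendsto_tdir).divX.divX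

theorem IsBranch.exists_residual_slope {f : MvPolynomial (Fin 2) ℂ} {p₀ : ℂ × ℂ}
    {u : Ultrafilter ℂ} {p : ℂ → ℂ × ℂ} (h : IsBranch f p₀ u p)
    (hx : evalP (pderiv 0 f) p₀ ≠ 0) (hy : evalP (pderiv 1 f) p₀ ≠ 0)
    (hH : evalP (hess f) p₀ ≠ 0) {t : ℂ} (ht : t ≠ 0)
    (hs : ¬ (evalP (pderiv 0 f) (p₀.1 + t * (tdir f p₀).1, p₀.2 + t * (tdir f p₀).2) = 0 ∧
      evalP (pderiv 1 f) (p₀.1 + t * (tdir f p₀).1, p₀.2 + t * (tdir f p₀).2) = 0))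
    (h2 : Contact f (p₀.1 + t * (tdir f p₀).1, p₀.2 + t * (tdir f p₀).2) (tdir f p₀) 2) :
    ∃ (κ : ℂ → ℂ) (κ₀ : ℂ), κ₀ ≠ 0 ∧ Tendsto κ u (𝓝 κ₀) ∧
      ∀ᶠ a in (u : Filter ℂ), (residualPoly f (p a)).eval t = κ a * ((p a).2 - p₀.2) := by
  set q : ℂ × ℂ := (p₀.1 + t * (tdir f p₀).1, p₀.2 + t * (tdir f p₀).2) with hq
  obtain ⟨hq0, hq1⟩ := contact_two_iff.1 h2
  obtain ⟨κ₁, hκ₁, hκ₁'⟩ := h.exists_slope hx (X 0 + C t * pderiv 1 f)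
  obtain ⟨κ₂, hκ₂, hκ₂'⟩ := h.exists_slope hx (X 1 + C t * -pderiv 0 f)
  obtain ⟨A, B, hAB, hA, hB⟩ := exists_increment f q
  have hqa : Tendsto (fun a => ((p a).1 + t * (tdir f (p a)).1, (p a).2 + t * (tdir f (p a)).2)) u
      (𝓝 q) := by
    have h3 := h.tendsto
    have h4 := h.tendsto_tdir
    exact (((continuous_fst.tendsto _).comp h3).add
      (((continuous_fst.tendsto _).comp h4).const_mul t)).prodMk_nhds
      (((continuous_snd.tendsto _).comp h3).add
      (((continuous_snd.tendsto _).comp h4).const_mul t))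
  have hA1 := ((continuous_evalP A).tendsto q).comp hqa
  have hB1 := ((continuous_evalP B).tendsto q).comp hqa
  refine ⟨_, _, ?_, ((hκ₁.mul hA1).add (hκ₂.mul hB1)).div_const (t ^ 2), ?_⟩
  · rw [hA, hB]
    refine div_ne_zero (fun h0 => ?_) (pow_ne_zero 2 ht)
    have hqy : evalP (pderiv 1 f) q ≠ 0 := by
      intro h5
      rw [h5, mul_zero, add_zero] at hq1
      exact hs ⟨(mul_eq_zero.1 hq1).resolve_left hy, h5⟩
    refine mul_ne_zero (mul_ne_zero hqy ht) hH ?_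
    simp only [map_add, map_neg, Derivation.leibniz, pderiv_C, pderiv_X, pderiv_one_zero, evalP_add,
      evalP_mul, evalP_C, smul_eq_mul, mul_zero, add_zero, Pi.single_eq_same, evalP_neg, evalP_one,
      evalP_zero, ne_eq, one_ne_zero, zero_ne_one, not_false_eq_true, Pi.single_eq_of_ne] at h0
    field_simp at h0
    simp only [hess, evalP_add, evalP_sub, evalP_mul, evalP_pow, evalP_C]
    simp only [tdir] at h0 hq1 ⊢
    linear_combination evalP (pderiv 1 f) p₀ * h0 + (evalP (pderiv 1 f) p₀ +
      t * (evalP (pderiv 1 f) p₀ * evalP (pderiv 0 (pderiv 1 f)) p₀ -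
        evalP (pderiv 0 f) p₀ * evalP (pderiv 1 (pderiv 1 f)) p₀)) * hq1
  · filter_upwards [hκ₁', hκ₂', h.zero] with a h3 h4 h5
    have h6 := congrArg (Polynomial.eval t) (lineRestrict_tdir h5)
    have h7 := hAB ((p a).1 + t * (tdir f (p a)).1, (p a).2 + t * (tdir f (p a)).2)
    rw [hq0] at h7
    rw [eval_lineRestrict, Polynomial.eval_mul, Polynomial.eval_pow, Polynomial.eval_X] at h6
    simp only [evalP_add, evalP_mul, evalP_C, evalP_X_zero, evalP_X_one, evalP_neg] at h3 h4
    simp only [Function.comp_apply]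
    field_simp
    simp only [hq] at h7
    generalize evalP A _ = A₁ at h7 ⊢
    generalize evalP B _ = B₁ at h7 ⊢
    simp only [tdir] at h3 h4 h6 h7 ⊢
    linear_combination h7 - h6 + A₁ * h3 + B₁ * h4

end Bitangency

section DoubleRoots

open Filter Topology Asymptotics

theorem CoeffTendsto.isTheta_derivative_double_root {α : Type*} {R : α → Polynomial ℂ}
    {R₀ : Polynomial ℂ} {u : Filter α} [u.NeBot] {N : ℕ} (hN : ∀ a, (R a).natDegree ≤ N)
    (h : CoeffTendsto R u R₀) {t : ℂ} (h2 : (Polynomial.taylor t R₀).coeff 2 ≠ 0)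
    {κ κ' δ z : α → ℂ} {κ₀ κ₁ : ℂ} (hκ₀ : κ₀ ≠ 0) (hκ : Tendsto κ u (𝓝 κ₀))
    (hκ' : Tendsto κ' u (𝓝 κ₁)) (h0 : ∀ᶠ a in u, (R a).eval t = κ a * δ a)
    (h1 : ∀ᶠ a in u, (Polynomial.derivative (R a)).eval t = κ' a * δ a)
    (hz : Tendsto z u (𝓝 t)) (hz0 : ∀ᶠ a in u, (R a).eval (z a) = 0) :
    (fun a => (Polynomial.derivative (R a)).eval (z a)) =Θ[u] fun a => t - z a := by
  have hT := h.taylor hN t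
  have hTN : ∀ a, (Polynomial.taylor t (R a)).natDegree ≤ N := fun a => by
    rw [Polynomial.natDegree_taylor]; exact hN a
  set S : α → Polynomial ℂ := fun a => Polynomial.taylor t (R a) with hS
  set E : α → Polynomial ℂ := fun a => (S a).divX.divX with hE
  have hEN : ∀ a, (E a).natDegree ≤ N := fun a =>
    (Polynomial.natDegree_divX_le.trans Polynomial.natDegree_divX_le).trans (hTN a)
  have hET : CoeffTendsto E u (Polynomial.taylor t R₀).divX.divX := hT.divX.divX
  have hs : Tendsto (fun a => z a - t) u (𝓝 0) := by simpa using hz.sub_const t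
  have hE0 := hET.eval hEN hs
  have hE1 := hET.derivative.eval (fun a => (Polynomial.natDegree_derivative_le _).trans
    ((Nat.sub_le _ _).trans (hEN a))) hs
  rw [← Polynomial.coeff_zero_eq_eval_zero, Polynomial.coeff_divX, Polynomial.coeff_divX] at hE0
  have hden : Tendsto (fun a => κ a + κ' a * (z a - t)) u (𝓝 κ₀) := by
    simpa using hκ.add (hκ'.mul hs)
  have hlim := ((hE0.const_mul 2).add (hs.mul hE1)).sub
    (((hκ'.mul hE0).div hden hκ₀).mul hs)
  have h3 := (isTheta_one_of_tendsto hlim.neg (by simpa using h2)).mul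
    (isTheta_refl (fun a => t - z a) u)
  simp only [one_mul] at h3
  refine (EventuallyEq.isTheta (g := fun a => -(2 * (E a).eval (z a - t) +
    (z a - t) * (Polynomial.derivative (E a)).eval (z a - t) -
    κ' a * (E a).eval (z a - t) / (κ a + κ' a * (z a - t)) * (z a - t)) * (t - z a)) ?_).trans
    h3
  filter_upwards [h0, h1, hz0, hden.eventually_ne hκ₀] with a h0 h1 hz0 hd
  have hSE : S a = Polynomial.C ((R a).eval t) + Polynomial.X *
      (Polynomial.C ((Polynomial.derivative (R a)).eval t) + Polynomial.X * E a) := by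
    have h4 := Polynomial.X_mul_divX_add (S a)
    have h5 := Polynomial.X_mul_divX_add (S a).divX
    rw [Polynomial.coeff_divX, zero_add] at h5
    simp only [hS, Polynomial.taylor_coeff_zero, Polynomial.taylor_coeff_one] at h4 h5
    simp only [hE, hS]
    rw [add_comm (Polynomial.C (Polynomial.eval t (Polynomial.derivative (R a)))), h5, add_comm, h4]
  have h6 : (R a).eval (z a) = (S a).eval (z a - t) := by
    simp [hS, Polynomial.taylor_eval]
  have h7 : (Polynomial.derivative (R a)).eval (z a)
      = (Polynomial.derivative (S a)).eval (z a - t) := by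
    simp [hS, Polynomial.taylor_apply, Polynomial.derivative_comp]
  rw [h7, hSE]
  rw [h6, hSE] at hz0
  simp only [Polynomial.derivative_add, Polynomial.derivative_mul, Polynomial.derivative_C,
    Polynomial.derivative_X, Polynomial.eval_add, Polynomial.eval_mul, Polynomial.eval_C,
    Polynomial.eval_X, Polynomial.eval_zero, Polynomial.eval_one] at hz0 ⊢
  rw [h0, h1] at hz0
  rw [h1]
  field_simp
  linear_combination κ' a * hz0

theorem MildContact.double_root {f : MvPolynomial (Fin 2) ℂ} (h : MildContact f) {p : ℂ × ℂ}
    (h0 : evalP f p = 0) (hv : tdir f p ≠ 0) {t : ℂ}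
    (ht : (Polynomial.X - Polynomial.C t) ^ 2 ∣ residualPoly f p) :
    t ≠ 0 ∧ Contact f (p.1 + t * (tdir f p).1, p.2 + t * (tdir f p).2) (tdir f p) 2 := by
  have ht0 : t ≠ 0 := by
    rintro rfl
    rw [Polynomial.C_0, sub_zero] at ht
    refine h.four p _ hv ?_
    rw [Contact, lineRestrict_tdir h0, show 4 = 2 + 2 from rfl, pow_add]
    exact mul_dvd_mul_left _ ht
  exact ⟨ht0, (contact_iff_residual h0 ht0 2).2 ht⟩

theorem MildContact.separable_residual {f : MvPolynomial (Fin 2) ℂ} (h : MildContact f)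
    {p : ℂ × ℂ} (h0 : evalP f p = 0) (hv : tdir f p ≠ 0)
    (hw : ¬ ((tdir f p).1 ≠ 0 ∧ (tdir f p).2 ≠ 0)) {t : ℂ} (ht : (residualPoly f p).eval t = 0) :
    (Polynomial.derivative (residualPoly f p)).eval t ≠ 0 := fun h1 => by
  obtain ⟨ht0, h2⟩ := h.double_root h0 hv (X_sub_C_sq_dvd_iff.2 ⟨ht, h1⟩)
  exact hw (h.two_two p _ t hv ht0 (contact_tdir h0) h2).1

theorem MildContact.other_root {f : MvPolynomial (Fin 2) ℂ} (h : MildContact f)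
    {p : ℂ × ℂ} (h0 : evalP f p = 0) (hv : tdir f p ≠ 0) {t : ℂ}
    (ht : (Polynomial.X - Polynomial.C t) ^ 2 ∣ residualPoly f p) {s : ℂ} (hst : s ≠ t)
    (hs : (residualPoly f p).eval s = 0) :
    (Polynomial.derivative (residualPoly f p)).eval s ≠ 0 := fun h1 => by
  obtain ⟨ht0, h2⟩ := h.double_root h0 hv ht
  obtain ⟨hs0, h3⟩ := h.double_root h0 hv (X_sub_C_sq_dvd_iff.2 ⟨hs, h1⟩)
  exact h.two_two_two p _ s t hv hs0 ht0 hst (contact_tdir h0) h3 h2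

theorem MildContact.taylor_coeff_two_ne_zero {f : MvPolynomial (Fin 2) ℂ} (h : MildContact f)
    {p : ℂ × ℂ} (h0 : evalP f p = 0) (hv : tdir f p ≠ 0) {t : ℂ}
    (ht : (Polynomial.X - Polynomial.C t) ^ 2 ∣ residualPoly f p) :
    (Polynomial.taylor t (residualPoly f p)).coeff 2 ≠ 0 := fun h1 => by
  obtain ⟨ht0, h2⟩ := h.double_root h0 hv ht
  obtain ⟨h3, h4⟩ := X_sub_C_sq_dvd_iff.1 ht
  have h5 : (Polynomial.X - Polynomial.C t) ^ 3 ∣ residualPoly f p := by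
    rw [Polynomial.X_sub_C_pow_dvd_iff, Polynomial.X_pow_dvd_iff]
    intro k hk
    rw [← Polynomial.taylor_apply]
    interval_cases k
    · rw [Polynomial.taylor_coeff_zero, h3]
    · rw [Polynomial.taylor_coeff_one, h4]
    · exact h1
  refine h.three_two _ _ (-t) hv (neg_ne_zero.2 ht0) ((contact_iff_residual h0 ht0 3).2 h5) ?_
  convert contact_tdir h0 using 1
  ext <;> ring

theorem Nondegenerate.isTheta_tangentResultant_double {c d : ℕ} {f : MvPolynomial (Fin 2) ℂ}
    (h : Nondegenerate c d f) (hd : 5 ≤ d) (hdc : d < c) {p₀ : ℂ × ℂ} {u : Ultrafilter ℂ}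
    {p : ℂ → ℂ × ℂ} (hp : IsBranch f p₀ u p) {t : ℂ}
    (ht : (Polynomial.X - Polynomial.C t) ^ 2 ∣ residualPoly f p₀) :
    (fun a => evalP (tangentResultant c f) (p a)) =Θ[u] fun a => (p a).2 - p₀.2 := by
  have h0 := hp.eval_eq_zero
  have hv := h.tdir_ne_zero h0
  obtain ⟨ht0, h2⟩ := h.double_root h0 hv ht
  have hne := (h.two_two p₀ _ t hv ht0 (contact_tdir h0) h2).1
  have hx : evalP (pderiv 0 f) p₀ ≠ 0 := fun h2 => hne.2 (by simp [tdir, h2])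
  have hy : evalP (pderiv 1 f) p₀ ≠ 0 := fun h2 => hne.1 (by simp [tdir, h2])
  have hH : evalP (hess f) p₀ ≠ 0 := fun hH =>
    h.three_two p₀ _ t hv ht0 ((contact_tdir_three_iff h0).2 hH) h2
  obtain ⟨κ, κ₀, hκ₀, hκ, h3⟩ :=
    hp.exists_residual_slope hx hy hH ht0 (h.smooth _ (contact_two_iff.1 h2).1) h2
  obtain ⟨κ', hκ', h4⟩ := hp.exists_slope hx
    ((Polynomial.derivative (genericResidual f)).eval (C t))
  simp only [evalP_eval_derivative_genericResidual, (X_sub_C_sq_dvd_iff.1 ht).2, zero_add] at h4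
  have hN : ∀ a, (residualPoly f (p a)).natDegree ≤ c - 2 := fun a =>
    h.wt.natDegree_residual_le (by omega) hdc _
  have hlc : Tendsto (fun a => coeff (exponent c 0) f * evalP (pderiv 1 f) (p a) ^ c) u
      (𝓝 (coeff (exponent c 0) f * evalP (pderiv 1 f) p₀ ^ c)) :=
    ((hp.tendsto_evalP _).pow c).const_mul _
  have hlc0 : coeff (exponent c 0) f * evalP (pderiv 1 f) p₀ ^ c ≠ 0 :=
    mul_ne_zero h.coeff_x (pow_ne_zero _ hy)
  have hye := (hp.tendsto_evalP (pderiv 1 f)).eventually_ne hy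
  have hprod := isTheta_prod_roots (l := (u : Filter ℂ)) (P := fun a => residualPoly f (p a))
    (N := c - 2) (g := fun a z => (Polynomial.derivative (residualPoly f (p a))).eval z)
    (h := fun a z => t - z)
    (hye.mono fun a ha => h.wt.natDegree_residual h.coeff_x (by omega) hdc ha)
    (hye.mono fun a ha => h.wt.residual_ne_zero h.coeff_x (by omega) hdc ha) ?_
  · have h5 := (isTheta_one_of_tendsto (hlc.pow (c - 3)) (pow_ne_zero _ hlc0)).mul hprod
    simp only [one_mul] at h5
    have h6 := (isTheta_one_of_tendsto (hκ.div hlc hlc0) (div_ne_zero hκ₀ hlc0)).mul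
      (isTheta_refl (fun a => (p a).2 - p₀.2) u)
    simp only [one_mul] at h6
    refine (EventuallyEq.isTheta ?_).trans (h5.trans ((EventuallyEq.isTheta ?_).trans h6))
    · filter_upwards [hye] with a ha
      exact h.wt.evalP_tangentResultant h.coeff_x (by omega) hdc ha
    · filter_upwards [hye, h3] with a ha h3
      have h7 := prod_roots_sub_eq (p := residualPoly f (p a)) t
      rw [h.wt.leadingCoeff_residual h.coeff_x (by omega) hdc ha, h3] at h7
      have h8 := mul_ne_zero h.coeff_x (pow_ne_zero c ha)
      simp only [Pi.div_apply]
      rw [div_mul_eq_mul_div, eq_div_iff h8, mul_comm, h7]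
  · intro z u' hu' hz
    obtain rfl := Ultrafilter.coe_le_coe.1 hu'
    obtain ⟨z₀, hz₀, hz₀'⟩ := hp.coeffTendsto.tendsto_root hN
      (by rw [h.wt.coeff_residual (by omega) hdc]; exact hlc0) hz
    by_cases hzt : z₀ = t
    · subst hzt
      exact hp.coeffTendsto.isTheta_derivative_double_root hN
        (h.taylor_coeff_two_ne_zero h0 hv ht) hκ₀ hκ hκ' h3 h4 hz₀ hz
    · exact isTheta_of_tendsto_ne_zero (hp.coeffTendsto.derivative.eval (fun a =>
        (Polynomial.natDegree_derivative_le _).trans ((Nat.sub_le _ _).trans (hN a))) hz₀)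
        (hz₀.const_sub t) (h.other_root h0 hv ht hzt hz₀') (sub_ne_zero.2 (Ne.symm hzt))

end DoubleRoots

section VerticalTangents

open Filter Topology Asymptotics

theorem evalP_tangent_point {f : MvPolynomial (Fin 2) ℂ} {p : ℂ × ℂ} (hp : evalP f p = 0) {t : ℂ}
    (ht : (residualPoly f p).eval t = 0) :
    evalP f (p.1 + t * (tdir f p).1, p.2 + t * (tdir f p).2) = 0 := by
  rw [← eval_lineRestrict, lineRestrict_tdir hp, Polynomial.eval_mul, ht, mul_zero]

theorem sq_mul_derivative_residual {f : MvPolynomial (Fin 2) ℂ} {p : ℂ × ℂ} (hp : evalP f p = 0)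
    {t : ℂ} (ht : (residualPoly f p).eval t = 0) :
    t ^ 2 * (Polynomial.derivative (residualPoly f p)).eval t
      = (tdir f p).1 * evalP (pderiv 0 f) (p.1 + t * (tdir f p).1, p.2 + t * (tdir f p).2)
        + (tdir f p).2 * evalP (pderiv 1 f) (p.1 + t * (tdir f p).1, p.2 + t * (tdir f p).2) := by
  have h := congrArg (fun P => (Polynomial.derivative P).eval t) (lineRestrict_tdir hp)
  simp only [derivative_lineRestrict, Polynomial.derivative_mul, Polynomial.eval_add,
    Polynomial.eval_mul, ht, Polynomial.eval_C, eval_lineRestrict, Polynomial.eval_pow,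
    Polynomial.eval_X, mul_zero, zero_add] at h
  exact h.symm

theorem WtLe.derivative_residual_eq {c d : ℕ} {f : MvPolynomial (Fin 2) ℂ} (h : WtLe c d f)
    (hd : 3 ≤ d) {e z : ℂ} (he : e ^ c * z = 1) {p : ℂ × ℂ} (hp : evalP f p = 0)
    (hz : (residualPoly f p).eval z = 0) {x y : ℂ} (hx : x = e ^ d * (p.1 + z * (tdir f p).1))
    (hy : y = e ^ c * (p.2 + z * (tdir f p).2)) (hc : 0 < c) :
    evalP (_root_.deform c d e f) (x, y) = 0 ∧
      (Polynomial.derivative (residualPoly f p)).eval z = z ^ (d - 3) *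
        ((x - e ^ d * p.1) * evalP (pderiv 0 (_root_.deform c d e f)) (x, y)
          + (y - e ^ c * p.2) * evalP (pderiv 1 (_root_.deform c d e f)) (x, y)) := by
  have hz0 : z ≠ 0 := right_ne_zero_of_mul_eq_one he
  have he0 : e ≠ 0 := by
    rintro rfl
    rw [zero_pow hc.ne', zero_mul] at he
    exact zero_ne_one he
  have hq : (e⁻¹ ^ d * x, e⁻¹ ^ c * y) = (p.1 + z * (tdir f p).1, p.2 + z * (tdir f p).2) := by
    rw [hx, hy, ← mul_assoc, ← mul_assoc, ← mul_pow, ← mul_pow, inv_mul_cancel₀ he0, one_pow,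
      one_pow, one_mul, one_mul]
  refine ⟨?_, ?_⟩
  · rw [h.evalP_scale he0, hq, evalP_tangent_point hp hz, mul_zero]
  · have h1 := sq_mul_derivative_residual hp hz
    have h2 := h.evalP_pderiv_scale e e⁻¹ (x, y) (x - e ^ d * p.1, y - e ^ c * p.2)
    simp only [inv_mul_cancel₀ he0, deform_one] at h2
    rw [hq] at h2
    have h3 : e⁻¹ ^ d * (x - e ^ d * p.1) = z * (tdir f p).1 := by
      rw [hx, inv_pow]; field_simp; ring
    have h4 : e⁻¹ ^ c * (y - e ^ c * p.2) = z * (tdir f p).2 := by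
      rw [hy, inv_pow]; field_simp; ring
    have h5 : e⁻¹ ^ (c * d) = z ^ d := by
      rw [pow_mul, inv_pow, eq_inv_of_mul_eq_one_right he]
    rw [h3, h4, h5] at h2
    obtain ⟨k, rfl⟩ := Nat.exists_eq_add_of_le hd
    rw [Nat.add_sub_cancel_left]
    refine mul_left_cancel₀ (pow_ne_zero 3 hz0) ?_
    rw [← mul_assoc, ← pow_add, ← h2]
    linear_combination z * h1

theorem Nondegenerate.isTheta_tangentResultant_vertical {c d : ℕ} {f : MvPolynomial (Fin 2) ℂ}
    (h : Nondegenerate c d f) (hd : 5 ≤ d) (hdc : d < c) {p₀ : ℂ × ℂ} {u : Ultrafilter ℂ}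
    {p : ℂ → ℂ × ℂ} (hp : IsBranch f p₀ u p) (hy : evalP (pderiv 1 f) p₀ = 0) :
    (fun a => evalP (tangentResultant c f) (p a)) =Θ[u]
      fun a => evalP (pderiv 1 f ^ (c * (c - d))) (p a) := by
  have h0 := hp.eval_eq_zero
  have hv := h.tdir_ne_zero h0
  have hx : evalP (pderiv 0 f) p₀ ≠ 0 := fun h2 => h.smooth _ h0 ⟨h2, hy⟩
  have hH : evalP (hess f) p₀ ≠ 0 := fun hH =>
    (h.three p₀ _ hv ((contact_tdir_three_iff h0).2 hH)).1.1 (by simp [tdir, hy])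
  have hyy : evalP (pderiv 1 (pderiv 1 f)) p₀ ≠ 0 := fun hyy => hH (by
    simp [hess, hy, hyy])
  have hye : ∀ᶠ a in (u : Filter ℂ), evalP (pderiv 1 f) (p a) ≠ 0 := by
    obtain ⟨κ, hκ, hκ'⟩ := hp.exists_slope hx (pderiv 1 f)
    have h1 : -((tdir f p₀).1 * evalP (pderiv 0 (pderiv 1 f)) p₀ +
        (tdir f p₀).2 * evalP (pderiv 1 (pderiv 1 f)) p₀) / evalP (pderiv 0 f) p₀ ≠ 0 := by
      simp [tdir, hy, hyy, hx]
    filter_upwards [hκ.eventually_ne h1, hκ', hp.snd_ne hx] with a h2 h3 h4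
    rw [h3, hy, zero_add]
    exact mul_ne_zero h2 h4
  have hN : ∀ a, (residualPoly f (p a)).natDegree ≤ c - 2 := fun a =>
    h.wt.natDegree_residual_le (by omega) hdc _
  have hr0 : (residualPoly f p₀).eval 0 ≠ 0 := fun h1 => hH (by
    rw [← eval_residual_zero, h1, mul_zero])
  have hprod := isTheta_prod_roots (l := (u : Filter ℂ)) (P := fun a => residualPoly f (p a))
    (N := c - 2) (g := fun a z => (Polynomial.derivative (residualPoly f (p a))).eval z)
    (h := fun a z => (0 - z) ^ (d - 3))
    (hye.mono fun a ha => h.wt.natDegree_residual h.coeff_x (by omega) hdc ha)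
    (hye.mono fun a ha => h.wt.residual_ne_zero h.coeff_x (by omega) hdc ha) ?_
  · have h5 := (isTheta_refl (fun a => (coeff (exponent c 0) f *
      evalP (pderiv 1 f) (p a) ^ c) ^ (c - 3)) (u : Filter ℂ)).mul hprod
    have h6 := ((isTheta_one_of_tendsto ((hp.coeffTendsto.eval hN (tendsto_const_nhds
      (x := (0 : ℂ)))).pow (d - 3)) (pow_ne_zero _ hr0)).const_mul_left
      (pow_ne_zero (c - d) h.coeff_x)).mul
      (isTheta_refl (fun a => evalP (pderiv 1 f ^ (c * (c - d))) (p a)) (u : Filter ℂ))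
    simp only [one_mul] at h6
    refine (EventuallyEq.isTheta ?_).trans (h5.trans ((EventuallyEq.isTheta ?_).trans h6))
    · filter_upwards [hye] with a ha
      exact h.wt.evalP_tangentResultant h.coeff_x (by omega) hdc ha
    · filter_upwards [hye] with a ha
      have h7 := prod_roots_sub_eq (p := residualPoly f (p a)) 0
      rw [h.wt.leadingCoeff_residual h.coeff_x (by omega) hdc ha] at h7
      rw [← h7, Multiset.prod_map_pow, evalP_pow, pow_mul, mul_pow,
        show c - 3 = (c - d) + (d - 3) by omega, pow_add]
      ring
  · intro z u' hu' hz
    obtain rfl := Ultrafilter.coe_le_coe.1 hu'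
    rcases ultrafilter_tendsto_or u' z with ⟨z₀, hz₀⟩ | hinf
    · have h1 := hp.coeffTendsto.eval hN hz₀
      have h2 : (residualPoly f p₀).eval z₀ = 0 :=
        tendsto_nhds_unique h1 (tendsto_const_nhds.congr' (hz.mono fun a ha => ha.symm))
      have hz0 : z₀ ≠ 0 := by rintro rfl; exact hr0 h2
      refine isTheta_of_tendsto_ne_zero (hp.coeffTendsto.derivative.eval (fun a =>
        (Polynomial.natDegree_derivative_le _).trans ((Nat.sub_le _ _).trans (hN a))) hz₀)
        ((hz₀.const_sub 0).pow _) (h.separable_residual h0 hv (by simp [tdir, hy]) h2)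
        (pow_ne_zero _ (by simpa using hz0))
    · have hc0 : c ≠ 0 := by omega
      choose e he using fun a => IsAlgClosed.exists_pow_nat_eq (z a)⁻¹ (Nat.pos_of_ne_zero hc0)
      have hinv : Tendsto (fun a => (z a)⁻¹) u' (𝓝 0) :=
        tendsto_inv₀_cobounded.comp (tendsto_norm_atTop_iff_cobounded.1 hinf)
      have he0 : Tendsto e u' (𝓝 0) := by
        rw [Metric.tendsto_nhds] at hinv ⊢
        intro r hr
        filter_upwards [hinv (r ^ c) (pow_pos hr c)] with a ha
        rw [← he a, dist_zero_right, norm_pow] at ha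
        rw [dist_zero_right]
        exact lt_of_pow_lt_pow_left₀ c hr.le ha
      have hz0 : ∀ᶠ a in (u' : Filter ℂ), z a ≠ 0 :=
        (hinf.eventually_gt_atTop 0).mono fun a ha => norm_pos_iff.1 ha
      set y : ℂ → ℂ := fun a => e a ^ c * ((p a).2 + z a * (tdir f (p a)).2) with hydef
      set x : ℂ → ℂ := fun a => e a ^ d * ((p a).1 + z a * (tdir f (p a)).1) with hxdef
      have hp2 : Tendsto (fun a => (p a).2) u' (𝓝 p₀.2) := (continuous_snd.tendsto _).comp hp.tendsto
      have hp1 : Tendsto (fun a => (p a).1) u' (𝓝 p₀.1) := (continuous_fst.tendsto _).comp hp.tendsto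
      have hv2 : Tendsto (fun a => (tdir f (p a)).2) u' (𝓝 (tdir f p₀).2) :=
        (continuous_snd.tendsto _).comp hp.tendsto_tdir
      have hylim : Tendsto y u' (𝓝 (tdir f p₀).2) := by
        have h1 := ((he0.pow c).mul hp2).add hv2
        rw [zero_pow hc0, zero_mul, zero_add] at h1
        refine h1.congr' (hz0.mono fun a ha => ?_)
        simp only [hydef, he]
        field_simp
      have hev : ∀ᶠ a in (u' : Filter ℂ), evalP (deform c d (e a) f) (x a, y a) = 0 ∧
          (Polynomial.derivative (residualPoly f (p a))).eval (z a) = z a ^ (d - 3) *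
          ((x a - e a ^ d * (p a).1) * evalP (pderiv 0 (deform c d (e a) f)) (x a, y a)
          + (y a - e a ^ c * (p a).2) * evalP (pderiv 1 (deform c d (e a) f)) (x a, y a)) := by
        filter_upwards [hz0, hz, hp.zero] with a h1 h2 h3
        exact h.wt.derivative_residual_eq (by omega) (by rw [he, inv_mul_cancel₀ h1]) h3 h2 rfl rfl
          (by omega)
      have hT := coeffTendsto_lineRestrict_deform c d f he0
        ((tendsto_const_nhds (x := (0 : ℂ))).prodMk_nhds hylim)
        (tendsto_const_nhds (x := ((1 : ℂ), (0 : ℂ))))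
      obtain ⟨x₀, hx₀, hx₀'⟩ := hT.tendsto_root (N := c) (z := x)
        (fun a => (h.wt.deform _).natDegree_lineRestrict_le (by omega) hdc _ _)
        (by
          rw [(h.wt.deform _).coeff_lineRestrict (by omega) hdc, coeff_deform_x]
          simpa using h.coeff_x)
        (hev.mono fun a ha => by simpa [eval_lineRestrict] using ha.1)
      rw [eval_lineRestrict] at hx₀'
      simp only [mul_one, mul_zero, zero_add, add_zero] at hx₀'
      have hne : (x₀, (tdir f p₀).2) ≠ 0 := fun h1 => hx (by simpa [tdir] using congrArg Prod.snd h1)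
      have hM := h.position_dot_ne_zero (by omega) (by omega) (by omega) hne hx₀'
      have hw := (hx₀.sub ((he0.pow d).mul hp1)).prodMk_nhds (hylim.sub ((he0.pow c).mul hp2))
      have hMt := coeffTendsto_lineRestrict_deform c d f he0 (hx₀.prodMk_nhds hylim) hw 1
      simp only [coeff_one_lineRestrict, zero_pow hc0, zero_pow (show d ≠ 0 by omega), zero_mul,
        sub_zero] at hMt
      have hΘ := (isTheta_refl (fun a => (0 - z a) ^ (d - 3)) (u' : Filter ℂ)).mul
        (isTheta_one_of_tendsto (hMt.const_mul ((-1) ^ (d - 3)))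
          (mul_ne_zero (pow_ne_zero _ (by norm_num)) hM))
      simp only [mul_one] at hΘ
      refine (EventuallyEq.isTheta ?_).trans hΘ
      filter_upwards [hev] with a ha
      rw [ha.2, ← mul_assoc, ← mul_pow]
      ring

end VerticalTangents

section DegreeAtInfinity

open Filter Topology Asymptotics

theorem WtLe.residual_scale {c d : ℕ} {f : MvPolynomial (Fin 2) ℂ} (h : WtLe c d f)
    (hcd : c + d ≤ c * d) {ε : ℂ} (hε : ε ≠ 0) (p : ℂ × ℂ) :
    residualPoly f (ε⁻¹ ^ d * p.1, ε⁻¹ ^ c * p.2)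
      = Polynomial.C (ε⁻¹ ^ (c * d + 2 * (c * d - (c + d)))) *
        (residualPoly (_root_.deform c d ε f) p).comp
          (Polynomial.C (ε⁻¹ ^ (c * d - (c + d))) * Polynomial.X) := by
  ext n
  rw [Polynomial.coeff_C_mul, Polynomial.comp_C_mul_X_coeff, _root_.coeff_residual,
    _root_.coeff_residual, h.coeff_lineRestrict_tdir_scale hcd hε]
  ring

theorem WtLe.evalP_pderiv_one_scale {c d : ℕ} {f : MvPolynomial (Fin 2) ℂ} (h : WtLe c d f)
    (hcd : c + d ≤ c * d) {ε : ℂ} (hε : ε ≠ 0) (y : ℂ) :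
    evalP (pderiv 1 f) (ε⁻¹ ^ d, ε⁻¹ ^ c * y)
      = ε⁻¹ ^ (c * d - c) * (tdir (_root_.deform c d ε f) (1, y)).1 := by
  have h1 := congrArg Prod.fst (h.tdir_scale hcd hε (1, y))
  simp only [mul_one, ← mul_assoc, ← pow_add] at h1
  rw [show c * d - c = d + (c * d - (c + d)) by omega, ← h1]
  rfl

theorem IsInfBranch.isTheta_pderiv_one {c d : ℕ} {f : MvPolynomial (Fin 2) ℂ} {y₀ : ℂ}
    {u : Ultrafilter ℂ} {y : ℂ → ℂ} (h : IsInfBranch c d f y₀ u y) (hf : Nondegenerate c d f)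
    (hcd : c + d ≤ c * d) :
    (fun ε => evalP (pderiv 1 f) (ε⁻¹ ^ d, ε⁻¹ ^ c * y ε)) =Θ[u] fun ε => ε⁻¹ ^ (c * d - c) := by
  have h1 := (continuous_fst.tendsto _).comp h.tendsto_tdir
  have h2 := (isTheta_refl (fun ε : ℂ => ε⁻¹ ^ (c * d - c)) u).mul
    (isTheta_one_of_tendsto h1 (hf.edge _ h.zero_lim))
  simp only [mul_one] at h2
  refine (EventuallyEq.isTheta ?_).trans h2
  filter_upwards [h.le self_mem_nhdsWithin] with ε hε
  exact hf.wt.evalP_pderiv_one_scale hcd hε _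

theorem IsInfBranch.isTheta_tangentResultant {c d : ℕ} {f : MvPolynomial (Fin 2) ℂ} {y₀ : ℂ}
    {u : Ultrafilter ℂ} {y : ℂ → ℂ} (h : IsInfBranch c d f y₀ u y) (hf : Nondegenerate c d f)
    (hd : 5 ≤ d) (hdc : d < c) :
    (fun ε => evalP (tangentResultant c f) (ε⁻¹ ^ d, ε⁻¹ ^ c * y ε)) =Θ[u] fun ε =>
      ε⁻¹ ^ ((c * d - c) * c * (c - 3) + (c * d + 3 * (c * d - (c + d))) * (c - 2)) := by
  have hcd : c + d ≤ c * d := by nlinarith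
  have hΘ := h.isTheta_pderiv_one hf hcd
  have hye : ∀ᶠ ε in (u : Filter ℂ), evalP (pderiv 1 f) (ε⁻¹ ^ d, ε⁻¹ ^ c * y ε) ≠ 0 := by
    filter_upwards [hΘ.eq_zero_iff, h.le self_mem_nhdsWithin] with ε h1 hε h2
    exact pow_ne_zero _ (inv_ne_zero hε) (h1.1 h2)
  have hN : ∀ ε, (residualPoly (deform c d ε f) (1, y ε)).natDegree ≤ c - 2 := fun a =>
    (hf.wt.deform _).natDegree_residual_le (by omega) hdc _
  have hT : CoeffTendsto (fun ε => residualPoly (deform c d ε f) (1, y ε)) u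
    (residualPoly (deform c d 0 f) (1, y₀)) := h.coeffTendsto.divX.divX
  have hprod := isTheta_prod_roots (l := (u : Filter ℂ))
    (P := fun ε => residualPoly f (ε⁻¹ ^ d, ε⁻¹ ^ c * y ε)) (N := c - 2)
    (g := fun ε z => (Polynomial.derivative
      (residualPoly f (ε⁻¹ ^ d, ε⁻¹ ^ c * y ε))).eval z)
    (h := fun ε _ => ε⁻¹ ^ (c * d + 3 * (c * d - (c + d))))
    (hye.mono fun a ha => hf.wt.natDegree_residual hf.coeff_x (by omega) hdc ha)
    (hye.mono fun a ha => hf.wt.residual_ne_zero hf.coeff_x (by omega) hdc ha) ?_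
  · have h5 := (((hΘ.pow c).const_mul_left hf.coeff_x).pow (c - 3)).mul hprod
    refine (EventuallyEq.isTheta ?_).trans (h5.trans (EventuallyEq.isTheta ?_))
    · filter_upwards [hye] with ε hε
      exact hf.wt.evalP_tangentResultant hf.coeff_x (by omega) hdc hε
    · filter_upwards [hye] with ε hε
      rw [Multiset.map_const', Multiset.prod_replicate,
        Polynomial.splits_iff_card_roots.1 (IsAlgClosed.splits _),
        hf.wt.natDegree_residual hf.coeff_x (by omega) hdc hε]
      simp only [← pow_mul, ← pow_add]
  · intro z u' hu' hz
    obtain rfl := Ultrafilter.coe_le_coe.1 hu'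
    have hε : ∀ᶠ ε : ℂ in (u' : Filter ℂ), ε ≠ 0 := h.le self_mem_nhdsWithin
    have hscale : ∀ ε : ℂ, ε ≠ 0 → residualPoly f (ε⁻¹ ^ d, ε⁻¹ ^ c * y ε) = _ := fun ε hε => by
      have := hf.wt.residual_scale hcd hε (1, y ε)
      simp only [mul_one] at this
      exact this
    obtain ⟨τ, hτ, hτ'⟩ := hT.tendsto_root (z := fun ε => ε⁻¹ ^ (c * d - (c + d)) * z ε) hN
      (by
        rw [(hf.wt.deform _).coeff_residual (by omega) hdc, coeff_deform_x]
        exact mul_ne_zero hf.coeff_x (pow_ne_zero _ (hf.edge _ h.zero_lim)))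
      (by
        filter_upwards [hε, hz] with ε hε hz
        rw [hscale ε hε, Polynomial.eval_mul, Polynomial.eval_C] at hz
        simpa using (mul_eq_zero.1 hz).resolve_left (pow_ne_zero _ (inv_ne_zero hε)))
    have hder := hT.derivative.eval (fun a => (Polynomial.natDegree_derivative_le _).trans
      ((Nat.sub_le _ _).trans (hN a))) hτ
    have h2 := (isTheta_refl (fun ε : ℂ => ε⁻¹ ^ (c * d + 3 * (c * d - (c + d)))) u').mul
      (isTheta_one_of_tendsto hder
        (hf.separable_residual_leadingForm (by omega) (by omega) (by omega) (by simp)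
          h.zero_lim hτ').2)
    simp only [mul_one] at h2
    refine (EventuallyEq.isTheta ?_).trans h2
    filter_upwards [hε] with ε hε
    rw [hscale ε hε]
    simp only [Polynomial.derivative_mul, Polynomial.derivative_C, Polynomial.derivative_comp,
      Polynomial.derivative_X, Polynomial.eval_mul, Polynomial.eval_C, Polynomial.eval_comp,
      Polynomial.eval_X, zero_mul, zero_add, mul_one]
    ring

end DegreeAtInfinity

section BitangentCount

open Filter Topology Asymptotics

/-- The points of `{f = 0}` whose tangent line is tangent to the curve at another point. -/
def bitangentPts (f : MvPolynomial (Fin 2) ℂ) : Set (ℂ × ℂ) :=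
  {p | evalP f p = 0 ∧ ∃ t : ℂ, t ≠ 0 ∧
    Contact f (p.1 + t * (tdir f p).1, p.2 + t * (tdir f p).2) (tdir f p) 2}

theorem Nondegenerate.mem_bitangentPts_iff {c d : ℕ} {f : MvPolynomial (Fin 2) ℂ}
    (h : Nondegenerate c d f) {p : ℂ × ℂ} (h0 : evalP f p = 0) :
    p ∈ bitangentPts f ↔ ∃ t, (Polynomial.X - Polynomial.C t) ^ 2 ∣ residualPoly f p := by
  refine ⟨fun ⟨_, t, ht, h2⟩ => ⟨t, (contact_iff_residual h0 ht 2).1 h2⟩, fun ⟨t, ht⟩ => ?_⟩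
  obtain ⟨ht0, h2⟩ := h.double_root h0 (h.tdir_ne_zero h0) ht
  exact ⟨h0, t, ht0, h2⟩

theorem Nondegenerate.tdir_bitangent {c d : ℕ} {f : MvPolynomial (Fin 2) ℂ}
    (h : Nondegenerate c d f) {p : ℂ × ℂ} (hp : p ∈ bitangentPts f) :
    (tdir f p).1 ≠ 0 ∧ (tdir f p).2 ≠ 0 := by
  obtain ⟨h0, t, ht, h2⟩ := hp
  exact (h.two_two p _ t (h.tdir_ne_zero h0) ht (contact_tdir h0) h2).1

theorem WtLe.tangentResultant_eq_zero_iff {c d : ℕ} {f : MvPolynomial (Fin 2) ℂ} (h : WtLe c d f)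
    (hx : coeff (exponent c 0) f ≠ 0) (hd : 2 ≤ d) (hdc : d < c) {p : ℂ × ℂ}
    (hp : evalP (pderiv 1 f) p ≠ 0) :
    evalP (tangentResultant c f) p = 0
      ↔ ∃ t, (Polynomial.X - Polynomial.C t) ^ 2 ∣ residualPoly f p := by
  rw [h.evalP_tangentResultant hx hd hdc hp, mul_eq_zero, Multiset.prod_eq_zero_iff,
    or_iff_right (pow_ne_zero _ (mul_ne_zero hx (pow_ne_zero _ hp)))]
  simp only [Multiset.mem_map, Polynomial.mem_roots (h.residual_ne_zero hx hd hdc hp),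
    X_sub_C_sq_dvd_iff, Polynomial.IsRoot]

theorem Nondegenerate.ncard_bitangentPts {c d : ℕ} {f : MvPolynomial (Fin 2) ℂ}
    (h : Nondegenerate c d f) (hd : 5 ≤ d) (hdc : d < c) :
    (bitangentPts f).Finite ∧ (bitangentPts f).ncard + 11 * (c * d)
      = c ^ 2 * d ^ 2 + 6 * c + 6 * d := by
  have hcd : c + d ≤ c * d := by nlinarith
  obtain ⟨NG, hNG⟩ := h.wt.exists_isNorm (by omega) (by omega) h.coeff_y (tangentResultant c f)
  obtain ⟨NB, hNB⟩ := h.wt.exists_isNorm (by omega) (by omega) h.coeff_y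
    (pderiv 1 f ^ (c * (c - d)))
  obtain ⟨hG0, hGw⟩ := natDegree_isNorm h.wt (by omega) (by omega) h.coeff_y hNG
    fun y₀ u y hy => hy.isTheta_tangentResultant h hd hdc
  obtain ⟨hB0, hBw⟩ := natDegree_isNorm h.wt (by omega) (by omega) h.coeff_y hNB
    (w := (c * d - c) * (c * (c - d))) fun y₀ u y hy => by
      simp only [evalP_pow, pow_mul _ (c * d - c)]
      exact (hy.isTheta_pderiv_one h hcd).pow _
  have hmain := ncard_eq_of_isNorm h.wt (by omega) (by omega) h.coeff_y hNG hNB hG0 hB0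
    (bitangentPts f) (fun p hp => ⟨hp.1, fun h2 => (h.tdir_bitangent hp).2 (by simp [tdir, h2])⟩)
    (fun p₀ hp₀ u p hp => ?_) (fun p₀ hp₀ u p hp => ?_)
  · refine ⟨hmain.1, ?_⟩
    have h1 := hmain.2
    rw [hGw, hBw] at h1
    zify at h1 ⊢
    rw [Nat.cast_sub (by omega), Nat.cast_sub (by omega), Nat.cast_sub (by omega),
      Nat.cast_sub (by omega), Nat.cast_sub (by omega)] at h1
    push_cast at h1 ⊢
    linear_combination h1
  · by_cases hy : evalP (pderiv 1 f) p₀ = 0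
    · exact h.isTheta_tangentResultant_vertical hd hdc hp hy
    · refine isTheta_of_tendsto_ne_zero (hp.tendsto_evalP _) (hp.tendsto_evalP _) (fun h2 => ?_)
        (by rw [evalP_pow]; exact pow_ne_zero _ hy)
      rw [h.wt.tangentResultant_eq_zero_iff h.coeff_x (by omega) hdc hy,
        ← h.mem_bitangentPts_iff hp.eval_eq_zero] at h2
      exact hp₀ h2
  · obtain ⟨t, ht⟩ := (h.mem_bitangentPts_iff hp₀.1).1 hp₀
    have h1 := (isTheta_one_of_tendsto (hp.tendsto_evalP (pderiv 1 f ^ (c * (c - d)))) (by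
      rw [evalP_pow]; exact pow_ne_zero _ (h.tdir_bitangent hp₀).1)).symm.mul
      (h.isTheta_tangentResultant_double hd hdc hp ht)
    simp only [one_mul] at h1
    exact h1

theorem mem_lineThrough_self (p w : ℂ × ℂ) : p ∈ lineThrough p w := ⟨0, by ext <;> simp⟩

theorem lineThrough_eq_of_mem {p q v w : ℂ × ℂ} {μ : ℂ} (hq : q ∈ lineThrough p w) (hμ : μ ≠ 0)
    (hv : v = (μ * w.1, μ * w.2)) : lineThrough q v = lineThrough p w := by
  obtain ⟨s, rfl⟩ := hq
  subst hv
  ext x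
  constructor
  · rintro ⟨t, rfl⟩
    exact ⟨s + t * μ, by ext <;> ring⟩
  · rintro ⟨t, rfl⟩
    refine ⟨(t - s) * μ⁻¹, ?_⟩
    ext <;> field_simp <;> ring

theorem exists_smul_of_lineThrough_eq {p q v w : ℂ × ℂ} (hv : v ≠ 0)
    (h : lineThrough q v = lineThrough p w) :
    ∃ μ : ℂ, μ ≠ 0 ∧ v = (μ * w.1, μ * w.2) := by
  obtain ⟨s, hs⟩ : q ∈ lineThrough p w := h ▸ mem_lineThrough_self q v
  obtain ⟨t, ht⟩ : (q.1 + v.1, q.2 + v.2) ∈ lineThrough p w := h ▸ ⟨1, by simp⟩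
  have h1 : v = ((t - s) * w.1, (t - s) * w.2) := by
    have h2 := congrArg Prod.fst ht
    have h3 := congrArg Prod.snd ht
    rw [hs] at h2 h3
    ext
    · simp only at h2 ⊢; linear_combination h2
    · simp only at h3 ⊢; linear_combination h3
  refine ⟨t - s, fun h2 => hv ?_, h1⟩
  rw [h1, h2]
  simp

theorem Contact.of_smul {f : MvPolynomial (Fin 2) ℂ} {p w : ℂ × ℂ} {k : ℕ} {μ : ℂ} (hμ : μ ≠ 0)
    (h : Contact f p (μ * w.1, μ * w.2) k) : Contact f p w k := by
  have h1 := h.smul μ⁻¹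
  simpa only [inv_mul_cancel_left₀ hμ] using h1

/-- The tangent line of `{f = 0}` at `p`. -/
def tangentLine (f : MvPolynomial (Fin 2) ℂ) (p : ℂ × ℂ) : Set (ℂ × ℂ) := lineThrough p (tdir f p)

theorem Nondegenerate.exists_smul_tdir {c d : ℕ} {f : MvPolynomial (Fin 2) ℂ}
    (h : Nondegenerate c d f) {p w : ℂ × ℂ} (hw : w ≠ 0) (h2 : Contact f p w 2) :
    ∃ μ : ℂ, μ ≠ 0 ∧ w = (μ * (tdir f p).1, μ * (tdir f p).2) := by
  obtain ⟨h0, h1⟩ := contact_two_iff.1 h2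
  obtain ⟨μ, hμ⟩ := eq_smul_tdir (h.smooth p h0) h1
  refine ⟨μ, ?_, hμ⟩
  rintro rfl
  exact hw (by rw [hμ]; simp)

theorem Nondegenerate.mem_bitangentPts_of_contact {c d : ℕ} {f : MvPolynomial (Fin 2) ℂ}
    (h : Nondegenerate c d f) {p w : ℂ × ℂ} {t : ℂ} (hw : w ≠ 0) (ht : t ≠ 0)
    (h1 : Contact f p w 2) (h2 : Contact f (p.1 + t * w.1, p.2 + t * w.2) w 2) :
    p ∈ bitangentPts f ∧ tangentLine f p = lineThrough p w := by
  obtain ⟨μ, hμ, rfl⟩ := h.exists_smul_tdir hw h1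
  refine ⟨⟨(contact_two_iff.1 h1).1, t * μ, mul_ne_zero ht hμ, ?_⟩,
    (lineThrough_eq_of_mem (mem_lineThrough_self _ _) hμ rfl).symm⟩
  simp only [← mul_assoc] at h2
  exact h2.of_smul hμ

theorem contact_symm {f : MvPolynomial (Fin 2) ℂ} {p w : ℂ × ℂ} {k : ℕ} (h : Contact f p w k)
    (t : ℂ) : Contact f ((p.1 + t * w.1, p.2 + t * w.2).1 + -t * w.1,
      (p.1 + t * w.1, p.2 + t * w.2).2 + -t * w.2) w k := by
  convert h using 1
  ext <;> ring

theorem Nondegenerate.bitangentLines_eq {c d : ℕ} {f : MvPolynomial (Fin 2) ℂ}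
    (h : Nondegenerate c d f) : bitangentLines f = tangentLine f '' bitangentPts f := by
  ext l
  constructor
  · rintro ⟨p, w, _, _, hw, rfl, ⟨⟨s₁, rfl⟩, -⟩, ⟨⟨s₂, rfl⟩, -⟩, hne, h1, h2⟩
    rw [← Nat.cast_ofNat, le_interMult_iff] at h1 h2
    have hs : s₂ - s₁ ≠ 0 := fun hs => hne (by rw [sub_eq_zero.1 hs])
    obtain ⟨h3, h4⟩ := h.mem_bitangentPts_of_contact hw hs h1 (by
      convert h2 using 1
      ext <;> simp only <;> ring)
    refine ⟨_, h3, h4.trans (lineThrough_eq_of_mem ⟨s₁, rfl⟩ one_ne_zero (by simp))⟩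
  · rintro ⟨p, ⟨h0, t, ht, h2⟩, rfl⟩
    have hv := h.tdir_ne_zero h0
    have h1 := contact_tdir h0
    refine ⟨p, tdir f p, p, _, hv, rfl, ⟨mem_lineThrough_self _ _, (h.two_two _ _ t hv ht h1 h2).2⟩,
      ⟨⟨t, rfl⟩, (h.two_two _ _ (-t) hv (neg_ne_zero.2 ht) h2 (contact_symm h1 t)).2⟩, fun h3 => ?_,
      le_interMult_iff.2 h1, le_interMult_iff.2 h2⟩
    have h4 := congrArg Prod.fst h3
    simp only [left_eq_add, mul_eq_zero, ht, (h.two_two _ _ t hv ht h1 h2).1.1, or_self] at h4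

theorem Nondegenerate.fibre_tangentLine {c d : ℕ} {f : MvPolynomial (Fin 2) ℂ}
    (h : Nondegenerate c d f) {p : ℂ × ℂ} (hp : p ∈ bitangentPts f) :
    {q ∈ bitangentPts f | tangentLine f q = tangentLine f p}.ncard = 2 := by
  obtain ⟨h0, t, ht, h2⟩ := id hp
  have hv := h.tdir_ne_zero h0
  have h1 := contact_tdir h0
  obtain ⟨h3, h4⟩ := h.mem_bitangentPts_of_contact hv (neg_ne_zero.2 ht) h2 (contact_symm h1 t)
  rw [Set.ncard_eq_two]
  refine ⟨p, _, fun h5 => ?_, Set.Subset.antisymm ?_ (Set.insert_subset ⟨hp, rfl⟩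
    (Set.singleton_subset_iff.2 ⟨h3, h4.trans (lineThrough_eq_of_mem ⟨t, rfl⟩ one_ne_zero
      (by simp))⟩))⟩
  · have h6 := congrArg Prod.fst h5
    simp only [left_eq_add, mul_eq_zero, ht, (h.tdir_bitangent hp).1, or_self] at h6
  · rintro q ⟨hq, hqp⟩
    obtain ⟨μ, hμ, hqv⟩ := exists_smul_of_lineThrough_eq (h.tdir_ne_zero hq.1) hqp
    obtain ⟨s, rfl⟩ : q ∈ tangentLine f p := hqp ▸ mem_lineThrough_self q _
    have hcq := contact_tdir hq.1
    rw [hqv] at hcq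
    by_cases hs : s = 0
    · left; ext <;> simp [hs]
    by_cases hst : s = t
    · right; rw [hst]; rfl
    · exact absurd h2 (h.two_two_two p _ s t hv hs ht hst h1 (hcq.of_smul hμ))

theorem Nondegenerate.ncard_bitangentLines {c d : ℕ} {f : MvPolynomial (Fin 2) ℂ}
    (h : Nondegenerate c d f) (hfin : (bitangentPts f).Finite) :
    (bitangentLines f).Finite ∧ 2 * (bitangentLines f).ncard = (bitangentPts f).ncard := by
  classical
  rw [h.bitangentLines_eq]
  refine ⟨hfin.image _, ?_⟩
  have h1 : (tangentLine f '' bitangentPts f) = ↑(hfin.toFinset.image (tangentLine f)) := by simp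
  rw [h1, Set.ncard_coe_finset, Set.ncard_eq_toFinset_card _ hfin,
    Finset.card_eq_sum_card_image (tangentLine f), mul_comm, ← smul_eq_mul]
  refine (Finset.sum_eq_card_nsmul fun l hl => ?_).symm
  obtain ⟨p, hp, rfl⟩ := Finset.mem_image.1 hl
  rw [← h.fibre_tangentLine (hfin.mem_toFinset.1 hp), ← Set.ncard_coe_finset]
  congr 1
  ext q
  simp

end BitangentCount

section SwapCoordinates

/-- The polynomial `f(y, x)`. -/
def swapVars (f : MvPolynomial (Fin 2) ℂ) : MvPolynomial (Fin 2) ℂ :=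
  rename (Equiv.swap (0 : Fin 2) 1) f

theorem evalP_swapVars (f : MvPolynomial (Fin 2) ℂ) (p : ℂ × ℂ) :
    evalP (swapVars f) p = evalP f p.swap := by
  rw [evalP, swapVars, eval_rename, evalP]
  congr 2
  funext i
  fin_cases i <;> simp

theorem lineRestrict_swapVars (f : MvPolynomial (Fin 2) ℂ) (p w : ℂ × ℂ) :
    lineRestrict (swapVars f) p w = lineRestrict f p.swap w.swap := by
  rw [lineRestrict, swapVars, aeval_rename, lineRestrict]
  congr 2
  funext i
  fin_cases i <;> simp

theorem interMult_swapVars (f : MvPolynomial (Fin 2) ℂ) (p w : ℂ × ℂ) :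
    interMult (swapVars f) p w = interMult f p.swap w.swap := by
  simp only [interMult, lineRestrict_swapVars]

theorem swapVars_swapVars (f : MvPolynomial (Fin 2) ℂ) : swapVars (swapVars f) = f := by
  rw [swapVars, swapVars, rename_rename]
  have h : (⇑(Equiv.swap (0 : Fin 2) 1) ∘ ⇑(Equiv.swap (0 : Fin 2) 1)) = id := by
    funext i
    simp
  rw [h, rename_id_apply]

theorem coeff_swapVars (f : MvPolynomial (Fin 2) ℂ) (m : Fin 2 →₀ ℕ) :
    coeff (m.mapDomain (Equiv.swap (0 : Fin 2) 1)) (swapVars f) = coeff m f :=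
  coeff_rename_mapDomain _ (Equiv.injective _) _ _

theorem coeffAt_swapVars (f : MvPolynomial (Fin 2) ℂ) (k : ℤ × ℤ) :
    coeffAt (swapVars f) k = coeffAt f k.swap := by
  have h : Finsupp.single (0 : Fin 2) k.1.toNat + Finsupp.single (1 : Fin 2) k.2.toNat
      = (Finsupp.single (0 : Fin 2) k.2.toNat + Finsupp.single (1 : Fin 2) k.1.toNat).mapDomain
        (Equiv.swap (0 : Fin 2) 1) := by
    simp [Finsupp.mapDomain_add, Finsupp.mapDomain_single, add_comm]
  rw [coeffAt, coeffAt, h, coeff_swapVars]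
  simp only [Prod.fst_swap, Prod.snd_swap, and_comm]

theorem SuppIn.swapVars {f : MvPolynomial (Fin 2) ℂ} {S : Set (ℤ × ℤ)} (h : SuppIn f S) :
    SuppIn (swapVars f) (Prod.swap ⁻¹' S) := fun m hm => by
  classical
  rw [_root_.swapVars, support_rename_of_injective (Equiv.injective _), Finset.mem_image] at hm
  obtain ⟨n, hn, rfl⟩ := hm
  have h0 := Finsupp.mapDomain_apply (Equiv.injective (Equiv.swap (0 : Fin 2) 1)) n 0
  have h1 := Finsupp.mapDomain_apply (Equiv.injective (Equiv.swap (0 : Fin 2) 1)) n 1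
  rw [Equiv.swap_apply_left] at h0
  rw [Equiv.swap_apply_right] at h1
  rw [Set.mem_preimage, h0, h1]
  exact h n hn

theorem GenericOn.swapVars {S : Set (ℤ × ℤ)} {Q : MvPolynomial (Fin 2) ℂ → Prop}
    (h : GenericOn S Q) : GenericOn (Prod.swap ⁻¹' S) (fun f => Q (swapVars f)) := by
  obtain ⟨D, hD, hQ⟩ := h
  let e : S → (Prod.swap ⁻¹' S : Set (ℤ × ℤ)) := fun k => ⟨k.1.swap, by simp⟩
  have he : Function.Injective e := fun a b hab =>
    Subtype.ext (Prod.swap_injective (Subtype.ext_iff.1 hab))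
  refine ⟨rename e D, (map_ne_zero_iff _ (rename_injective e he)).2 hD, fun f hf hDf => ?_⟩
  refine hQ _ (by simpa [← Set.preimage_comp] using hf.swapVars) ?_
  rw [eval_rename] at hDf
  simp only [coeffAt_swapVars]
  exact hDf

theorem preimage_swap_qhExponents (c d : ℕ) :
    Prod.swap ⁻¹' qhExponents c d = qhExponents d c := by
  ext ⟨i, j⟩
  simp only [qhExponents, Set.mem_preimage, Set.mem_ofPred_eq, Prod.swap_prod_mk]
  rw [and_left_comm, add_comm, mul_comm (d : ℤ) (c : ℤ)]

theorem swap_mem_torus {p : ℂ × ℂ} : p.swap ∈ Torus ↔ p ∈ Torus := and_comm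

theorem inflPts_swapVars (f : MvPolynomial (Fin 2) ℂ) :
    inflPts (swapVars f) = Prod.swap '' inflPts f := by
  rw [Set.image_swap_eq_preimage_swap]
  ext p
  simp only [inflPts, Set.mem_preimage, Set.mem_ofPred_eq, swap_mem_torus, evalP_swapVars,
    interMult_swapVars]
  refine and_congr_right' (and_congr_right' ⟨fun ⟨w, hw, h⟩ => ⟨w.swap, ?_, h⟩,
    fun ⟨w, hw, h⟩ => ⟨w.swap, ?_, by simpa using h⟩⟩) <;>
  exact fun h0 => hw (Prod.swap_injective h0)

theorem image_swap_lineThrough (p w : ℂ × ℂ) :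
    Prod.swap '' lineThrough p w = lineThrough p.swap w.swap := by
  ext q
  rw [Set.image_swap_eq_preimage_swap]
  simp only [lineThrough, Set.mem_preimage, Set.mem_ofPred_eq, Prod.ext_iff, Prod.fst_swap,
    Prod.snd_swap, and_comm]

theorem image_swap_bitangentLines_subset (f : MvPolynomial (Fin 2) ℂ) :
    Set.image Prod.swap '' bitangentLines f ⊆ bitangentLines (swapVars f) := by
  rintro _ ⟨_, ⟨p, w, q₁, q₂, hw, rfl, h1, h2, hne, h3, h4⟩, rfl⟩
  refine ⟨p.swap, w.swap, q₁.swap, q₂.swap, fun h0 => hw (Prod.swap_injective h0),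
    image_swap_lineThrough p w, ⟨?_, swap_mem_torus.2 h1.2⟩, ⟨?_, swap_mem_torus.2 h2.2⟩,
    fun h => hne (Prod.swap_injective h), ?_, ?_⟩
  · rw [← image_swap_lineThrough]; exact Set.mem_image_of_mem _ h1.1
  · rw [← image_swap_lineThrough]; exact Set.mem_image_of_mem _ h2.1
  · simpa [interMult_swapVars] using h3
  · simpa [interMult_swapVars] using h4

theorem bitangentLines_swapVars (f : MvPolynomial (Fin 2) ℂ) :
    bitangentLines (swapVars f) = Set.image Prod.swap '' bitangentLines f := by
  refine Set.Subset.antisymm (fun l hl => ?_) (image_swap_bitangentLines_subset f)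
  have h := image_swap_bitangentLines_subset (swapVars f) ⟨l, hl, rfl⟩
  rw [swapVars_swapVars] at h
  exact ⟨_, h, by rw [Set.image_image]; simp⟩

end SwapCoordinates

/-- The number of inflection points and the number of bitangents of `{f = 0}` in the torus,
for a curve of degree `(c, d)`. -/
def HasQuasihomogeneousCounts (c d : ℕ) (f : MvPolynomial (Fin 2) ℂ) : Prop :=
  (inflPts f).Finite ∧ ((inflPts f).ncard : ℚ) = 3 * c * d - 2 * c - 2 * d ∧
    (bitangentLines f).Finite ∧ ((bitangentLines f).ncard : ℚ)
      = ((c : ℚ) ^ 2 * (d : ℚ) ^ 2 - 11 * c * d + 6 * c + 6 * d) / 2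

theorem HasQuasihomogeneousCounts.of_swapVars {c d : ℕ} {f : MvPolynomial (Fin 2) ℂ}
    (h : HasQuasihomogeneousCounts d c (swapVars f)) : HasQuasihomogeneousCounts c d f := by
  obtain ⟨h1, h2, h3, h4⟩ := h
  have hinj : Function.Injective (Set.image (Prod.swap : ℂ × ℂ → ℂ × ℂ)) :=
    Set.image_injective.2 Prod.swap_injective
  rw [inflPts_swapVars] at h1 h2
  rw [bitangentLines_swapVars] at h3 h4
  rw [Set.ncard_image_of_injective _ Prod.swap_injective] at h2
  rw [Set.ncard_image_of_injective _ hinj] at h4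
  refine ⟨h1.of_finite_image Prod.swap_injective.injOn, ?_, h3.of_finite_image hinj.injOn, ?_⟩
  · rw [h2]; ring
  · rw [h4]; ring

theorem Nondegenerate.hasQuasihomogeneousCounts {c d : ℕ} {f : MvPolynomial (Fin 2) ℂ}
    (h : Nondegenerate c d f) (hd : 5 ≤ d) (hdc : d < c) : HasQuasihomogeneousCounts c d f := by
  obtain ⟨h1, h2⟩ := h.ncard_inflPts (by omega) hd hdc.ne'
  obtain ⟨h3, h4⟩ := h.ncard_bitangentPts hd hdc
  obtain ⟨h5, h6⟩ := h.ncard_bitangentLines h3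
  refine ⟨h1, ?_, h5, ?_⟩
  · have h2' : ((inflPts f).ncard : ℚ) + 2 * c + 2 * d = 3 * (c * d) := by exact_mod_cast h2
    linear_combination h2'
  · have h4' : ((bitangentPts f).ncard : ℚ) + 11 * (c * d) = c ^ 2 * d ^ 2 + 6 * c + 6 * d := by
      exact_mod_cast h4
    have h6' : 2 * ((bitangentLines f).ncard : ℚ) = (bitangentPts f).ncard := by exact_mod_cast h6
    linear_combination h6' / 2 + h4' / 2

theorem quasihomogeneous_count (c d : ℕ) (hc : 5 ≤ c) (hd : 5 ≤ d) (hcd : c ≠ d) :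
    GenericOn {k : ℤ × ℤ | 0 ≤ k.1 ∧ 0 ≤ k.2 ∧ (d : ℤ) * k.1 + (c : ℤ) * k.2 ≤ (c : ℤ) * (d : ℤ)}
      (fun f =>
        (inflPts f).Finite ∧
        ((inflPts f).ncard : ℚ) = 3 * c * d - 2 * c - 2 * d ∧
        (bitangentLines f).Finite ∧
        ((bitangentLines f).ncard : ℚ)
          = ((c : ℚ) ^ 2 * (d : ℚ) ^ 2 - 11 * c * d + 6 * c + 6 * d) / 2) := by
  rcases lt_or_gt_of_ne hcd with h | h
  · have h1 := ((genericOn_nondegenerate hd hc).mono fun f _ hf =>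
      hf.hasQuasihomogeneousCounts hc h :
        GenericOn (qhExponents d c) (HasQuasihomogeneousCounts d c)).swapVars
    rw [preimage_swap_qhExponents] at h1
    exact h1.mono fun f _ hf => hf.of_swapVars
  · exact (genericOn_nondegenerate hc hd).mono fun f _ hf => hf.hasQuasihomogeneousCounts hd h

end
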